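/- Let L and L' be non-degenerate even lattices with rank L ≥ 3, having the same signature (t₊, t₋), and suppose there is a group isomorphism A(L) ≅ A(L') identifying the discriminant quadratic forms q(L) and q(L'). If L ≅ U(n) ⊕ L'' for some positive integer n and some lattice L'', then L ≅ L' (i.e. the genus of L consists of a single isomorphism class). -/

import Mathlib

/-- The dual lattice `L^∨ = {x ∈ L ⊗ ℚ | ⟨x,y⟩ ∈ ℤ for all y ∈ L}` of a full lattice
`L` in the ambient rational vector space `V = L ⊗ ℚ`. -/
def dualLattice {V : Type*} [AddCommGroup V] [Module ℚ V]
    (Φ : V →ₗ[ℚ] V →ₗ[ℚ] ℚ) (L : Submodule ℤ V) : Submodule ℤ V where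
  carrier := {x | ∀ y ∈ L, ∃ n : ℤ, Φ x y = (n : ℚ)}
  add_mem' := by
    intro a b ha hb y hy
    obtain ⟨n, hn⟩ := ha y hy
    obtain ⟨m, hm⟩ := hb y hy
    exact ⟨n + m, by rw [map_add, LinearMap.add_apply, hn, hm]; push_cast; ring⟩
  zero_mem' := by
    intro y hy
    exact ⟨0, by simp⟩
  smul_mem' := by
    intro c x hx y hy
    obtain ⟨n, hn⟩ := hx y hy
    refine ⟨c * n, ?_⟩
    rw [← Int.cast_smul_eq_zsmul ℚ c x, map_smul, LinearMap.smul_apply, hn, smul_eq_mul]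
    push_cast; ring

/-- The discriminant group `A(L) = L^∨/L` of a full lattice `L`. -/
abbrev discGroup {V : Type*} [AddCommGroup V] [Module ℚ V]
    (Φ : V →ₗ[ℚ] V →ₗ[ℚ] ℚ) (L : Submodule ℤ V) : Type _ :=
  ↥(dualLattice Φ L) ⧸ Submodule.comap (dualLattice Φ L).subtype L

/-- A non-degenerate rational bilinear form `Φ` has signature `(tp, tm)` iff it admits an
orthogonal basis with `tp` vectors of positive square and `tm` vectors of negative
square (equivalently, the ℝ-extension has `tp` positive and `tm` negative eigenvalues). -/
def hasSignature {V : Type*} [AddCommGroup V] [Module ℚ V]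
    (Φ : V →ₗ[ℚ] V →ₗ[ℚ] ℚ) (tp tm : ℕ) : Prop :=
  ∃ b : Module.Basis (Fin (tp + tm)) ℚ V,
    (∀ i j, i ≠ j → Φ (b i) (b j) = 0) ∧
    ∀ i : Fin (tp + tm),
      ((i : ℕ) < tp → 0 < Φ (b i) (b i)) ∧ (tp ≤ (i : ℕ) → Φ (b i) (b i) < 0)


namespace Nik
open Module

/-- diagonal bilinear form with weights `w` -/
def bf {ι : Type} [Fintype ι] (w : ι → ℚ) : LinearMap.BilinForm ℚ (ι → ℚ) :=
  LinearMap.mk₂ ℚ (fun x y => ∑ i, w i * x i * y i)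
    (by intro a b c; simp only [Pi.add_apply, ← Finset.sum_add_distrib]
        exact Finset.sum_congr rfl fun i _ => by ring)
    (by intro a b c; simp only [Pi.smul_apply, smul_eq_mul, Finset.mul_sum]
        exact Finset.sum_congr rfl fun i _ => by ring)
    (by intro a b c; simp only [Pi.add_apply, ← Finset.sum_add_distrib]
        exact Finset.sum_congr rfl fun i _ => by ring)
    (by intro a b c; simp only [Pi.smul_apply, smul_eq_mul, Finset.mul_sum]
        exact Finset.sum_congr rfl fun i _ => by ring)

lemma bf_apply {ι : Type} [Fintype ι] (w : ι → ℚ) (x y : ι → ℚ) :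
    bf w x y = ∑ i, w i * x i * y i := rfl

lemma bf_symm {ι : Type} [Fintype ι] (w : ι → ℚ) (x y : ι → ℚ) :
    bf w x y = bf w y x := by
  simp only [bf_apply]; exact Finset.sum_congr rfl fun i _ => by ring

lemma bf_isSymm {ι : Type} [Fintype ι] (w : ι → ℚ) : (bf w).IsSymm :=
  ⟨fun x y => by simpa using bf_symm w x y⟩

lemma bf_single {ι : Type} [Fintype ι] [DecidableEq ι] (w : ι → ℚ) (x : ι → ℚ) (i : ι) (c : ℚ) :
    bf w x (Pi.single i c) = w i * x i * c := by
  rw [bf_apply, Finset.sum_eq_single i]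
  · simp
  · intro j _ hj; simp [Pi.single_eq_of_ne hj]
  · simp

lemma bf_nondeg {ι : Type} [Fintype ι] (w : ι → ℚ) (hw : ∀ i, w i ≠ 0) :
    (bf w).Nondegenerate := by
  classical
  have key : ∀ x, (∀ y, bf w x y = 0) → x = 0 := by
    intro x hx
    funext i
    have := hx (Pi.single i 1)
    rw [bf_single] at this
    simpa [hw i] using this
  refine ⟨key, ?_⟩
  intro x hx
  exact key x fun y => by rw [bf_symm]; exact hx y

/-- `w` is metabolic -/
def MetW {ι : Type} [Fintype ι] (w : ι → ℚ) : Prop :=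
  ∃ N : Submodule ℚ (ι → ℚ), (∀ x ∈ N, ∀ y ∈ N, bf w x y = 0) ∧
    Fintype.card ι ≤ 2 * finrank ℚ N

lemma MetW_reindex {ι κ : Type} [Fintype ι] [Fintype κ] (e : ι ≃ κ) (w : ι → ℚ) (w' : κ → ℚ)
    (h : ∀ i, w' (e i) = w i) (hm : MetW w) : MetW w' := by
  obtain ⟨N, h1, h2⟩ := hm
  let E : (ι → ℚ) ≃ₗ[ℚ] (κ → ℚ) := LinearEquiv.funCongrLeft ℚ ℚ e.symm
  have hE : ∀ x y, bf w' (E x) (E y) = bf w x y := by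
    intro x y
    simp only [bf_apply]
    rw [← e.sum_comp]
    refine Finset.sum_congr rfl fun i _ => ?_
    simp [E, LinearEquiv.funCongrLeft_apply, LinearMap.funLeft_apply, h]
  refine ⟨N.map (E : (ι → ℚ) →ₗ[ℚ] (κ → ℚ)), ?_, ?_⟩
  · rintro _ ⟨x, hx, rfl⟩ _ ⟨y, hy, rfl⟩
    exact (hE x y).trans (h1 x hx y hy)
  · rw [LinearEquiv.finrank_map_eq, ← Fintype.card_congr e]; exact h2

lemma bf_sum {ι κ : Type} [Fintype ι] [Fintype κ] (w : ι → ℚ) (w' : κ → ℚ) (x y : ι ⊕ κ → ℚ) :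
    bf (Sum.elim w w') x y = bf w (x ∘ Sum.inl) (y ∘ Sum.inl) + bf w' (x ∘ Sum.inr) (y ∘ Sum.inr) := by
  simp [bf_apply, Fintype.sum_sum_type]

lemma MetW_add {ι κ : Type} [Fintype ι] [Fintype κ] (w : ι → ℚ) (w' : κ → ℚ)
    (h : MetW w) (h' : MetW w') : MetW (Sum.elim w w') := by
  obtain ⟨N, h1, h2⟩ := h
  obtain ⟨N', h1', h2'⟩ := h'
  let E : ((ι → ℚ) × (κ → ℚ)) ≃ₗ[ℚ] (ι ⊕ κ → ℚ) := (LinearEquiv.sumArrowLequivProdArrow ι κ ℚ ℚ).symm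
  refine ⟨(N.prod N').map (E : _ →ₗ[ℚ] _), ?_, ?_⟩
  · rintro _ ⟨⟨x, x'⟩, hx, rfl⟩ _ ⟨⟨y, y'⟩, hy, rfl⟩
    rw [bf_sum]
    have e1 : ∀ a b, (E (a, b)) ∘ Sum.inl = a := by intro a b; funext i; simp [E]
    have e2 : ∀ a b, (E (a, b)) ∘ Sum.inr = b := by intro a b; funext i; simp [E]
    simp only [LinearEquiv.coe_coe, e1, e2]
    rw [h1 _ hx.1 _ hy.1, h1' _ hx.2 _ hy.2, add_zero]
  · rw [LinearEquiv.finrank_map_eq, Fintype.card_sum]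
    have : finrank ℚ (N.prod N') = finrank ℚ N + finrank ℚ N' := by
      rw [← Module.finrank_prod]
      exact LinearEquiv.finrank_eq
        { toFun := fun x => (⟨x.1.1, x.2.1⟩, ⟨x.1.2, x.2.2⟩)
          invFun := fun y => ⟨(y.1.1, y.2.1), ⟨y.1.2, y.2.2⟩⟩
          map_add' := fun _ _ => rfl
          map_smul' := fun _ _ => rfl
          left_inv := fun _ => rfl
          right_inv := fun _ => rfl }
    omega

/-- An isotropic subspace of at least half dimension is its own orthogonal. -/
lemma lagr {V : Type*} [AddCommGroup V] [Module ℚ V] [FiniteDimensional ℚ V]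
    (B : LinearMap.BilinForm ℚ V) (hB : B.Nondegenerate) (N : Submodule ℚ V)
    (h1 : ∀ x ∈ N, ∀ y ∈ N, B x y = 0) (h2 : finrank ℚ V ≤ 2 * finrank ℚ N) :
    B.orthogonal N = N ∧ finrank ℚ V = 2 * finrank ℚ N := by
  have hle : N ≤ B.orthogonal N := by
    intro y hy x hx
    exact h1 x hx y hy
  have hf := LinearMap.BilinForm.finrank_orthogonal hB N
  have h3 := Submodule.finrank_mono hle
  have h4 := Submodule.finrank_le N
  refine ⟨(Submodule.eq_of_le_of_finrank_le hle (by omega)).symm, by omega⟩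

lemma MetW_cancel {ι κ : Type} [Fintype ι] [Fintype κ] (w : ι → ℚ) (w' : κ → ℚ)
    (hw : ∀ i, w i ≠ 0) (hw' : ∀ i, w' i ≠ 0)
    (h : MetW (Sum.elim w w')) (h' : MetW w') : MetW w := by
  obtain ⟨N, h1, h2⟩ := h
  obtain ⟨N0, h3, h4⟩ := h'
  have hnd : (bf (Sum.elim w w')).Nondegenerate :=
    bf_nondeg _ (by rintro (i | i) <;> simp [hw, hw'])
  obtain ⟨h5, h6⟩ := lagr (bf w') (bf_nondeg w' hw') N0 h3 (by simpa using h4)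
  let j : (κ → ℚ) →ₗ[ℚ] (ι ⊕ κ → ℚ) :=
    { toFun := fun m => Sum.elim 0 m
      map_add' := fun x y => by funext i; rcases i with i | i <;> simp
      map_smul' := fun c y => by funext i; rcases i with i | i <;> simp }
  have hj : Function.Injective j := by
    intro x y hxy; funext i; exact congrFun hxy (Sum.inr i)
  have hbj : ∀ m x, bf (Sum.elim w w') (j m) x = bf w' m (x ∘ Sum.inr) := by
    intro m x; rw [bf_sum]
    have e1 : (j m) ∘ Sum.inl = 0 := by funext i; rfl
    have e2 : (j m) ∘ Sum.inr = m := by funext i; rfl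
    rw [e1, e2]; simp
  let fs : (ι ⊕ κ → ℚ) →ₗ[ℚ] (ι → ℚ) := LinearMap.funLeft ℚ ℚ Sum.inl
  let sn : (ι ⊕ κ → ℚ) →ₗ[ℚ] (κ → ℚ) := LinearMap.funLeft ℚ ℚ Sum.inr
  let T := (bf (Sum.elim w w')).orthogonal (N0.map j)
  have hT : ∀ x, x ∈ T → x ∘ Sum.inr ∈ N0 := by
    intro x hx
    rw [← h5]
    intro m hm
    have := hx (j m) ⟨m, hm, rfl⟩
    rw [hbj] at this
    exact this
  let K : Submodule ℚ (κ → ℚ) := N0 ⊓ N.comap j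
  let P := N ⊓ T
  have d1 := Submodule.finrank_sup_add_finrank_inf_eq N T
  have d2 : finrank ℚ T = _ := LinearMap.BilinForm.finrank_orthogonal hnd (N0.map j)
  have d3 := LinearMap.BilinForm.finrank_orthogonal hnd (K.map j)
  have d4 : N ⊔ T ≤ (bf (Sum.elim w w')).orthogonal (K.map j) := by
    rw [sup_le_iff]
    constructor
    · rintro x hx _ ⟨m, hm, rfl⟩
      exact h1 _ hm.2 _ hx
    · rintro x hx _ ⟨m, hm, rfl⟩
      exact hx _ ⟨m, hm.1, rfl⟩
  have d5 := Submodule.finrank_mono d4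
  have d6 : finrank ℚ (N0.map j) = finrank ℚ N0 := (Submodule.equivMapOfInjective j hj N0).finrank_eq.symm
  have d7 : finrank ℚ (K.map j) = finrank ℚ K := (Submodule.equivMapOfInjective j hj K).finrank_eq.symm
  have d8 := LinearMap.finrank_range_add_finrank_ker (fs.domRestrict P)
  have d9 : finrank ℚ (LinearMap.ker (fs.domRestrict P)) ≤ finrank ℚ K := by
    let φ : LinearMap.ker (fs.domRestrict P) →ₗ[ℚ] K :=
      LinearMap.codRestrict K (sn ∘ₗ P.subtype ∘ₗ (LinearMap.ker (fs.domRestrict P)).subtype) (by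
        rintro ⟨⟨x, hx⟩, hx0⟩
        have hx0' : x ∘ Sum.inl = 0 := hx0
        refine ⟨hT x hx.2, ?_⟩
        change Sum.elim (0 : ι → ℚ) (x ∘ Sum.inr) ∈ N
        rw [← hx0', Sum.elim_comp_inl_inr]
        exact hx.1)
    refine LinearMap.finrank_le_finrank_of_injective (f := φ) ?_
    rintro ⟨⟨x, hx⟩, hx0⟩ ⟨⟨y, hy⟩, hy0⟩ hxy
    have hx0' : x ∘ Sum.inl = 0 := hx0
    have hy0' : y ∘ Sum.inl = 0 := hy0
    have hxy' : x ∘ Sum.inr = y ∘ Sum.inr := congrArg Subtype.val hxy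
    simp only [Subtype.mk.injEq]
    rw [← Sum.elim_comp_inl_inr x, ← Sum.elim_comp_inl_inr y, hx0', hy0', hxy']
  have d10 : finrank ℚ (ι ⊕ κ → ℚ) = Fintype.card ι + Fintype.card κ := by simp
  have d11 : finrank ℚ (κ → ℚ) = Fintype.card κ := by simp
  refine ⟨LinearMap.range (fs.domRestrict P), ?_, ?_⟩
  · rintro _ ⟨⟨x, hx⟩, rfl⟩ _ ⟨⟨y, hy⟩, rfl⟩
    have := h1 x hx.1 y hy.1
    rw [bf_sum, h3 _ (hT x hx.2) _ (hT y hy.2), add_zero] at this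
    exact this
  · have hP : finrank ℚ P = finrank ℚ (N ⊓ T : Submodule ℚ _) := rfl
    have := Submodule.finrank_le (K.map j)
    have := Submodule.finrank_le (N0.map j)
    simp only [Fintype.card_sum] at h2
    omega

/-- the multiset of weights -/
def ms {ι : Type} [Fintype ι] (w : ι → ℚˣ) : Multiset ℚˣ := ∑ i, {w i}

lemma ms_sum {ι κ : Type} [Fintype ι] [Fintype κ] (w : ι → ℚˣ) (w' : κ → ℚˣ) :
    ms (Sum.elim w w') = ms w + ms w' := by simp [ms, Fintype.sum_sum_type]

lemma ms_equiv {ι κ : Type} [Fintype ι] [Fintype κ] (w : ι → ℚˣ) (w' : κ → ℚˣ)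
    (h : ms w = ms w') : ∃ e : ι ≃ κ, ∀ i, w' (e i) = w i := by
  classical
  have hc : ∀ c, Fintype.card {a // w a = c} = Fintype.card {b // w' b = c} := by
    intro c
    have := congrArg (Multiset.count c) h
    simp only [ms, Multiset.count_sum', Multiset.count_singleton, Finset.sum_boole] at this
    simp only [Fintype.card_subtype]
    simpa [eq_comm] using this
  refine ⟨Equiv.ofFiberEquiv (fun c => Fintype.equivOfCardEq (hc c)), ?_⟩
  intro i
  exact Equiv.ofFiberEquiv_map _ i

/-- metabolic multisets -/
def Met (s : Multiset ℚˣ) : Prop :=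
  ∃ (n : ℕ) (w : Fin n → ℚˣ), ms w = s ∧ MetW (fun i => (w i : ℚ))

lemma Met_iff {ι : Type} [Fintype ι] (w : ι → ℚˣ) : Met (ms w) ↔ MetW (fun i => (w i : ℚ)) := by
  constructor
  · rintro ⟨n, w', h1, h2⟩
    obtain ⟨e, he⟩ := ms_equiv w' w h1
    exact MetW_reindex e _ _ (fun i => by simp [he]) h2
  · intro h
    let e := Fintype.equivFin ι
    refine ⟨_, w ∘ e.symm, ?_, MetW_reindex e _ _ (fun i => by simp) h⟩
    simp only [ms, Function.comp]
    exact e.symm.sum_comp (fun i => ({w i} : Multiset ℚˣ))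

lemma ms_rep (s : Multiset ℚˣ) : ∃ (n : ℕ) (w : Fin n → ℚˣ), ms w = s := by
  induction s using Multiset.induction_on with
  | empty => exact ⟨0, Fin.elim0, by simp [ms]⟩
  | cons a s ih =>
    obtain ⟨n, w, rfl⟩ := ih
    refine ⟨n + 1, Fin.cons a w, ?_⟩
    simp [ms, Fin.sum_univ_succ]

lemma ms_neg {ι : Type} [Fintype ι] (w : ι → ℚˣ) : (ms w).map Neg.neg = ms (fun i => - w i) := by
  unfold ms
  rw [← Multiset.coe_mapAddMonoidHom, map_sum]
  simp

lemma elim_coe {ι κ : Type} (w : ι → ℚˣ) (w' : κ → ℚˣ) :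
    (fun i => ((Sum.elim w w' i : ℚˣ) : ℚ)) = Sum.elim (fun i => (w i : ℚ)) (fun i => (w' i : ℚ)) := by
  funext i; rcases i with i | i <;> rfl

lemma Met_add {s t : Multiset ℚˣ} (hs : Met s) (ht : Met t) : Met (s + t) := by
  obtain ⟨n, w, rfl, h1⟩ := hs
  obtain ⟨m, w', rfl, h2⟩ := ht
  rw [← ms_sum, Met_iff, elim_coe]
  exact MetW_add _ _ h1 h2

lemma Met_cancel {s t : Multiset ℚˣ} (hs : Met (s + t)) (ht : Met t) : Met s := by
  obtain ⟨n, w, rfl⟩ := ms_rep s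
  obtain ⟨m, w', rfl⟩ := ms_rep t
  rw [← ms_sum, Met_iff, elim_coe] at hs
  rw [Met_iff] at ht ⊢
  exact MetW_cancel _ _ (fun i => (w i).ne_zero) (fun i => (w' i).ne_zero) hs ht

lemma Met_self_neg (s : Multiset ℚˣ) : Met (s + s.map Neg.neg) := by
  obtain ⟨n, w, rfl⟩ := ms_rep s
  rw [ms_neg, ← ms_sum, Met_iff, elim_coe]
  let d : (Fin n → ℚ) →ₗ[ℚ] (Fin n ⊕ Fin n → ℚ) := LinearMap.funLeft ℚ ℚ (Sum.elim id id)
  refine ⟨LinearMap.range d, ?_, ?_⟩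
  · rintro _ ⟨x, rfl⟩ _ ⟨y, rfl⟩
    rw [bf_sum]
    simp only [bf_apply, ← Finset.sum_add_distrib]
    refine Finset.sum_eq_zero fun i _ => ?_
    simp [d, LinearMap.funLeft_apply]
  · rw [LinearMap.finrank_range_of_inj]
    · simp; omega
    · intro x y h; funext i; exact congrFun h (Sum.inl i)

lemma Met_neg {s : Multiset ℚˣ} (hs : Met s) : Met (s.map Neg.neg) := by
  obtain ⟨n, w, rfl, N, h1, h2⟩ := hs
  rw [ms_neg, Met_iff]
  refine ⟨N, fun x hx y hy => ?_, h2⟩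
  have := h1 x hx y hy
  simp only [bf_apply] at this ⊢
  simpa [neg_mul] using this

lemma map_neg_neg (s : Multiset ℚˣ) : (s.map Neg.neg).map Neg.neg = s := by simp

/-- Witt equivalence -/
def wittCon : AddCon (Multiset ℚˣ) where
  r s t := Met (s + t.map Neg.neg)
  iseqv := by
    refine ⟨Met_self_neg, ?_, ?_⟩
    · intro s t h
      have := Met_neg h
      rwa [Multiset.map_add, map_neg_neg, add_comm] at this
    · intro s t u h1 h2
      have h3 := Met_add h1 h2
      have : s + Multiset.map Neg.neg t + (t + Multiset.map Neg.neg u)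
        = (s + Multiset.map Neg.neg u) + (t + Multiset.map Neg.neg t) := by abel
      rw [this] at h3
      exact Met_cancel h3 (Met_self_neg t)
  add' := by
    intro s t u v h1 h2
    have h3 := Met_add h1 h2
    rw [Multiset.map_add]
    have : s + Multiset.map Neg.neg t + (u + Multiset.map Neg.neg v)
        = (s + u) + (Multiset.map Neg.neg t + Multiset.map Neg.neg v) := by abel
    rwa [this] at h3

lemma wittCon_iff (s t : Multiset ℚˣ) : wittCon s t ↔ Met (s + t.map Neg.neg) := Iff.rfl

/-- Witt group of the rationals -/
abbrev WQ : Type := wittCon.Quotient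

instance : Neg WQ := ⟨fun x => AddCon.liftOn x (fun s => ((s.map Neg.neg : Multiset ℚˣ) : WQ)) (by
  intro s t h
  rw [AddCon.eq, wittCon_iff]
  have := Met_neg h
  rwa [Multiset.map_add] at this)⟩

lemma WQ_neg_coe (s : Multiset ℚˣ) : -(s : WQ) = ((s.map Neg.neg : Multiset ℚˣ) : WQ) := rfl

lemma WQ_zero_iff (s : Multiset ℚˣ) : (s : WQ) = 0 ↔ Met s := by
  rw [← AddCon.coe_zero, AddCon.eq, wittCon_iff]; simp

instance : AddCommGroup WQ :=
  { (inferInstance : AddCommMonoid WQ) with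
    neg := Neg.neg
    zsmul := zsmulRec
    neg_add_cancel := by
      intro x
      induction x using AddCon.induction_on with
      | H s =>
        rw [WQ_neg_coe, ← AddCon.coe_add, WQ_zero_iff, add_comm]
        exact Met_self_neg s }

open Classical in
/-- class of a one-dimensional form -/
noncomputable def qc (x : ℚ) : WQ :=
  if h : x = 0 then 0 else (({Units.mk0 x h} : Multiset ℚˣ) : WQ)

lemma qc_unit (u : ℚˣ) : qc u = (({u} : Multiset ℚˣ) : WQ) := by
  simp [qc, u.ne_zero]

lemma qc_zero : qc 0 = 0 := by simp [qc]

lemma sum_qc_unit {ι : Type} [Fintype ι] (w : ι → ℚˣ) : ∑ i, qc (w i) = (ms w : WQ) := by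
  simp only [qc_unit, ms]
  exact (map_sum (AddCon.mk' wittCon) (fun i => ({w i} : Multiset ℚˣ)) Finset.univ).symm

lemma sum_qc_eq_zero {ι : Type} [Fintype ι] (w : ι → ℚ) (hw : ∀ i, w i ≠ 0) :
    ∑ i, qc (w i) = 0 ↔ MetW w := by
  have := sum_qc_unit (fun i => Units.mk0 (w i) (hw i))
  simp only [Units.val_mk0] at this
  rw [this, WQ_zero_iff, Met_iff]
  simp

lemma qc_neg (x : ℚ) : qc (-x) = - qc x := by
  by_cases h : x = 0
  · subst h; simp [qc_zero]
  · lift x to ℚˣ using isUnit_iff_ne_zero.mpr h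
    have : (-(x : ℚ)) = ((-x : ℚˣ) : ℚ) := by simp
    rw [this, qc_unit, qc_unit, WQ_neg_coe]; simp

lemma MetW_of_vec2 (w : Fin 2 → ℚ) (x : Fin 2 → ℚ) (hx : x ≠ 0) (h : bf w x x = 0) : MetW w := by
  refine ⟨Submodule.span ℚ {x}, ?_, ?_⟩
  · intro a ha b hb
    obtain ⟨c, rfl⟩ := Submodule.mem_span_singleton.mp ha
    obtain ⟨d, rfl⟩ := Submodule.mem_span_singleton.mp hb
    simp [h]
  · rw [finrank_span_singleton hx]; simp

lemma qc_sq (x y : ℚ) (hy : y ≠ 0) : qc (x * y ^ 2) = qc x := by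
  by_cases h : x = 0
  · subst h; simp
  have : ∑ i, qc ((![x * y ^ 2, -x] : Fin 2 → ℚ) i) = 0 := by
    rw [sum_qc_eq_zero]
    · refine MetW_of_vec2 _ ![1, y] (by intro h; simpa using congrFun h 0) ?_
      simp [bf_apply, Fin.sum_univ_two]; ring
    · intro i; fin_cases i <;> simp [h, hy]
  simp only [Fin.sum_univ_two, Matrix.cons_val_zero, Matrix.cons_val_one, qc_neg] at this
  exact add_neg_eq_zero.mp this

lemma qc_add (a b : ℚ) (ha : a ≠ 0) (hb : b ≠ 0) (hab : a + b ≠ 0) :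
    qc a + qc b = qc (a + b) + qc (a * b * (a + b)) := by
  have : ∑ i, qc ((![a, b, -(a+b), -(a*b*(a+b))] : Fin 4 → ℚ) i) = 0 := by
    rw [sum_qc_eq_zero]
    · have hli : LinearIndependent ℚ ![(![1, 1, 1, 0] : Fin 4 → ℚ), ![b, -a, 0, 1]] := by
        rw [LinearIndependent.pair_iff]
        intro s t h
        have h2 := congrFun h 2
        have h3 := congrFun h 3
        simp at h2 h3
        exact ⟨h2, h3⟩
      refine ⟨Submodule.span ℚ (Set.range ![(![1, 1, 1, 0] : Fin 4 → ℚ), ![b, -a, 0, 1]]), ?_, ?_⟩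
      · intro x hx y hy
        rw [Submodule.mem_span_range_iff_exists_fun] at hx hy
        obtain ⟨c, rfl⟩ := hx
        obtain ⟨d, rfl⟩ := hy
        simp [bf_apply, Fin.sum_univ_four, Fin.sum_univ_two]; ring
      · rw [finrank_span_eq_card hli]; simp
    · intro i; fin_cases i <;> simp [ha, hb]
      · intro h; apply hab; linarith
      · exact hab
  simp only [Fin.sum_univ_four, Matrix.cons_val_zero, Matrix.cons_val_one, Matrix.cons_val, qc_neg] at this
  have h2 : qc a + qc b - (qc (a+b) + qc (a*b*(a+b))) = 0 := by rw [← this]; abel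
  exact sub_eq_zero.mp h2

end Nik


namespace Nik
open Module

/-- nonzero integers all of whose prime divisors are `< p` -/
def sm (p : ℕ) (n : ℤ) : Prop := n ≠ 0 ∧ ∀ q : ℕ, q.Prime → (q : ℤ) ∣ n → q < p

lemma sm_mul {p : ℕ} {m n : ℤ} (hm : sm p m) (hn : sm p n) : sm p (m * n) := by
  refine ⟨mul_ne_zero hm.1 hn.1, fun q hq h => ?_⟩
  rcases (Nat.prime_iff_prime_int.mp hq).dvd_or_dvd h with h | h
  · exact hm.2 q hq h
  · exact hn.2 q hq h

lemma sm_neg {p : ℕ} {m : ℤ} (hm : sm p m) : sm p (-m) :=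
  ⟨neg_ne_zero.mpr hm.1, fun q hq h => hm.2 q hq ((dvd_neg).mp h)⟩

lemma sm_lt {p : ℕ} {m : ℤ} (h0 : m ≠ 0) (h : |m| < p) : sm p m := by
  refine ⟨h0, fun q hq hd => ?_⟩
  have := Int.le_of_dvd (abs_pos.mpr h0) ((dvd_abs _ _).mpr hd)
  omega

lemma sm_of_dvd {p : ℕ} {m n : ℤ} (hn : sm p n) (h : m ∣ n) : sm p m :=
  ⟨fun h0 => hn.1 (by subst h0; exact zero_dvd_iff.mp h), fun q hq hd => hn.2 q hq (hd.trans h)⟩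

lemma sm_one {p : ℕ} : sm p 1 := by
  refine ⟨one_ne_zero, fun q hq h => ?_⟩
  have : (q : ℤ) ∣ ((1 : ℕ) : ℤ) := by simpa using h
  rw [Int.natCast_dvd_natCast] at this
  exact absurd (Nat.dvd_one.mp this) (Nat.Prime.ne_one hq)

/-- filtration of the Witt group -/
noncomputable def SS (p : ℕ) : AddSubgroup WQ :=
  AddSubgroup.closure {x | ∃ n : ℤ, sm p n ∧ x = qc n}

lemma mem_SS {p : ℕ} {n : ℤ} (h : sm p n) : qc n ∈ SS p :=
  AddSubgroup.subset_closure ⟨n, h, rfl⟩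

lemma zmod2_one : ∀ u : ZMod 2, u ≠ 0 → u = 1 := by decide

lemma sqf_neg {a : ℤ} (h : Squarefree a) : Squarefree (-a) :=
  fun x hx => h x ((dvd_neg).mp hx)

lemma step {p : ℕ} (hp : p.Prime) {x y l c : ℤ} (hx : sm p x) (hy : sm p y) (hc : sm p c)
    (hl : l = 0 ∨ sm p l) (h : x = y + p * l) :
    qc ((p * x * c : ℤ)) - qc ((p * y * c : ℤ)) ∈ SS p := by
  rcases hl with rfl | hl
  · simp at h; subst h; simp
  have hp0 : (p : ℚ) ≠ 0 := by exact_mod_cast hp.ne_zero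
  have hx0 : (x : ℚ) ≠ 0 := by exact_mod_cast hx.1
  have hy0 : (y : ℚ) ≠ 0 := by exact_mod_cast hy.1
  have hc0 : (c : ℚ) ≠ 0 := by exact_mod_cast hc.1
  have hl0 : (l : ℚ) ≠ 0 := by exact_mod_cast hl.1
  have hxq : (x : ℚ) = y + p * l := by exact_mod_cast h
  have e1 : (p * y * c : ℚ) + (p * p * l * c) = p * x * c := by rw [hxq]; ring
  have key := qc_add (p * y * c) (p * p * l * c) (by positivity) (by positivity) (by
    rw [e1]; positivity)
  rw [e1] at key
  have e2 : (p * p * l * c : ℚ) = ((l * c : ℤ) : ℚ) * p ^ 2 := by push_cast; ring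
  have e3 : (p * y * c : ℚ) * (p * p * l * c) * (p * x * c)
      = ((y * l * x * c : ℤ) : ℚ) * (p ^ 2 * c) ^ 2 := by push_cast; ring
  rw [e3, e2, qc_sq _ _ hp0, qc_sq _ _ (by positivity)] at key
  push_cast at key ⊢
  have : qc (p * x * c) - qc (p * y * c) = qc (l * c) - qc (y * l * x * c) := by
    rw [sub_eq_sub_iff_add_eq_add, ← key]; abel
  rw [this]
  refine sub_mem ?_ ?_
  · exact_mod_cast mem_SS (sm_mul hl hc)
  · exact_mod_cast mem_SS (sm_mul (sm_mul (sm_mul hy hl) hx) hc)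

lemma reduce {p : ℕ} (hp : p.Prime) (n : ℕ) : sm p n → ∀ m : ℕ, 0 < m → m < p →
    qc ((p * n * m : ℤ)) - qc ((p * ((n * m % p : ℕ) : ℤ) : ℤ)) ∈ SS p := by
  induction n using induction_on_primes with
  | zero => intro h; exact absurd rfl h.1
  | one =>
    intro _ m h0 hm
    rw [one_mul, Nat.mod_eq_of_lt hm]; simp
  | prime_mul q a hq ih =>
    intro h m h0 hm
    have hqp : q < p := h.2 q hq (by push_cast; exact dvd_mul_right _ _)
    have ha : sm p a := sm_of_dvd h (by push_cast; exact dvd_mul_left _ _)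
    have hm'0 : 0 < (q * m) % p := by
      rw [Nat.pos_iff_ne_zero]
      intro h1
      rcases (hp.dvd_mul).mp (Nat.dvd_of_mod_eq_zero h1) with h2 | h2
      · exact absurd (Nat.le_of_dvd hq.pos h2) (by omega)
      · exact absurd (Nat.le_of_dvd h0 h2) (by omega)
    have hm'1 : (q * m) % p < p := Nat.mod_lt _ hp.pos
    have ihm := ih ha _ hm'0 hm'1
    have hl : (q * m) / p < p := by
      rw [Nat.div_lt_iff_lt_mul hp.pos]
      exact Nat.mul_lt_mul_of_lt_of_lt hqp hm
    have hst := step hp (x := (q * m : ℕ)) (y := ((q * m) % p : ℕ)) (l := ((q * m) / p : ℕ)) (c := a)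
      (by push_cast; exact sm_mul (sm_lt (by exact_mod_cast hq.ne_zero) (by simpa using hqp))
            (sm_lt (by omega) (by simpa using hm)))
      (sm_lt (by omega) (by rw [Nat.abs_cast]; exact_mod_cast hm'1)) ha
      (by
        by_cases h1 : (q * m) / p = 0
        · left; exact_mod_cast h1
        · right; exact sm_lt (by exact_mod_cast h1) (by rw [Nat.abs_cast]; exact_mod_cast hl))
      (by exact_mod_cast (Nat.mod_add_div (q * m) p).symm)
    have e1 : (a * (q * m % p)) % p = (q * a * m) % p := by
      rw [Nat.mul_mod_mod]; congr 1; ring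
    rw [e1] at ihm
    have := add_mem hst ihm
    convert this using 1
    have e2 : (p * ((q * m : ℕ) : ℤ) * a : ℤ) = p * ((q * a : ℕ) : ℤ) * m := by push_cast; ring
    have e3 : ((p : ℤ) * ((q * m % p : ℕ) : ℤ) * a) = p * a * ((q * m % p : ℕ) : ℤ) := by ring
    rw [e2, e3]; abel

section theta
variable {p : ℕ} [hp : Fact p.Prime]

/-- the map `F_p → W/S_p` -/
noncomputable def th (u : ZMod p) : WQ ⧸ SS p := QuotientAddGroup.mk (qc ((p * (u.val : ℤ) : ℤ)))

lemma mk_eq_iff (x y : WQ) : (QuotientAddGroup.mk x : WQ ⧸ SS p) = QuotientAddGroup.mk y ↔ x - y ∈ SS p :=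
  QuotientAddGroup.eq_iff_sub_mem

lemma th_nat (n : ℕ) (h : sm p n) :
    (QuotientAddGroup.mk (qc ((p * n : ℤ))) : WQ ⧸ SS p) = th (n : ZMod p) := by
  rw [th, mk_eq_iff, ZMod.val_natCast]
  have := reduce hp.out n h 1 one_pos hp.out.one_lt
  simpa using this

lemma val_pos (u : ZMod p) (hu : u ≠ 0) : 0 < u.val := by
  rw [Nat.pos_iff_ne_zero]; rwa [Ne, ZMod.val_eq_zero]

lemma sm_val (u : ZMod p) (hu : u ≠ 0) : sm p u.val :=
  sm_lt (by have := val_pos u hu; omega) (by rw [Nat.abs_cast]; exact_mod_cast u.val_lt)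

lemma th_neg (u : ZMod p) (hu : u ≠ 0) : th (-u) = - th u := by
  have h1 := step hp.out (x := -(u.val : ℤ)) (y := (p - u.val : ℤ)) (l := -1) (c := 1)
    (sm_neg (sm_val u hu))
    (sm_lt (by have := u.val_lt; omega) (by
      have := u.val_lt; have := val_pos u hu; rw [abs_lt]; omega)) sm_one
    (Or.inr (sm_neg sm_one)) (by ring)
  rw [← mk_eq_iff] at h1
  have h2 : (-u).val = p - u.val := by
    rw [ZMod.neg_val, if_neg hu]
  rw [th, th, h2, Nat.cast_sub u.val_lt.le, ← QuotientAddGroup.mk_neg, ← qc_neg]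
  rw [← Int.cast_neg]
  simp only [mul_one] at h1
  rw [← h1]; congr 2; ring_nf

lemma th_int (n : ℤ) (h : sm p n) :
    (QuotientAddGroup.mk (qc ((p * n : ℤ))) : WQ ⧸ SS p) = th (n : ZMod p) := by
  rcases Int.eq_nat_or_neg n with ⟨k, rfl | rfl⟩
  · simpa using th_nat k h
  · have hk : sm p k := by simpa using sm_neg h
    have hk0 : (k : ZMod p) ≠ 0 := by
      intro h0
      rw [ZMod.natCast_eq_zero_iff] at h0
      exact absurd (hk.2 p hp.out (by exact_mod_cast h0)) (lt_irrefl _)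
    rw [Int.cast_neg, Int.cast_natCast, th_neg _ hk0, ← th_nat k hk, ← QuotientAddGroup.mk_neg, ← qc_neg]
    simp

lemma th_sq (u v : ZMod p) (hu : u ≠ 0) (hv : v ≠ 0) : th (u * v ^ 2) = th u := by
  have h := th_int (p := p) ((u.val : ℤ) * ((v.val : ℤ) * v.val))
    (sm_mul (sm_val u hu) (sm_mul (sm_val v hv) (sm_val v hv)))
  have h' := th_int (p := p) (u.val : ℤ) (sm_val u hu)
  push_cast at h h'
  rw [ZMod.natCast_zmod_val, ZMod.natCast_zmod_val] at h
  rw [ZMod.natCast_zmod_val] at h'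
  rw [show u * v ^ 2 = u * (v * v) by ring, ← h, ← h', ← qc_sq (p * (u.val : ℚ)) v.val (by have := val_pos v hv; positivity)]
  congr 2; ring

lemma th_add (u v : ZMod p) (hu : u ≠ 0) (hv : v ≠ 0) (huv : u + v ≠ 0) :
    th u + th v = th (u + v) + th (u * v * (u + v)) := by
  obtain ⟨a, ha⟩ : ∃ a : ℤ, a = u.val := ⟨_, rfl⟩
  obtain ⟨b, hb⟩ : ∃ b : ℤ, b = (v.val : ℤ) - p := ⟨_, rfl⟩
  have hau : (a : ZMod p) = u := by rw [ha]; simp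
  have hbv : (b : ZMod p) = v := by rw [hb]; simp
  have hab : a + b ≠ 0 := by
    intro h
    apply huv
    rw [← hau, ← hbv]; exact_mod_cast congrArg (Int.cast : ℤ → ZMod p) h
  have hu1 := u.val_lt
  have hv1 := v.val_lt
  have hu2 := val_pos u hu
  have hv2 := val_pos v hv
  have sa : sm p a := sm_lt (by omega) (by rw [abs_lt]; omega)
  have sb : sm p b := sm_lt (by omega) (by rw [abs_lt]; omega)
  have sab : sm p (a + b) := sm_lt hab (by rw [abs_lt]; omega)
  have h1 := th_int (p := p) a sa
  have h2 := th_int (p := p) b sb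
  have h3 := th_int (p := p) _ sab
  have h4 := th_int (p := p) _ (sm_mul (sm_mul sa sb) sab)
  push_cast at h1 h2 h3 h4
  rw [hau] at h1 h3 h4
  rw [hbv] at h2 h3 h4
  have hp0 : (p : ℚ) ≠ 0 := by exact_mod_cast hp.out.ne_zero
  have a0 : (a : ℚ) ≠ 0 := by exact_mod_cast sa.1
  have b0 : (b : ℚ) ≠ 0 := by exact_mod_cast sb.1
  have ab0 : (a + b : ℚ) ≠ 0 := by exact_mod_cast sab.1
  have key := qc_add (p * a) (p * b) (by positivity) (by positivity) (by
    rw [← mul_add]; exact mul_ne_zero hp0 ab0)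
  have e : (p * a : ℚ) * (p * b) * (p * a + p * b) = (p * (a * b * (a + b))) * p ^ 2 := by ring
  rw [e, qc_sq _ _ hp0, ← mul_add] at key
  rw [← h1, ← h2, ← h3, ← h4, ← QuotientAddGroup.mk_add, key, QuotientAddGroup.mk_add]

lemma th_mul (hp2 : p ≠ 2) (u v : ZMod p) (hu : u ≠ 0) (hv : v ≠ 0) :
    th u + th v = th 1 + th (u * v) := by
  obtain ⟨x, y, hxy⟩ : ∃ x y : ZMod p, u * x ^ 2 + v * y ^ 2 = 1 := by
    open Polynomial in
    obtain ⟨x, y, h⟩ := FiniteField.exists_root_sum_quadratic (R := ZMod p)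
      (f := C u * X ^ 2) (g := C v * X ^ 2 - C 1)
      (by rw [degree_C_mul_X_pow _ hu]; rfl)
      (by
        rw [degree_sub_C]
        · rw [degree_C_mul_X_pow _ hv]; rfl
        · rw [degree_C_mul_X_pow _ hv]; norm_num)
      (by rw [ZMod.card]; exact Nat.odd_iff.mp (hp.out.odd_of_ne_two hp2))
    refine ⟨x, y, ?_⟩
    simp at h
    linear_combination h
  by_cases hx : x = 0
  · have hy : y ≠ 0 := by rintro rfl; subst hx; simp at hxy
    subst hx
    have h1 : v * y ^ 2 = 1 := by simpa using hxy
    rw [← th_sq v y hv hy, h1, ← th_sq (u * v) y (mul_ne_zero hu hv) hy, mul_assoc, h1, mul_one, add_comm]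
  by_cases hy : y = 0
  · subst hy
    have h1 : u * x ^ 2 = 1 := by simpa using hxy
    rw [← th_sq u x hu hx, h1, ← th_sq (u * v) x (mul_ne_zero hu hv) hx]
    rw [show u * v * x ^ 2 = v * (u * x ^ 2) by ring, h1, mul_one]
  have := th_add (u * x ^ 2) (v * y ^ 2) (by positivity) (by positivity) (by rw [hxy]; exact one_ne_zero)
  rw [hxy, th_sq u x hu hx, th_sq v y hv hy] at this
  rw [this, mul_one, show u * x ^ 2 * (v * y ^ 2) = u * v * (x * y) ^ 2 by ring,
    th_sq _ _ (mul_ne_zero hu hv) (mul_ne_zero hx hy)]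

lemma th_four (hp2 : p ≠ 2) : (4 : ℕ) • (th 1 : WQ ⧸ SS p) = 0 := by
  have h := th_mul (p := p) hp2 (-1) (-1) (by simp) (by simp)
  rw [th_neg 1 one_ne_zero] at h
  simp only [mul_neg, mul_one, neg_neg] at h
  have : (4 : ℕ) • (th 1 : WQ ⧸ SS p) = (th 1 + th 1) - (- th 1 + - th 1) := by abel
  rw [this, h, sub_self]

lemma th_prod (hp2 : p ≠ 2) {ι : Type} (J : Finset ι) (b : ι → ZMod p) (hb : ∀ j ∈ J, b j ≠ 0) :
    ∑ j ∈ J, th (b j) + th 1 = J.card • th 1 + th (∏ j ∈ J, b j) := by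
  classical
  induction J using Finset.induction_on with
  | empty => simp
  | insert i J hi ih =>
    have ih' := ih (fun j hj => hb j (Finset.mem_insert_of_mem hj))
    rw [Finset.sum_insert hi, Finset.prod_insert hi, Finset.card_insert_of_notMem hi, add_assoc, ih',
      succ_nsmul, add_left_comm, th_mul hp2 (b i) _ (hb i (Finset.mem_insert_self _ _))
        (Finset.prod_ne_zero_iff.mpr fun j hj => hb j (Finset.mem_insert_of_mem hj))]
    abel

lemma th_sum_zero (hp2 : p ≠ 2) {ι : Type} (J : Finset ι) (b : ι → ZMod p) (hb : ∀ j ∈ J, b j ≠ 0)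
    (he : Even J.card) (hs : IsSquare ((-1) ^ (J.card / 2) * ∏ j ∈ J, b j)) :
    ∑ j ∈ J, th (b j) = 0 := by
  have h := th_prod hp2 J b hb
  obtain ⟨h2, hh⟩ := he
  obtain ⟨c, hc⟩ := hs
  have hP : ∏ j ∈ J, b j ≠ 0 := Finset.prod_ne_zero_iff.mpr hb
  have hc0 : c ≠ 0 := by
    rintro rfl
    simp at hc
    exact hP hc
  have e1 : J.card / 2 = h2 := by omega
  rw [e1] at hc
  have e2 : ∏ j ∈ J, b j = (-1) ^ h2 * c ^ 2 := by
    rw [sq, ← hc, ← mul_assoc, ← mul_pow]; simp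
  rw [e2, th_sq _ _ (by simp) hc0, hh] at h
  have h4 := th_four (p := p) hp2
  have : ∑ j ∈ J, th (b j) = (h2 + h2) • th 1 + th ((-1) ^ h2) - th 1 := by rw [← h]; abel
  rw [this]
  rcases Nat.even_or_odd h2 with ⟨k, rfl⟩ | ⟨k, rfl⟩
  · rw [Even.neg_one_pow ⟨k, rfl⟩, show k + k + (k + k) = k * 4 by ring, mul_nsmul', h4]; simp
  · rw [Odd.neg_one_pow ⟨k, rfl⟩, th_neg 1 one_ne_zero,
      show 2 * k + 1 + (2 * k + 1) = k * 4 + 2 by ring, add_nsmul, mul_nsmul', h4, smul_zero]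
    abel

end theta

/-- the residue condition at `p` -/
def CC (p : ℕ) {ι : Type} [Fintype ι] (a : ι → ℤ) : Prop :=
  Even (Finset.univ.filter (fun i => (p : ℤ) ∣ a i)).card ∧
  (p ≠ 2 → IsSquare ((-1) ^ ((Finset.univ.filter (fun i => (p : ℤ) ∣ a i)).card / 2) *
    ∏ i ∈ Finset.univ.filter (fun i => (p : ℤ) ∣ a i), ((a i / p : ℤ) : ZMod p)))

lemma SS_drop {p : ℕ} [hp : Fact p.Prime] {ι : Type} [Fintype ι] (a : ι → ℤ) (hsq : ∀ i, Squarefree (a i))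
    (hsm : ∀ i, sm (p + 1) (a i)) (hC : CC p a) : ∑ i, qc (a i) ∈ SS p := by
  set J := Finset.univ.filter (fun i => (p : ℤ) ∣ a i) with hJ
  have hpi : Prime (p : ℤ) := Nat.prime_iff_prime_int.mp hp.out
  rw [← Finset.sum_filter_add_sum_filter_not Finset.univ (fun i => (p : ℤ) ∣ a i)]
  refine add_mem ?_ ?_
  swap
  · refine sum_mem fun i hi => mem_SS ⟨(hsm i).1, fun q hq hd => ?_⟩
    have h1 := (hsm i).2 q hq hd
    have h2 : q ≠ p := by
      rintro rfl
      exact (Finset.mem_filter.mp hi).2 hd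
    omega
  · rw [← hJ]
    have hb : ∀ j ∈ J, a j = p * (a j / p) := fun j hj =>
      (Int.mul_ediv_cancel' (Finset.mem_filter.mp hj).2).symm
    have hbp : ∀ j ∈ J, ¬ (p : ℤ) ∣ a j / p := by
      intro j hj ⟨c, hc⟩
      have h1 := hb j hj
      rw [hc] at h1
      have := hsq j p ⟨c, by rw [h1]; ring⟩
      exact hpi.not_isUnit this
    have hbs : ∀ j ∈ J, sm p (a j / p) := by
      intro j hj
      have hd : a j / p ∣ a j := ⟨p, by rw [mul_comm]; exact hb j hj⟩
      refine ⟨fun h0 => hbp j hj (by rw [h0]; exact dvd_zero _), fun q hq hqd => ?_⟩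
      have h1 := (hsm j).2 q hq (hqd.trans hd)
      have h2 : q ≠ p := by
        rintro rfl
        exact hbp j hj hqd
      omega
    have hb0 : ∀ j ∈ J, ((a j / p : ℤ) : ZMod p) ≠ 0 := by
      intro j hj h0
      rw [ZMod.intCast_zmod_eq_zero_iff_dvd] at h0
      exact hbp j hj h0
    rw [← QuotientAddGroup.eq_zero_iff, QuotientAddGroup.mk_sum]
    have e1 : ∀ j ∈ J, (QuotientAddGroup.mk (qc (a j)) : WQ ⧸ SS p) = th ((a j / p : ℤ) : ZMod p) := by
      intro j hj
      rw [← th_int _ (hbs j hj), ← hb j hj]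
    rw [Finset.sum_congr rfl e1]
    by_cases hp2 : p = 2
    · subst hp2
      have e2 : ∀ j ∈ J, th ((a j / (2 : ℕ) : ℤ) : ZMod 2) = th (1 : ZMod 2) := by
        intro j hj
        rw [zmod2_one _ (hb0 j hj)]
      rw [Finset.sum_congr rfl e2, Finset.sum_const]
      have h2 : (2 : ℕ) • (th (1 : ZMod 2)) = 0 := by
        have h1 := qc_add 1 1 one_ne_zero one_ne_zero (by norm_num)
        have h3 : (2 : ℕ) • (th (1 : ZMod 2)) = QuotientAddGroup.mk (qc 1 + qc 1) := by
          rw [h1, two_nsmul, th]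
          rw [← QuotientAddGroup.mk_add]
          congr 2 <;> congr 1 <;> norm_num [ZMod.val_one]
        rw [h3, QuotientAddGroup.eq_zero_iff]
        have : qc 1 ∈ SS 2 := by exact_mod_cast mem_SS (sm_one (p := 2))
        exact add_mem this this
      obtain ⟨k, hk⟩ := hC.1
      rw [← hJ] at hk
      rw [hk, show k + k = k * 2 by ring, mul_nsmul', h2, smul_zero]
    · exact th_sum_zero hp2 J _ hb0 hC.1 (hC.2 hp2)

lemma sqf_part (n : ℤ) (hn : n ≠ 0) : ∃ a s : ℤ, s ≠ 0 ∧ Squarefree a ∧ n = a * s ^ 2 := by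
  obtain ⟨a, b, hab, hsq⟩ := Nat.sq_mul_squarefree n.natAbs
  have hb : b ≠ 0 := by rintro rfl; simp at hab; omega
  rcases Int.natAbs_eq n with h | h
  · refine ⟨a, b, by exact_mod_cast hb, Int.squarefree_natCast.mpr hsq, ?_⟩
    rw [h, ← hab]; push_cast; ring
  · refine ⟨-a, b, by exact_mod_cast hb, sqf_neg (Int.squarefree_natCast.mpr hsq), ?_⟩
    rw [h, ← hab]; push_cast; ring

lemma SS_rep {p : ℕ} {x : WQ} (hx : x ∈ SS p) : ∃ (ι : Type) (_ : Fintype ι) (a : ι → ℤ),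
    (∀ i, Squarefree (a i)) ∧ (∀ i, sm p (a i)) ∧ ∑ i, qc (a i) = x := by
  induction hx using AddSubgroup.closure_induction with
  | mem x h =>
    obtain ⟨n, hn, rfl⟩ := h
    obtain ⟨a, s, hs, hsq, rfl⟩ := sqf_part n hn.1
    refine ⟨Unit, inferInstance, fun _ => a, fun _ => hsq, fun _ => sm_of_dvd hn (dvd_mul_right _ _), ?_⟩
    have : (s : ℚ) ≠ 0 := by exact_mod_cast hs
    simp [qc_sq _ _ this]
  | zero => exact ⟨Empty, inferInstance, fun x => x.elim, fun x => x.elim, fun x => x.elim, by simp⟩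
  | add x y _ _ h1 h2 =>
    obtain ⟨ι, _, a, a1, a2, rfl⟩ := h1
    obtain ⟨κ, _, b, b1, b2, rfl⟩ := h2
    refine ⟨ι ⊕ κ, inferInstance, Sum.elim a b, ?_, ?_, ?_⟩
    · rintro (i | i); exacts [a1 i, b1 i]
    · rintro (i | i); exacts [a2 i, b2 i]
    · simp [Fintype.sum_sum_type]
  | neg x _ h =>
    obtain ⟨ι, _, a, a1, a2, rfl⟩ := h
    refine ⟨ι, inferInstance, fun i => - a i, fun i => sqf_neg (a1 i), fun i => sm_neg (a2 i), ?_⟩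
    simp [qc_neg]

lemma SS_descend (x : WQ) (hx : ∀ (ι : Type) (_ : Fintype ι) (a : ι → ℤ), (∀ i, Squarefree (a i)) →
    ∑ i, qc (a i) = x → ∀ p : ℕ, p.Prime → CC p a) (k : ℕ) (hk : x ∈ SS (k + 2)) : x ∈ SS 2 := by
  induction k with
  | zero => exact hk
  | succ k ih =>
    apply ih
    obtain ⟨ι, _, a, a1, a2, hs⟩ := SS_rep hk
    by_cases hp : (k + 2).Prime
    · have : Fact (k + 2).Prime := ⟨hp⟩
      rw [← hs]
      exact SS_drop a a1 (fun i => a2 i) (hx ι _ a a1 hs _ hp)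
    · rw [← hs]
      refine sum_mem fun i _ => mem_SS ⟨(a2 i).1, fun q hq hd => ?_⟩
      have h1 := (a2 i).2 q hq hd
      have : q ≠ k + 2 := by rintro rfl; exact hp hq
      omega

lemma SS_two {x : WQ} (hx : x ∈ SS 2) : ∃ m : ℤ, x = m • qc 1 := by
  induction hx using AddSubgroup.closure_induction with
  | mem x h =>
    obtain ⟨n, hn, rfl⟩ := h
    have h1 : n.natAbs = 1 := by
      by_contra h
      obtain ⟨q, hq, hd⟩ := Nat.exists_prime_and_dvd h
      have := hn.2 q hq (Int.natCast_dvd.mpr hd)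
      have := hq.two_le
      omega
    rcases Int.natAbs_eq n with h | h
    · exact ⟨1, by rw [h, h1]; simp⟩
    · exact ⟨-1, by rw [h, h1]; simp [qc_neg]⟩
  | zero => exact ⟨0, by simp⟩
  | add x y _ _ h1 h2 =>
    obtain ⟨a, rfl⟩ := h1
    obtain ⟨b, rfl⟩ := h2
    exact ⟨a + b, by rw [add_smul]⟩
  | neg x _ h =>
    obtain ⟨a, rfl⟩ := h
    exact ⟨-a, by rw [neg_smul]⟩

lemma mem_SS_big {ι : Type} [Fintype ι] (a : ι → ℤ) (ha : ∀ i, a i ≠ 0) :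
    ∃ k : ℕ, ∑ i, qc (a i) ∈ SS (k + 2) := by
  refine ⟨∑ i, (a i).natAbs, sum_mem fun i _ => mem_SS (sm_lt (ha i) ?_)⟩
  have : (a i).natAbs ≤ ∑ i, (a i).natAbs :=
    Finset.single_le_sum (f := fun i => (a i).natAbs) (fun _ _ => Nat.zero_le _) (Finset.mem_univ i)
  rw [Int.abs_eq_natAbs]; push_cast; push_cast at this
  zify at this ⊢
  linarith

/-- A Witt class with trivial residues is a multiple of `⟨1⟩`. -/
lemma witt_main {ι : Type} [Fintype ι] (a : ι → ℤ) (ha : ∀ i, a i ≠ 0)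
    (hx : ∀ (κ : Type) (_ : Fintype κ) (b : κ → ℤ), (∀ i, Squarefree (b i)) →
    ∑ i, qc (b i) = ∑ i, qc (a i) → ∀ p : ℕ, p.Prime → CC p b) :
    ∃ m : ℤ, ∑ i, qc (a i) = m • qc 1 := by
  obtain ⟨k, hk⟩ := mem_SS_big a ha
  exact SS_two (SS_descend _ hx k hk)

end Nik

namespace Nik
open Module

/-- sign lemma -/
lemma MetW_pos {ι : Type} [Fintype ι] (w : ι → ℚ) (hw : ∀ i, w i ≠ 0) (h : MetW w) :
    Fintype.card ι ≤ 2 * (Finset.univ.filter (fun i => 0 < w i)).card := by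
  obtain ⟨N, h1, h2⟩ := h
  let r : N →ₗ[ℚ] ({i // 0 < w i} → ℚ) := (LinearMap.funLeft ℚ ℚ Subtype.val) ∘ₗ N.subtype
  have hr : Function.Injective r := by
    rw [← LinearMap.ker_eq_bot, LinearMap.ker_eq_bot']
    intro x hx
    have h0 : ∀ i, 0 < w i → (x : ι → ℚ) i = 0 := fun i hi => congrFun hx ⟨i, hi⟩
    have hs := h1 x x.2 x x.2
    rw [bf_apply] at hs
    have hneg : ∀ i, w i * (x : ι → ℚ) i * (x : ι → ℚ) i ≤ 0 := by
      intro i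
      rcases lt_trichotomy (w i) 0 with h | h | h
      · nlinarith [mul_self_nonneg ((x : ι → ℚ) i)]
      · exact absurd h (hw i)
      · rw [h0 i h]; simp
    rw [Finset.sum_eq_zero_iff_of_nonpos (fun i _ => hneg i)] at hs
    ext i
    have := hs i (Finset.mem_univ i)
    simpa [hw i] using this
  have := LinearMap.finrank_le_finrank_of_injective hr
  rw [Module.finrank_fintype_fun_eq_card, Fintype.card_subtype] at this
  omega

lemma MetW_neg {ι : Type} [Fintype ι] (w : ι → ℚ) (hw : ∀ i, w i ≠ 0) (h : MetW w) :
    Fintype.card ι ≤ 2 * (Finset.univ.filter (fun i => w i < 0)).card := by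
  have hneg : MetW (fun i => - w i) := by
    obtain ⟨N, h1, h2⟩ := h
    refine ⟨N, fun x hx y hy => ?_, h2⟩
    have := h1 x hx y hy
    rw [bf_apply] at this ⊢
    simp only [neg_mul, Finset.sum_neg_distrib, this, neg_zero]
  simpa using MetW_pos _ (fun i => neg_ne_zero.mpr (hw i)) hneg

/-- a finitely generated spanning lattice has a basis -/
lemma lattice_basis {V : Type*} [AddCommGroup V] [Module ℚ V] (L : Submodule ℤ V)
    (hfg : L.FG) (hspan : Submodule.span ℚ (L : Set V) = ⊤) :
    ∃ (n : ℕ) (b : Basis (Fin n) ℚ V), L = Submodule.span ℤ (Set.range b) := by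
  have : Module.Finite ℤ L := Module.Finite.iff_fg.mpr hfg
  have : IsTorsionFree ℤ V := IsTorsionFree.trans_faithfulSMul ℤ ℚ V
  have : Module.Free ℤ L := inferInstance
  let b := Module.finBasis ℤ L
  have hli : LinearIndependent ℤ (fun i => (b i : V)) :=
    b.linearIndependent.map' L.subtype (Submodule.ker_subtype L)
  have hli' := (LinearIndependent.iff_fractionRing ℤ ℚ).mp hli
  have hL : L = Submodule.span ℤ (Set.range (fun i => (b i : V))) := by
    have h1 := b.span_eq
    have h2 := congrArg (Submodule.map L.subtype) h1
    rw [Submodule.map_span, Submodule.map_top, Submodule.range_subtype, ← Set.range_comp] at h2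
    exact h2.symm
  have hsp : ⊤ ≤ Submodule.span ℚ (Set.range (fun i => (b i : V))) := by
    rw [← hspan, Submodule.span_le]
    intro x hx
    rw [SetLike.mem_coe, hL] at hx
    exact Submodule.span_le_restrictScalars ℤ ℚ _ hx
  refine ⟨_, Basis.mk hli' hsp, ?_⟩
  rw [Basis.coe_mk]; exact hL

/-- biduality for lattices -/
lemma bidual {V : Type*} [AddCommGroup V] [Module ℚ V] [FiniteDimensional ℚ V]
    (B : LinearMap.BilinForm ℚ V) (hB : B.Nondegenerate)
    (hs : B.IsSymm) (L : Submodule ℤ V) (hfg : L.FG) (hspan : Submodule.span ℚ (L : Set V) = ⊤)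
    (x : V) (hx : ∀ y, (∀ z ∈ L, ∃ n : ℤ, B y z = n) → ∃ n : ℤ, B x y = n) : x ∈ L := by
  obtain ⟨n, b, rfl⟩ := lattice_basis L hfg hspan
  rw [← LinearMap.BilinForm.dualSubmodule_dualSubmodule_of_basis (R := ℤ) B hB hs b]
  intro y hy
  obtain ⟨n, hn⟩ := hx y (by
    intro z hz
    obtain ⟨m, hm⟩ := Submodule.mem_one.mp (hy z hz)
    exact ⟨m, by simpa using hm.symm⟩)
  exact Submodule.mem_one.mpr ⟨n, by simpa using hn.symm⟩

/-- a self-dual complement forces discriminant (-1)^h up to squares -/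
lemma disc_lagr {K : Type*} [Field K] {J : Type} [Fintype J] [DecidableEq J] (w : J → K)
    (hw : ∀ j, w j ≠ 0)
    (X : Submodule K (J → K)) (hX : ∀ c, c ∈ X ↔ ∀ x ∈ X, ∑ j, w j * c j * x j = 0) :
    Even (Fintype.card J) ∧ IsSquare ((-1) ^ (Fintype.card J / 2) * ∏ j, w j) := by
  let B : LinearMap.BilinForm K (J → K) := Matrix.toBilin' (Matrix.diagonal w)
  have hBa : ∀ x y, B x y = ∑ j, w j * x j * y j := by
    intro x y
    simp only [B, Matrix.toBilin'_apply', Matrix.mulVec_diagonal, dotProduct]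
    exact Finset.sum_congr rfl fun j _ => by ring
  have hBn : B.Nondegenerate := by
    apply Matrix.Nondegenerate.toBilin'
    apply Matrix.nondegenerate_of_det_ne_zero
    rw [Matrix.det_diagonal, Finset.prod_ne_zero_iff]; exact fun j _ => hw j
  have hsym : ∀ x y, B x y = B y x := by
    intro x y; rw [hBa, hBa]; exact Finset.sum_congr rfl fun j _ => by ring
  have hXo : B.orthogonal X = X := by
    ext c
    rw [LinearMap.BilinForm.mem_orthogonal_iff, hX]
    constructor
    · intro h x hx; rw [← hBa, hsym]; exact h x hx
    · intro h x hx; change B x c = 0; rw [hsym, hBa]; exact h x hx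
  have hd := LinearMap.BilinForm.finrank_orthogonal hBn (W := X)
  rw [hXo] at hd
  have hle := Submodule.finrank_le X
  rw [finrank_fintype_fun_eq_card] at hd hle
  set h := finrank K X with hh
  have hc : Fintype.card J = h + h := by omega
  obtain ⟨Y, hY⟩ := Submodule.exists_isCompl X
  have hYd := Submodule.finrank_add_eq_of_isCompl hY
  rw [finrank_fintype_fun_eq_card] at hYd
  have hYh : finrank K Y = h := by omega
  let bX : Basis (Fin h) K X := Module.finBasisOfFinrankEq K X hh.symm
  let bY : Basis (Fin h) K Y := Module.finBasisOfFinrankEq K Y hYh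
  let b : Basis (Fin h ⊕ Fin h) K (J → K) :=
    (bX.prod bY).map (Submodule.prodEquivOfIsCompl X Y hY)
  have hb1 : ∀ i, b (Sum.inl i) ∈ X := by intro i; simp [b]
  have hcard : Fintype.card J = Fintype.card (Fin h ⊕ Fin h) := by simp [hc]
  let e : J ≃ Fin h ⊕ Fin h := Fintype.equivOfCardEq hcard
  refine ⟨⟨h, hc⟩, ?_⟩
  let P : Matrix (Fin h ⊕ Fin h) (Fin h ⊕ Fin h) K := fun i j => b j (e.symm i)
  let G : Matrix (Fin h ⊕ Fin h) (Fin h ⊕ Fin h) K := fun i j => B (b i) (b j)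
  have hG : G = P.transpose * Matrix.diagonal (fun i => w (e.symm i)) * P := by
    ext i j
    rw [Matrix.mul_apply]
    simp only [Matrix.mul_diagonal, Matrix.transpose_apply, G, P, hBa]
    rw [← Equiv.sum_comp e.symm]
    refine Finset.sum_congr rfl fun k _ => ?_
    change _ = b i (e.symm k) * _ * _
    ring
  have hP : P.det ≠ 0 := by
    have := b.invertibleToMatrix ((Pi.basisFun K J).reindex e)
    have h1 : P = ((Pi.basisFun K J).reindex e).toMatrix b := by
      ext i j; simp [P, Basis.toMatrix_apply]
    rw [h1]
    have h2 := Basis.toMatrix_mul_toMatrix_flip ((Pi.basisFun K J).reindex e) b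
    intro h3
    have := congrArg Matrix.det h2
    rw [Matrix.det_mul, h3] at this
    simp at this
  let A : Matrix (Fin h) (Fin h) K := fun i j => B (b (Sum.inl i)) (b (Sum.inr j))
  let C : Matrix (Fin h) (Fin h) K := fun i j => B (b (Sum.inr i)) (b (Sum.inr j))
  have hGb : G = Matrix.fromBlocks 0 A A.transpose C := by
    ext i j
    rcases i with i | i <;> rcases j with j | j
    · simp only [G, Matrix.fromBlocks_apply₁₁, hBa]
      exact (hX _).mp (hb1 i) _ (hb1 j)
    · rfl
    · simp only [G, Matrix.fromBlocks_apply₂₁, Matrix.transpose_apply, A]; exact hsym _ _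
    · rfl
  let J0 : Matrix (Fin h ⊕ Fin h) (Fin h ⊕ Fin h) K := Matrix.fromBlocks 0 (-1) 1 0
  have hJ0 : J0.det = 1 := by
    have : J0 = Matrix.fromBlocks 1 (-1) 0 1 * (Matrix.fromBlocks 1 0 1 1 * Matrix.fromBlocks 1 (-1) 0 1) := by
      simp [J0, Matrix.fromBlocks_multiply]
    rw [this, Matrix.det_mul, Matrix.det_mul, Matrix.det_fromBlocks_zero₂₁, Matrix.det_fromBlocks_zero₁₂]
    simp
  have hdet : G.det = (-1) ^ h * A.det ^ 2 := by
    have : (G * J0).det = (-1) ^ h * A.det ^ 2 := by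
      rw [hGb]; simp only [J0, Matrix.fromBlocks_multiply]
      simp [Matrix.det_fromBlocks_zero₁₂, Matrix.det_neg]; ring
    rwa [Matrix.det_mul, hJ0, mul_one] at this
  have hdet2 : G.det = P.det ^ 2 * ∏ j, w j := by
    rw [hG, Matrix.det_mul, Matrix.det_mul, Matrix.det_transpose, Matrix.det_diagonal,
      Equiv.prod_comp e.symm]; ring
  refine ⟨A.det / P.det, ?_⟩
  have e1 : Fintype.card J / 2 = h := by omega
  have e2 : ((-1 : K) ^ h) * (-1) ^ h = 1 := by rw [← mul_pow]; simp
  rw [e1]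
  field_simp
  have : (P.det ^ 2) * ∏ j, w j = (-1) ^ h * A.det ^ 2 := by rw [← hdet2, hdet]
  linear_combination ((-1) ^ h) * this + A.det ^ 2 * e2

end Nik

namespace Nik
open Module

lemma residue {ι : Type} [Fintype ι] [DecidableEq ι] (a : ι → ℤ) (ha : ∀ i, Squarefree (a i))
    (Γ : Submodule ℤ (ι → ℚ)) (hfg : Γ.FG)
    (hsd : ∀ x, x ∈ Γ ↔ ∀ y ∈ Γ, ∃ n : ℤ, bf (fun i => (a i : ℚ)) x y = n)
    (p : ℕ) (hp : p.Prime) : CC p a := by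
  classical
  have : Fact p.Prime := ⟨hp⟩
  have ha0 : ∀ i, a i ≠ 0 := fun i => (ha i).ne_zero
  have haq : ∀ i, (a i : ℚ) ≠ 0 := fun i => by exact_mod_cast ha0 i
  have hpq : (p : ℚ) ≠ 0 := by exact_mod_cast hp.ne_zero
  let J := {i // (p : ℤ) ∣ a i}
  have hbj : ∀ j : J, a j = p * (a j / p) := fun j => (Int.mul_ediv_cancel' j.2).symm
  have hb0 : ∀ j : J, ((a j / p : ℤ) : ZMod p) ≠ 0 := by
    intro j h0
    rw [ZMod.intCast_zmod_eq_zero_iff_dvd] at h0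
    obtain ⟨k, hk⟩ := h0
    have := ha j p ⟨k, by rw [hbj j, hk]; ring⟩
    exact (Nat.prime_iff_prime_int.mp hp).not_isUnit this
  let w : J → ZMod p := fun j => ((a j / p : ℤ) : ZMod p)⁻¹
  have hw : ∀ j, w j ≠ 0 := fun j => inv_ne_zero (hb0 j)
  let B := bf (fun i => (a i : ℚ))
  have hB : B.Nondegenerate := bf_nondeg _ haq
  have hBs : B.IsSymm := bf_isSymm _
  let X : Submodule (ZMod p) (J → ZMod p) :=
    { carrier := {c | ∃ y ∈ Γ, ∃ n : ι → ℤ, (∀ i, (a i : ℚ) * y i = n i) ∧ ∀ j : J, c j = (n j : ZMod p)}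
      add_mem' := by
        rintro c d ⟨y, hy, n, h1, h2⟩ ⟨z, hz, m, h3, h4⟩
        refine ⟨y + z, add_mem hy hz, n + m, fun i => ?_, fun j => ?_⟩
        · simp [mul_add, h1, h3]
        · simp [h2, h4]
      zero_mem' := ⟨0, zero_mem _, 0, by simp, by simp⟩
      smul_mem' := by
        rintro k c ⟨y, hy, n, h1, h2⟩
        refine ⟨(k.val : ℤ) • y, Γ.smul_mem _ hy, (k.val : ℤ) • n, fun i => ?_, fun j => ?_⟩
        · simp [← h1]; ring
        · simp [h2] }
  let a' : ι → ℤ := fun i => if (p : ℤ) ∣ a i then a i / p else a i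
  have ha'J : ∀ j : J, a' j = a j / p := fun j => if_pos j.2
  have ha'0 : ∀ i, ((a' i : ℤ) : ZMod p) ≠ 0 := by
    intro i
    by_cases h : (p : ℤ) ∣ a i
    · rw [show a' i = a i / p from if_pos h]; exact hb0 ⟨i, h⟩
    · rw [show a' i = a i from if_neg h]
      rwa [Ne, ZMod.intCast_zmod_eq_zero_iff_dvd]
  have hX : ∀ c, c ∈ X ↔ ∀ x ∈ X, ∑ j, w j * c j * x j = 0 := by
    intro c
    constructor
    · rintro ⟨y, hy, n, h1, h2⟩ d ⟨z, hz, m, h3, h4⟩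
      obtain ⟨N, hN⟩ := (hsd y).mp hy z hz
      rw [bf_apply] at hN
      have hy' : ∀ i, y i = n i / a i := fun i => by rw [← h1]; field_simp [haq i]
      have hz' : ∀ i, z i = m i / a i := fun i => by rw [← h3]; field_simp [haq i]
      let P : ℤ := ∏ i, a' i
      let Pi : ι → ℤ := fun i => ∏ k ∈ Finset.univ.erase i, a' k
      have hPi : ∀ i, a' i * Pi i = P := fun i => Finset.mul_prod_erase _ _ (Finset.mem_univ i)
      have hP0 : ((P : ℤ) : ZMod p) ≠ 0 := by
        simp only [P, Int.cast_prod]; rw [Finset.prod_ne_zero_iff]; exact fun i _ => ha'0 i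
      have hkey : (p : ℤ) * (N * P) = ∑ i, (if (p : ℤ) ∣ a i then 1 else (p : ℤ)) * (n i * m i * Pi i) := by
        have : ((p : ℤ) * (N * P) : ℚ) = ∑ i, (((if (p : ℤ) ∣ a i then 1 else (p : ℤ)) * (n i * m i * Pi i) : ℤ) : ℚ) := by
          rw [← hN, Finset.sum_mul, Finset.mul_sum]
          refine Finset.sum_congr rfl fun i _ => ?_
          rw [hy', hz', ← hPi i]
          push_cast
          by_cases h : (p : ℤ) ∣ a i
          · have e1 : (a i : ℚ) = p * a' i := by
              rw [show a' i = a i / p from if_pos h]; exact_mod_cast hbj ⟨i, h⟩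
            rw [if_pos h]
            have := haq i
            have h0 : (a' i : ℚ) ≠ 0 := by intro h0; rw [e1, h0, mul_zero] at this; exact this rfl
            rw [e1]; push_cast; field_simp
          · rw [if_neg h, show a' i = a i from if_neg h]
            have := haq i
            push_cast; field_simp
        exact_mod_cast this
      have hk2 := congrArg (Int.cast : ℤ → ZMod p) hkey
      push_cast at hk2
      simp only [CharP.cast_eq_zero, zero_mul] at hk2
      have hk3 : ∑ j : J, ((n j : ZMod p) * m j * Pi j) = 0 := by
        rw [hk2]
        rw [← Finset.sum_filter_add_sum_filter_not Finset.univ (fun i => (p : ℤ) ∣ a i)]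
        rw [Finset.sum_eq_zero (s := Finset.univ.filter (fun i => ¬ (p : ℤ) ∣ a i)), add_zero]
        · rw [Finset.sum_subtype (Finset.univ.filter (fun i => (p : ℤ) ∣ a i)) (p := fun i => (p : ℤ) ∣ a i) (by simp)]
          refine Finset.sum_congr rfl fun j _ => ?_
          rw [if_pos j.2, one_mul]
        · intro i hi; rw [if_neg (Finset.mem_filter.mp hi).2, zero_mul]
      have hk4 : (P : ZMod p) * ∑ j : J, w j * c j * d j = 0 := by
        rw [Finset.mul_sum, ← hk3]
        refine Finset.sum_congr rfl fun j _ => ?_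
        rw [h2, h4, ← hPi j, ha'J]
        push_cast
        simp only [w]
        have := hb0 j
        field_simp
      exact (mul_eq_zero.mp hk4).resolve_left hP0
    · intro hc
      let d : J → ℤ := fun j => ((c j * w j : ZMod p).val : ℤ)
      have hd : ∀ j, ((d j : ℤ) : ZMod p) = c j * w j := fun j => by simp [d]
      let z : ι → ℚ := fun i => if h : (p : ℤ) ∣ a i then (d ⟨i, h⟩ : ℚ) / p else 0
      let M : Submodule ℤ (ι → ℚ) := Submodule.span ℤ (Set.range (fun i => Pi.single i (1 : ℚ)))
      have hMfg : M.FG := Submodule.fg_span (Set.finite_range _)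
      have hMspan : Submodule.span ℚ ((Γ ⊔ M : Submodule ℤ (ι → ℚ)) : Set (ι → ℚ)) = ⊤ := by
        rw [eq_top_iff, ← (Pi.basisFun ℚ ι).span_eq]
        apply Submodule.span_mono
        rintro _ ⟨i, rfl⟩
        exact (le_sup_right : M ≤ Γ ⊔ M) (Submodule.subset_span ⟨i, by simp⟩)
      have hMint : ∀ m ∈ M, ∀ i, ∃ k : ℤ, m i = k := by
        intro m hm i
        induction hm using Submodule.span_induction with
        | mem x h =>
          obtain ⟨k, rfl⟩ := h
          by_cases hki : k = i
          · subst hki; exact ⟨1, by simp⟩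
          · exact ⟨0, by simp [Pi.single_eq_of_ne (Ne.symm hki)]⟩
        | zero => exact ⟨0, by simp⟩
        | add x y _ _ h1 h2 =>
          obtain ⟨k, hk⟩ := h1
          obtain ⟨l, hl⟩ := h2
          exact ⟨k + l, by simp [hk, hl]⟩
        | smul r x _ h =>
          obtain ⟨k, hk⟩ := h
          exact ⟨r * k, by simp [hk]⟩
      have hz : z ∈ Γ ⊔ M := by
        refine bidual B hB hBs _ (hfg.sup hMfg) hMspan z ?_
        intro y hy
        have hyΓ : y ∈ Γ := (hsd y).mpr fun x hx => hy x ((le_sup_left : Γ ≤ Γ ⊔ M) hx)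
        have hyM : ∀ i, ∃ n : ℤ, (a i : ℚ) * y i = n := by
          intro i
          obtain ⟨n, hn⟩ := hy (Pi.single i 1) ((le_sup_right : M ≤ Γ ⊔ M) (Submodule.subset_span ⟨i, rfl⟩))
          exact ⟨n, by rw [← hn]; simp [B, bf_single]⟩
        choose n hn using hyM
        have h0 := hc (fun j => (n j : ZMod p)) ⟨y, hyΓ, n, hn, fun j => rfl⟩
        have h1 : ((∑ j : J, d j * n j : ℤ) : ZMod p) = 0 := by
          rw [← h0]; push_cast
          exact Finset.sum_congr rfl fun j _ => by rw [hd]; ring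
        rw [ZMod.intCast_zmod_eq_zero_iff_dvd] at h1
        obtain ⟨k, hk⟩ := h1
        refine ⟨k, ?_⟩
        have hkq : (∑ j : J, (d j : ℚ) * n j) = p * k := by exact_mod_cast hk
        have : (p : ℚ) * B z y = p * k := by
          rw [← hkq, bf_apply, Finset.mul_sum]
          rw [← Finset.sum_filter_add_sum_filter_not Finset.univ (fun i => (p : ℤ) ∣ a i)]
          rw [Finset.sum_eq_zero (s := Finset.univ.filter (fun i => ¬ (p : ℤ) ∣ a i)), add_zero]
          · rw [Finset.sum_subtype (Finset.univ.filter (fun i => (p : ℤ) ∣ a i)) (p := fun i => (p : ℤ) ∣ a i) (by simp)]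
            refine Finset.sum_congr rfl fun j _ => ?_
            rw [← hn j]
            have : z j = d j / p := dif_pos j.2
            rw [this]; field_simp
          · intro i hi
            have : z i = 0 := dif_neg (Finset.mem_filter.mp hi).2
            rw [this]; simp
        exact mul_left_cancel₀ hpq this
      obtain ⟨γ, hγ, m, hm, hzm⟩ := Submodule.mem_sup.mp hz
      choose k hk using hMint m hm
      refine ⟨γ, hγ, fun i => (if h : (p : ℤ) ∣ a i then (a i / p) * d ⟨i, h⟩ else 0) - a i * k i, ?_, ?_⟩
      · intro i
        have h1 : γ i = z i - k i := by rw [← hzm, ← hk]; simp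
        rw [h1]
        beta_reduce
        by_cases h : (p : ℤ) ∣ a i
        · have h2 : z i = d ⟨i, h⟩ / p := dif_pos h
          have h3 : (a i : ℚ) = p * (a i / p : ℤ) := by exact_mod_cast hbj ⟨i, h⟩
          rw [h2, dif_pos h]; push_cast
          have h4 : (a i : ℚ) * (d ⟨i, h⟩ / p) = (a i / p : ℤ) * d ⟨i, h⟩ := by
            rw [h3]; field_simp
          rw [mul_sub, h4]
        · have h2 : z i = 0 := dif_neg h
          rw [h2, dif_neg h]; push_cast; ring
      · intro j
        beta_reduce
        rw [dif_pos j.2]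
        have : ((a j : ℤ) : ZMod p) = 0 := (ZMod.intCast_zmod_eq_zero_iff_dvd _ _).mpr j.2
        push_cast
        rw [this, hd]
        simp only [w]
        have := hb0 j
        field_simp; simp
  obtain ⟨h1, h2⟩ := disc_lagr w hw X hX
  have hcard : (Finset.univ.filter (fun i => (p : ℤ) ∣ a i)).card = Fintype.card J :=
    (Fintype.card_subtype _).symm
  have hprod : ∏ i ∈ Finset.univ.filter (fun i => (p : ℤ) ∣ a i), ((a i / p : ℤ) : ZMod p)
      = (∏ j, w j)⁻¹ := by
    rw [Finset.prod_subtype (Finset.univ.filter (fun i => (p : ℤ) ∣ a i)) (p := fun i => (p : ℤ) ∣ a i) (by simp)]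
    rw [← Finset.prod_inv_distrib]
    exact Finset.prod_congr rfl fun j _ => by simp [w]
  unfold CC
  rw [hcard, hprod]
  refine ⟨h1, fun _ => ?_⟩
  obtain ⟨c, hc⟩ := h2
  refine ⟨c⁻¹, ?_⟩
  rw [← mul_inv, ← hc, mul_inv, ← inv_pow]; simp

/-- existence of a hyperbolic basis -/
lemma hyp_basis {R : Type*} [CommRing R] [IsDomain R] [IsPrincipalIdealRing R]
    {G : Type*} [AddCommGroup G] [Module R G] [Module.Finite R G] [Module.Free R G]
    (B : G →ₗ[R] G →ₗ[R] R) (hs : ∀ x y, B x y = B y x)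
    (hperf : ∀ φ : G →ₗ[R] R, ∃ x, ∀ y, B x y = φ y) (hev : ∀ x, ∃ c, B x x = c + c)
    (N : Submodule R G) (hN : ∀ x, x ∈ N ↔ ∀ y ∈ N, B x y = 0) :
    ∃ (r : ℕ) (a b : Fin r → G), (∀ i j, B (a i) (a j) = 0) ∧ (∀ i j, B (b i) (b j) = 0) ∧
      (∀ i j, B (a i) (b j) = if i = j then 1 else 0) ∧
      (∀ x, x = ∑ i, B x (b i) • a i + ∑ i, B x (a i) • b i) ∧ (∀ i, a i ∈ N) := by
  classical
  have htf : IsTorsionFree R (G ⧸ N) := by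
    rw [Module.isTorsionFree_iff_smul_eq_zero]
    intro r x hx
    obtain ⟨x, rfl⟩ := Submodule.Quotient.mk_surjective N x
    by_cases hr : r = 0
    · exact Or.inl hr
    right
    rw [← Submodule.Quotient.mk_smul, Submodule.Quotient.mk_eq_zero, hN] at hx
    rw [Submodule.Quotient.mk_eq_zero, hN]
    intro y hy
    have := hx y hy
    simpa [hr] using this
  have : Module.Free R (G ⧸ N) := inferInstance
  obtain ⟨s, hsec⟩ := Module.projective_lifting_property N.mkQ LinearMap.id (Submodule.mkQ_surjective N)
  have hsx : ∀ x, x - s (N.mkQ x) ∈ N := by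
    intro x
    have := LinearMap.congr_fun hsec (N.mkQ x)
    simp only [LinearMap.comp_apply, LinearMap.id_apply] at this
    rw [← Submodule.Quotient.mk_eq_zero, Submodule.Quotient.mk_sub, ← Submodule.mkQ_apply, ← Submodule.mkQ_apply, this, sub_self]
  let π : G →ₗ[R] N := (LinearMap.id - s ∘ₗ N.mkQ).codRestrict N hsx
  have hπ : ∀ x : N, π x = x := by
    intro x; ext
    simp [π, (Submodule.Quotient.mk_eq_zero N).mpr x.2]
  let bN := Module.finBasis R N
  let r := finrank R N
  choose b0 hb0 using fun i : Fin r => hperf (bN.coord i ∘ₗ π)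
  let a : Fin r → G := fun i => bN i
  have haN : ∀ i, a i ∈ N := fun i => (bN i).2
  have haa : ∀ i j, B (a i) (a j) = 0 := fun i j => (hN _).mp (haN i) _ (haN j)
  have hba0 : ∀ i j, B (b0 i) (a j) = if i = j then 1 else 0 := by
    intro i j
    rw [hb0]
    simp only [LinearMap.comp_apply, a, hπ, Basis.coord_apply, Basis.repr_self, Finsupp.single_apply]
    simp [eq_comm]
  choose hf hhf using hev
  let c : Fin r → Fin r → R := fun i k => if i < k then B (b0 i) (b0 k) else if i = k then hf (b0 i) else 0
  have hcc : ∀ i k, c i k + c k i = B (b0 i) (b0 k) := by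
    intro i k
    rcases lt_trichotomy i k with h | h | h
    · simp [c, h, h.not_gt, h.ne']
    · subst h; simp [c, hhf]
    · simp [c, h, h.not_gt, h.ne', hs (b0 i)]
  let b : Fin r → G := fun i => b0 i - ∑ j, c i j • a j
  have hba : ∀ i j, B (b i) (a j) = if i = j then 1 else 0 := by
    intro i j; simp [b, haa, hba0]
  have hbb : ∀ i j, B (b i) (b j) = 0 := by
    intro i j
    have : B (b i) (b j) = B (b i) (b0 j) - c j i := by
      conv_lhs => rw [show b j = b0 j - ∑ k, c j k • a k from rfl]
      simp [hba]
    rw [this]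
    simp only [b, map_sub, map_sum, map_smul, LinearMap.sub_apply, LinearMap.sum_apply, LinearMap.smul_apply]
    simp only [hs (a _) (b0 j), hba0, smul_eq_mul, mul_ite, mul_one, mul_zero]
    rw [Finset.sum_ite_eq]
    simp [← hcc i j]
  have hab : ∀ i j, B (a i) (b j) = if i = j then 1 else 0 := by
    intro i j; rw [hs, hba]; simp [eq_comm]
  refine ⟨r, a, b, haa, hbb, hab, ?_, haN⟩
  intro x
  let y := x - (∑ i, B x (b i) • a i + ∑ i, B x (a i) • b i)
  have hya : ∀ j, B y (a j) = 0 := by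
    intro j; simp [y, haa, hba]
  have hyb : ∀ j, B y (b j) = 0 := by
    intro j; simp [y, hab, hbb]
  have hyN : y ∈ N := by
    rw [hN]
    intro z hz
    have := bN.sum_repr ⟨z, hz⟩
    have h2 := congrArg (N.subtype) this
    rw [map_sum] at h2
    simp only [map_smul, Submodule.subtype_apply] at h2
    rw [← h2, map_sum]
    refine Finset.sum_eq_zero fun i _ => ?_
    rw [map_smul]
    have := hya i
    simp only [a] at this
    simp [this]
  have h2 := congrArg (N.subtype) (bN.sum_repr ⟨y, hyN⟩)
  rw [map_sum] at h2
  simp only [map_smul, Submodule.subtype_apply] at h2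
  have h3 : ∀ j, bN.repr ⟨y, hyN⟩ j = 0 := by
    intro j
    have h4 := hyb j
    rw [← h2] at h4
    simp only [map_sum, map_smul, LinearMap.sum_apply, LinearMap.smul_apply] at h4
    have h5 : ∀ i, B (bN i : G) (b j) = if i = j then 1 else 0 := fun i => hab i j
    simpa [h5] using h4
  have : y = 0 := by
    rw [← h2]; exact Finset.sum_eq_zero fun i _ => by rw [h3]; simp
  exact sub_eq_zero.mp this

end Nik

namespace Nik
open Module

lemma MetW_lattice {ι : Type} [Fintype ι] (w : ι → ℚ) (hw : ∀ i, w i ≠ 0) (h : MetW w) :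
    ∃ Γ : Submodule ℤ (ι → ℚ), Γ.FG ∧ ∀ x, x ∈ Γ ↔ ∀ y ∈ Γ, ∃ n : ℤ, bf w x y = n := by
  obtain ⟨N, h1, h2⟩ := h
  have hB := bf_nondeg w hw
  obtain ⟨h3, -⟩ := lagr (bf w) hB N h1 (by rwa [finrank_fintype_fun_eq_card])
  obtain ⟨r, a, b, haa, hbb, hab, hx, -⟩ := hyp_basis (bf w) (bf_symm w)
    (fun φ => ⟨(LinearMap.BilinForm.toDual (bf w) hB).symm φ, fun y => by
      have := LinearMap.BilinForm.toDual_def (B := bf w) hB (m := (LinearMap.BilinForm.toDual (bf w) hB).symm φ) (n := y)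
      rw [← this]; simp⟩)
    (fun x => ⟨bf w x x / 2, by ring⟩) N (by
      intro x
      conv_lhs => rw [← h3, LinearMap.BilinForm.mem_orthogonal_iff]
      constructor
      · intro h y hy; rw [bf_symm]; exact h y hy
      · intro h y hy; change bf w y x = 0; rw [bf_symm]; exact h y hy)
  have hba : ∀ i j, bf w (b i) (a j) = if i = j then 1 else 0 := by
    intro i j; rw [bf_symm, hab]; simp [eq_comm]
  refine ⟨Submodule.span ℤ (Set.range a) ⊔ Submodule.span ℤ (Set.range b),
    (Submodule.fg_span (Set.finite_range _)).sup (Submodule.fg_span (Set.finite_range _)), ?_⟩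
  set Γ := Submodule.span ℤ (Set.range a) ⊔ Submodule.span ℤ (Set.range b)
  have haG : ∀ i, a i ∈ Γ := fun i => (le_sup_left : _ ≤ Γ) (Submodule.subset_span ⟨i, rfl⟩)
  have hbG : ∀ i, b i ∈ Γ := fun i => (le_sup_right : _ ≤ Γ) (Submodule.subset_span ⟨i, rfl⟩)
  have key : ∀ x, (∀ i, ∃ n : ℤ, bf w x (a i) = n) → (∀ i, ∃ n : ℤ, bf w x (b i) = n) →
      ∀ y ∈ Γ, ∃ n : ℤ, bf w x y = n := by
    intro x h1 h2 y hy
    have hle : Γ ≤ ({ carrier := {y | ∃ n : ℤ, bf w x y = n}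
                      add_mem' := by
                        rintro _ _ ⟨n, hn⟩ ⟨m, hm⟩
                        exact ⟨n + m, by simp [hn, hm]⟩
                      zero_mem' := ⟨0, by simp⟩
                      smul_mem' := by
                        rintro c _ ⟨n, hn⟩
                        exact ⟨c * n, by rw [map_zsmul, hn]; simp⟩ } : Submodule ℤ (ι → ℚ)) := by
      rw [sup_le_iff, Submodule.span_le, Submodule.span_le]
      constructor
      · rintro _ ⟨i, rfl⟩; exact h1 i
      · rintro _ ⟨i, rfl⟩; exact h2 i
    exact hle hy
  intro x
  constructor
  · intro hxG y hy
    refine key x (fun i => ?_) (fun i => ?_) y hy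
    · obtain ⟨n, hn⟩ := key (a i) (fun j => ⟨0, by simp [haa]⟩) (fun j => ⟨if i = j then 1 else 0, by simp [hab]⟩) x hxG
      exact ⟨n, by rw [bf_symm, hn]⟩
    · obtain ⟨n, hn⟩ := key (b i) (fun j => ⟨if i = j then 1 else 0, by simp [hba]⟩) (fun j => ⟨0, by simp [hbb]⟩) x hxG
      exact ⟨n, by rw [bf_symm, hn]⟩
  · intro h
    rw [hx x]
    refine add_mem (sum_mem fun i _ => ?_) (sum_mem fun i _ => ?_)
    · obtain ⟨n, hn⟩ := h _ (hbG i)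
      rw [hn, Int.cast_smul_eq_zsmul]; exact Γ.smul_mem _ (haG i)
    · obtain ⟨n, hn⟩ := h _ (haG i)
      rw [hn, Int.cast_smul_eq_zsmul]; exact Γ.smul_mem _ (hbG i)

lemma CC_cancel {p : ℕ} (hp : p.Prime) {ι κ : Type} [Fintype ι] [Fintype κ] (a : ι → ℤ) (b : κ → ℤ)
    (hb : ∀ i, Squarefree (b i)) (h : CC p (Sum.elim a b)) (h' : CC p b) : CC p a := by
  classical
  have : Fact p.Prime := ⟨hp⟩
  unfold CC at *
  have hc : (Finset.univ.filter (fun i => (p : ℤ) ∣ Sum.elim a b i)).card =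
      (Finset.univ.filter (fun i => (p : ℤ) ∣ a i)).card + (Finset.univ.filter (fun i => (p : ℤ) ∣ b i)).card := by
    simp only [Finset.card_filter, Fintype.sum_sum_type]; rfl
  have hpr : ∏ i ∈ Finset.univ.filter (fun i => (p : ℤ) ∣ Sum.elim a b i), ((Sum.elim a b i / p : ℤ) : ZMod p)
      = (∏ i ∈ Finset.univ.filter (fun i => (p : ℤ) ∣ a i), ((a i / p : ℤ) : ZMod p)) *
        ∏ i ∈ Finset.univ.filter (fun i => (p : ℤ) ∣ b i), ((b i / p : ℤ) : ZMod p) := by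
    simp only [Finset.prod_filter, Fintype.prod_sum_type]; rfl
  rw [hc, hpr] at h
  have hev : Even (Finset.univ.filter (fun i => (p : ℤ) ∣ a i)).card := (Nat.even_add.mp h.1).mpr h'.1
  refine ⟨hev, fun hp2 => ?_⟩
  have h1 := h.2 hp2
  have h2 := h'.2 hp2
  have hne : ∏ i ∈ Finset.univ.filter (fun i => (p : ℤ) ∣ b i), ((b i / p : ℤ) : ZMod p) ≠ 0 := by
    rw [Finset.prod_ne_zero_iff]
    intro i hi h0
    rw [ZMod.intCast_zmod_eq_zero_iff_dvd] at h0
    obtain ⟨k, hk⟩ := h0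
    have := hb i p ⟨k, by rw [← Int.mul_ediv_cancel' (Finset.mem_filter.mp hi).2, hk]; ring⟩
    exact (Nat.prime_iff_prime_int.mp hp).not_isUnit this
  obtain ⟨s, hs⟩ := hev
  obtain ⟨t, ht⟩ := h'.1
  rw [hs, ht, show (s + s + (t + t)) / 2 = s + t by omega, pow_add] at h1
  rw [ht, show (t + t) / 2 = t by omega] at h2
  rw [hs, show (s + s) / 2 = s by omega]
  obtain ⟨c, hc⟩ := h1
  obtain ⟨d, hd⟩ := h2
  have hd0 : d ≠ 0 := by
    rintro rfl
    have : ((-1 : ZMod p) ^ t) ≠ 0 := by simp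
    simp [hne] at hd
  refine ⟨c / d, ?_⟩
  field_simp
  have : (d * d) * ((-1) ^ s * ∏ i ∈ Finset.univ.filter (fun i => (p : ℤ) ∣ a i), ((a i / p : ℤ) : ZMod p)) = c * c := by
    rw [← hd, ← hc]; ring
  linear_combination this

/-- the heart of part A -/
lemma unimod_metabolic {ι : Type} [Fintype ι] (a : ι → ℤ) (ha : ∀ i, Squarefree (a i))
    (Γ : Submodule ℤ (ι → ℚ)) (hfg : Γ.FG)
    (hsd : ∀ x, x ∈ Γ ↔ ∀ y ∈ Γ, ∃ n : ℤ, bf (fun i => (a i : ℚ)) x y = n)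
    (hsg : (Finset.univ.filter (fun i => 0 < a i)).card = (Finset.univ.filter (fun i => a i < 0)).card) :
    MetW (fun i => (a i : ℚ)) := by
  classical
  have ha0 : ∀ i, a i ≠ 0 := fun i => (ha i).ne_zero
  have haq : ∀ i, (a i : ℚ) ≠ 0 := fun i => by exact_mod_cast ha0 i
  have hneg : ∀ p : ℕ, p.Prime → CC p (fun i => - a i) := by
    intro p hp
    refine residue _ (fun i => sqf_neg (ha i)) Γ hfg ?_ p hp
    intro x
    rw [hsd]
    have e : ∀ y, bf (fun i => ((-a i : ℤ) : ℚ)) x y = - bf (fun i => (a i : ℚ)) x y := by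
      intro y; simp [bf_apply, Finset.sum_neg_distrib]
    constructor
    · intro h y hy
      obtain ⟨n, hn⟩ := h y hy
      exact ⟨-n, by rw [e, hn]; simp⟩
    · intro h y hy
      obtain ⟨n, hn⟩ := h y hy
      exact ⟨-n, by rw [e] at hn; push_cast; linarith⟩
  obtain ⟨m, hm⟩ := witt_main a ha0 (by
    intro κ _ b hb hab p hp
    refine CC_cancel hp b (fun i => - a i) (fun i => sqf_neg (ha i)) ?_ (hneg p hp)
    have hsq : ∀ i, Squarefree (Sum.elim b (fun i => - a i) i) := by
      rintro (i | i)
      exacts [hb i, sqf_neg (ha i)]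
    have h0 : ∀ i, ((Sum.elim b (fun i => - a i) i : ℤ) : ℚ) ≠ 0 := by
      intro i; exact_mod_cast (hsq i).ne_zero
    have hM : MetW (fun i => ((Sum.elim b (fun i => - a i) i : ℤ) : ℚ)) := by
      rw [← sum_qc_eq_zero _ h0, Fintype.sum_sum_type]
      simp only [Sum.elim_inl, Sum.elim_inr, Int.cast_neg, qc_neg, Finset.sum_neg_distrib, hab, add_neg_cancel]
    obtain ⟨Γ', h1, h2⟩ := MetW_lattice _ h0 hM
    exact residue _ hsq Γ' h1 h2 p hp)
  have hcard : Fintype.card ι = 2 * (Finset.univ.filter (fun i => 0 < a i)).card := by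
    have h1 := Finset.card_filter_add_card_filter_not (s := (Finset.univ : Finset ι)) (fun i => 0 < a i)
    have h2 : (Finset.univ.filter (fun i => ¬ 0 < a i)) = Finset.univ.filter (fun i => a i < 0) := by
      ext i; have := ha0 i; simp; omega
    rw [h2, ← hsg, Finset.card_univ] at h1
    omega
  have hm0 : m = 0 := by
    rcases Int.eq_nat_or_neg m with ⟨k, rfl | rfl⟩
    · have h0 : ∀ i : ι ⊕ Fin k, ((Sum.elim a (fun _ => -1) i : ℤ) : ℚ) ≠ 0 := by
        rintro (i | i)
        exacts [haq i, by simp]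
      have hM := (sum_qc_eq_zero _ h0).mp (by
        rw [Fintype.sum_sum_type]
        simp [hm, qc_neg])
      have := MetW_pos _ h0 hM
      have e : (Finset.univ.filter (fun i => 0 < ((Sum.elim a (fun _ : Fin k => -1) i : ℤ) : ℚ))).card
          = (Finset.univ.filter (fun i => 0 < a i)).card := by
        simp only [Finset.card_filter, Fintype.sum_sum_type]
        simp
      rw [e, Fintype.card_sum, Fintype.card_fin] at this
      have : k = 0 := by omega
      simp [this]
    · have h0 : ∀ i : ι ⊕ Fin k, ((Sum.elim a (fun _ => 1) i : ℤ) : ℚ) ≠ 0 := by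
        rintro (i | i)
        exacts [haq i, by simp]
      have hM := (sum_qc_eq_zero _ h0).mp (by
        rw [Fintype.sum_sum_type]
        simp [hm])
      have := MetW_neg _ h0 hM
      have e : (Finset.univ.filter (fun i => ((Sum.elim a (fun _ : Fin k => 1) i : ℤ) : ℚ) < 0)).card
          = (Finset.univ.filter (fun i => a i < 0)).card := by
        simp only [Finset.card_filter, Fintype.sum_sum_type]
        simp [(show ¬ ((1:ℚ) < 0) by norm_num)]
      rw [e, Fintype.card_sum, Fintype.card_fin] at this
      have : k = 0 := by omega
      simp [this]
  rw [← sum_qc_eq_zero _ haq, hm, hm0, zero_smul]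

end Nik

namespace Nik
open Module

/-- hyperbolic space in coordinates -/
abbrev HE (r : ℕ) (R : Type) := (Fin r → R) × (Fin r → R)

def hh {r : ℕ} {R : Type} [CommRing R] (x y : HE r R) : R :=
  ∑ i, (x.1 i * y.2 i + x.2 i * y.1 i)

def red (p : ℕ) {r : ℕ} : HE r ℤ →+ HE r (ZMod p) where
  toFun x := (fun i => (x.1 i : ZMod p), fun i => (x.2 i : ZMod p))
  map_zero' := by ext <;> simp
  map_add' x y := by ext <;> simp

lemma red_zsmul (p : ℕ) {r : ℕ} (c : ℤ) (x : HE r ℤ) : red p (c • x) = (c : ZMod p) • red p x := by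
  ext <;> simp [red]

def iot {r : ℕ} {R : Type} [CommRing R] (φ : Fin (r + 1) → R) (i : Fin (r + 1)) :
    HE r R →ₗ[R] HE (r + 1) R where
  toFun x := (i.insertNth 0 x.1, i.insertNth (- ∑ j, φ (i.succAbove j) * x.2 j) (φ i • x.2))
  map_add' x y := by
    ext k
    · refine Fin.succAboveCases i ?_ ?_ k <;> simp
    · refine Fin.succAboveCases i ?_ ?_ k
      · simp [mul_add, Finset.sum_add_distrib]; ring
      · simp [mul_add]
  map_smul' c x := by
    ext k
    · refine Fin.succAboveCases i ?_ ?_ k <;> simp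
    · refine Fin.succAboveCases i ?_ ?_ k
      · simp [Finset.mul_sum]; exact Finset.sum_congr rfl fun j _ => by ring
      · simp; intros; ring

lemma hh_iot {r : ℕ} {R : Type} [CommRing R] (φ : Fin (r + 1) → R) (i : Fin (r + 1)) (x y : HE r R) :
    hh (iot φ i x) (iot φ i y) = φ i * hh x y := by
  unfold hh
  rw [Fin.sum_univ_succAbove _ i, Finset.mul_sum]
  simp only [iot, LinearMap.coe_mk, AddHom.coe_mk, Fin.insertNth_apply_same, Fin.insertNth_apply_succAbove]
  simp only [zero_mul, mul_zero, add_zero, zero_add, Pi.smul_apply, smul_eq_mul]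
  exact Finset.sum_congr rfl fun j _ => by ring

lemma hh_iot_f {r : ℕ} {R : Type} [CommRing R] (φ : Fin (r + 1) → R) (i : Fin (r + 1)) (x : HE r R) :
    hh (φ, 0) (iot φ i x) = 0 := by
  unfold hh
  rw [Fin.sum_univ_succAbove _ i]
  simp only [iot, LinearMap.coe_mk, AddHom.coe_mk, Fin.insertNth_apply_same, Fin.insertNth_apply_succAbove]
  simp only [Pi.zero_apply, zero_mul, add_zero, Pi.smul_apply, smul_eq_mul]
  rw [mul_neg, Finset.mul_sum, neg_add_eq_zero]
  exact Finset.sum_congr rfl fun j _ => by ring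

lemma red_iot (p : ℕ) {r : ℕ} (φ : Fin (r + 1) → ℤ) (i : Fin (r + 1)) (x : HE r ℤ) :
    red p (iot φ i x) = iot (fun k => (φ k : ZMod p)) i (red p x) := by
  ext k
  · refine Fin.succAboveCases i ?_ ?_ k <;> simp [iot, red]
  · refine Fin.succAboveCases i ?_ ?_ k <;> simp [iot, red]

lemma hh_symm {r : ℕ} {R : Type} [CommRing R] (x y : HE r R) : hh x y = hh y x := by
  unfold hh; exact Finset.sum_congr rfl fun j _ => by ring

lemma hh_smul {r : ℕ} {R : Type} [CommRing R] (c : R) (x y : HE r R) : hh x (c • y) = c * hh x y := by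
  unfold hh; rw [Finset.mul_sum]; exact Finset.sum_congr rfl fun j _ => by simp; ring

lemma hh_add {r : ℕ} {R : Type} [CommRing R] (x y z : HE r R) : hh x (y + z) = hh x y + hh x z := by
  unfold hh; rw [← Finset.sum_add_distrib]; exact Finset.sum_congr rfl fun j _ => by simp; ring

def hlin {r : ℕ} {R : Type} [CommRing R] (x : HE r R) : HE r R →ₗ[R] R where
  toFun y := hh x y
  map_add' := hh_add x
  map_smul' c y := by simp [hh_smul]

lemma hlin_apply {r : ℕ} {R : Type} [CommRing R] (x y : HE r R) : hlin x y = hh x y := rfl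

def Claim (p r : ℕ) : Prop := ∀ S : Submodule (ZMod p) (HE r (ZMod p)), finrank (ZMod p) S ≤ r →
  ∃ ν : Fin r → HE r ℤ, (∀ i j, hh (ν i) (ν j) = 0) ∧
    ∀ x : Fin r → ℤ, red p (∑ i, x i • ν i) ∈ S → ∀ i, (p : ℤ) ∣ x i

lemma stepA (p r : ℕ) [Fact p.Prime] (hC : Claim p r) (S : Submodule (ZMod p) (HE (r + 1) (ZMod p)))
    (φ : Fin (r + 1) → ZMod p) (hf : ((φ, 0) : HE (r + 1) (ZMod p)) ∉ S)
    (hd : finrank (ZMod p) (S ⊓ LinearMap.ker (hlin ((φ, 0) : HE (r + 1) (ZMod p))) : Submodule _ _) ≤ r) :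
    ∃ ν : Fin (r + 1) → HE (r + 1) ℤ, (∀ i j, hh (ν i) (ν j) = 0) ∧
    ∀ x : Fin (r + 1) → ℤ, red p (∑ i, x i • ν i) ∈ S → ∀ i, (p : ℤ) ∣ x i := by
  have hφ : ∃ i, φ i ≠ 0 := by
    by_contra h
    push Not at h
    apply hf
    have : φ = 0 := funext h
    rw [this]; exact zero_mem S
  obtain ⟨i, hi⟩ := hφ
  let f : HE (r + 1) (ZMod p) := (φ, 0)
  let W := Submodule.comap (iot φ i) (S ⊔ Submodule.span (ZMod p) {f})
  have hinj : ∀ x (c : ZMod p), iot φ i x + c • f = 0 → x = 0 ∧ c = 0 := by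
    intro x c h
    have h1 := congrFun (congrArg Prod.fst h) i
    simp [iot, f, hi] at h1
    refine ⟨?_, h1⟩
    rw [h1, zero_smul, add_zero] at h
    ext k
    · have := congrFun (congrArg Prod.fst h) (i.succAbove k)
      simpa [iot] using this
    · have := congrFun (congrArg Prod.snd h) (i.succAbove k)
      simpa [iot, hi] using this
  let T : Submodule (ZMod p) (HE (r + 1) (ZMod p)) := (S ⊓ LinearMap.ker (hlin f)) ⊔ Submodule.span (ZMod p) {f}
  have hff : hh f f = 0 := by simp [hh, f]
  have hT : finrank (ZMod p) T ≤ r + 1 := by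
    have h1 := Submodule.finrank_add_le_finrank_add_finrank (S ⊓ LinearMap.ker (hlin f)) (Submodule.span (ZMod p) {f})
    have h2 := finrank_span_le_card (R := ZMod p) ({f} : Set (HE (r + 1) (ZMod p)))
    simp at h2
    exact h1.trans (add_le_add hd h2)
  let Θ : W × ZMod p →ₗ[ZMod p] T := LinearMap.codRestrict T
    (LinearMap.coprod ((iot φ i) ∘ₗ W.subtype) (LinearMap.toSpanSingleton (ZMod p) _ f)) (by
      rintro ⟨⟨x, hx⟩, c⟩
      simp only [LinearMap.coprod_apply, LinearMap.comp_apply, Submodule.subtype_apply, LinearMap.toSpanSingleton_apply]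
      refine add_mem ?_ (Submodule.smul_mem _ _ ((le_sup_right : _ ≤ T) (Submodule.mem_span_singleton_self f)))
      obtain ⟨s, hs, t, ht, hst⟩ := Submodule.mem_sup.mp (Submodule.mem_comap.mp hx)
      obtain ⟨d, rfl⟩ := Submodule.mem_span_singleton.mp ht
      rw [← hst]
      refine add_mem ((le_sup_left : _ ≤ T) ⟨hs, ?_⟩) (Submodule.smul_mem _ _ ((le_sup_right : _ ≤ T) (Submodule.mem_span_singleton_self f)))
      have h1 := hh_iot_f φ i x
      rw [← hst, hh_add, hh_smul] at h1
      rw [SetLike.mem_coe, LinearMap.mem_ker, hlin_apply]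
      have h2 : hh (φ, 0) f = 0 := hff
      rw [h2] at h1
      simpa using h1)
  have hΘ : Function.Injective Θ := by
    rw [← LinearMap.ker_eq_bot, LinearMap.ker_eq_bot']
    rintro ⟨x, c⟩ h
    have := hinj x c (congrArg Subtype.val h)
    ext1
    · exact Subtype.ext this.1
    · exact this.2
  have hW : finrank (ZMod p) W ≤ r := by
    have := LinearMap.finrank_le_finrank_of_injective hΘ
    rw [finrank_prod, finrank_self] at this
    omega
  obtain ⟨ν, hν, hνp⟩ := hC W hW
  let ψ : Fin (r + 1) → ℤ := fun k => (φ k).val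
  have hψ : (fun k => ((ψ k : ℤ) : ZMod p)) = φ := by funext k; simp [ψ]
  refine ⟨Fin.cons (ψ, 0) (fun j => iot ψ i (ν j)), ?_, ?_⟩
  · intro j k
    refine Fin.cases ?_ (fun j => ?_) j <;> refine Fin.cases ?_ (fun k => ?_) k
    · simp [hh]
    · simp only [Fin.cons_zero, Fin.cons_succ]; exact hh_iot_f _ _ _
    · simp only [Fin.cons_zero, Fin.cons_succ]; rw [hh_symm]; exact hh_iot_f _ _ _
    · simp only [Fin.cons_succ]; rw [hh_iot, hν, mul_zero]
  · intro x hx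
    rw [Fin.sum_univ_succ] at hx
    simp only [Fin.cons_zero, Fin.cons_succ] at hx
    have e1 : ∑ j : Fin r, x j.succ • iot ψ i (ν j) = iot ψ i (∑ j : Fin r, x j.succ • ν j) := by
      rw [map_sum]; exact Finset.sum_congr rfl fun j _ => (map_zsmul _ _ _).symm
    have e2 : red p ((ψ, 0) : HE (r + 1) ℤ) = f := by
      ext k
      · exact congrFun hψ k
      · simp [red, f]
    rw [e1, map_add, red_zsmul, red_iot, hψ, e2] at hx
    have h1 : red p (∑ j : Fin r, x j.succ • ν j) ∈ W := by
      rw [Submodule.mem_comap]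
      have : iot φ i (red p (∑ j : Fin r, x j.succ • ν j)) =
        ((x 0 : ZMod p) • f + iot φ i (red p (∑ j : Fin r, x j.succ • ν j))) + (-(x 0 : ZMod p)) • f := by
        rw [neg_smul]; abel
      rw [this]
      exact add_mem ((le_sup_left : S ≤ _) hx) (Submodule.smul_mem _ _ ((le_sup_right : _ ≤ S ⊔ _) (Submodule.mem_span_singleton_self f)))
    have h2 := hνp _ h1
    have h3 : red p (∑ j : Fin r, x j.succ • ν j) = 0 := by
      rw [map_sum]
      refine Finset.sum_eq_zero fun j _ => ?_
      rw [red_zsmul, (ZMod.intCast_zmod_eq_zero_iff_dvd _ _).mpr (h2 j), zero_smul]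
    rw [h3, map_zero, add_zero] at hx
    refine Fin.cases ?_ (fun k => h2 k)
    rw [← ZMod.intCast_zmod_eq_zero_iff_dvd]
    by_contra h0
    exact hf ((Submodule.smul_mem_iff _ h0).mp hx)

lemma sub_union {K M : Type*} [Ring K] [AddCommGroup M] [Module K M] (A S T : Submodule K M)
    (h : ∀ a ∈ A, a ∈ S ∨ a ∈ T) : A ≤ S ∨ A ≤ T := by
  by_contra hc
  push Not at hc
  obtain ⟨⟨x, hx, hxS⟩, ⟨y, hy, hyT⟩⟩ := And.intro (Set.not_subset.mp hc.1) (Set.not_subset.mp hc.2)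
  have hxT := (h x hx).resolve_left hxS
  have hyS := (h y hy).resolve_right hyT
  rcases h _ (add_mem hx hy) with h1 | h1
  · exact hxS ((Submodule.add_mem_iff_left S hyS).mp h1)
  · exact hyT ((Submodule.add_mem_iff_right T hxT).mp h1)

/-- choice of the first isotropic vector -/
lemma choose_f (p r : ℕ) [Fact p.Prime] (S : Submodule (ZMod p) (HE (r + 1) (ZMod p)))
    (hS : finrank (ZMod p) S ≤ r + 1) :
    ∃ φ : Fin (r + 1) → ZMod p,
      (((φ, 0) : HE (r + 1) (ZMod p)) ∉ S ∧
        finrank (ZMod p) (S ⊓ LinearMap.ker (hlin ((φ, 0) : HE (r + 1) (ZMod p))) : Submodule _ _) ≤ r) ∨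
      (((0, φ) : HE (r + 1) (ZMod p)) ∉ S ∧
        finrank (ZMod p) (S ⊓ LinearMap.ker (hlin ((0, φ) : HE (r + 1) (ZMod p))) : Submodule _ _) ≤ r) := by
  let A : Submodule (ZMod p) (HE (r + 1) (ZMod p)) := LinearMap.range (LinearMap.inl _ _ _)
  let B : Submodule (ZMod p) (HE (r + 1) (ZMod p)) := LinearMap.range (LinearMap.inr _ _ _)
  have hA : finrank (ZMod p) A = r + 1 := by
    rw [LinearMap.finrank_range_of_inj LinearMap.inl_injective]; simp
  have hB : finrank (ZMod p) B = r + 1 := by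
    rw [LinearMap.finrank_range_of_inj LinearMap.inr_injective]; simp
  have hlt : ∀ f : HE (r + 1) (ZMod p), ¬ (S ≤ LinearMap.ker (hlin f)) →
      finrank (ZMod p) (S ⊓ LinearMap.ker (hlin f) : Submodule _ _) ≤ r := by
    intro f h
    have : S ⊓ LinearMap.ker (hlin f) < S := lt_of_le_of_ne inf_le_left (fun h' => h (inf_eq_left.mp h'))
    have := Submodule.finrank_lt_finrank_of_lt this
    omega
  by_contra hcon
  push Not at hcon
  let So : Submodule (ZMod p) (HE (r + 1) (ZMod p)) :=
    { carrier := {f | ∀ s ∈ S, hh f s = 0}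
      zero_mem' := by intro s _; simp [hh]
      add_mem' := by
        intro x y hx hy s hs
        rw [hh_symm, hh_add, hh_symm s x, hh_symm s y, hx s hs, hy s hs, add_zero]
      smul_mem' := by
        intro c x hx s hs
        rw [hh_symm, hh_smul, hh_symm s x, hx s hs, mul_zero] }
  have hSo : ∀ f, f ∉ S → r < finrank (ZMod p) (S ⊓ LinearMap.ker (hlin f) : Submodule _ _) → f ∈ So := by
    intro f _ h s hs
    by_contra h0
    have := hlt f (fun h' => h0 (h' hs))
    omega
  have hAS : S = A := by
    have : A ≤ S ∨ A ≤ So := by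
      apply sub_union
      rintro _ ⟨φ, rfl⟩
      by_cases h : LinearMap.inl (ZMod p) _ _ φ ∈ S
      · exact Or.inl h
      · exact Or.inr (hSo _ h ((hcon φ).1 h))
    rcases this with h | h
    · exact (Submodule.eq_of_le_of_finrank_le h (by omega)).symm
    · have hge : S ≤ A := by
        intro s hs
        refine ⟨s.1, ?_⟩
        ext k
        · rfl
        · have := h ⟨Pi.single k 1, rfl⟩ s hs
          simpa [hh, Pi.single_apply, eq_comm] using this
      refine Submodule.eq_of_le_of_finrank_le hge ?_
      by_contra hlt'
      have h1 : ¬ A ≤ S := by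
        intro hle
        exact hlt' (Submodule.finrank_mono hle)
      obtain ⟨x, ⟨φ, rfl⟩, hx⟩ := Set.not_subset.mp h1
      have := (hcon φ).1 hx
      have h2 := Submodule.finrank_mono (inf_le_left : S ⊓ LinearMap.ker (hlin ((φ, 0) : HE (r + 1) (ZMod p))) ≤ S)
      omega
  have hBS : S = B := by
    have : B ≤ S ∨ B ≤ So := by
      apply sub_union
      rintro _ ⟨φ, rfl⟩
      by_cases h : LinearMap.inr (ZMod p) _ _ φ ∈ S
      · exact Or.inl h
      · exact Or.inr (hSo _ h ((hcon φ).2 h))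
    have hSd : finrank (ZMod p) S = r + 1 := by rw [hAS, hA]
    rcases this with h | h
    · exact (Submodule.eq_of_le_of_finrank_le h (by omega)).symm
    · have hge : S ≤ B := by
        intro s hs
        refine ⟨s.2, ?_⟩
        ext k
        · have := h ⟨Pi.single k 1, rfl⟩ s hs
          simpa [hh, Pi.single_apply, eq_comm] using this
        · rfl
      exact Submodule.eq_of_le_of_finrank_le hge (by omega)
  have h1 : ((Pi.single 0 1, 0) : HE (r + 1) (ZMod p)) ∈ B := by
    rw [← hBS, hAS]; exact ⟨_, rfl⟩
  obtain ⟨φ, hφ⟩ := h1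
  have := congrFun (congrArg Prod.fst hφ) 0
  simp at this

lemma claim_all (p r : ℕ) [Fact p.Prime] : Claim p r := by
  induction r with
  | zero => intro S _; exact ⟨Fin.elim0, fun i => i.elim0, fun _ _ i => i.elim0⟩
  | succ r ih =>
    intro S hS
    obtain ⟨φ, ⟨h1, h2⟩ | ⟨h1, h2⟩⟩ := choose_f p r S hS
    · exact stepA p r ih S φ h1 h2
    · let σ := LinearEquiv.prodComm (ZMod p) (Fin (r + 1) → ZMod p) (Fin (r + 1) → ZMod p)
      have hσ : ∀ x y, hh (σ x) (σ y) = hh x y := by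
        intro x y; simp [hh, σ, add_comm]
      obtain ⟨ν, hν, hp⟩ := stepA p r ih (S.comap σ.toLinearMap) φ h1 (by
        refine le_trans (le_of_eq ?_) h2
        have e : S.comap σ.toLinearMap ⊓ LinearMap.ker (hlin ((φ, 0) : HE (r + 1) (ZMod p))) =
          (S ⊓ LinearMap.ker (hlin ((0, φ) : HE (r + 1) (ZMod p)))).comap σ.toLinearMap := by
          ext x
          simp only [Submodule.mem_inf, Submodule.mem_comap, LinearMap.mem_ker, hlin_apply]
          have := hσ (φ, 0) x
          simp only [σ, LinearEquiv.prodComm_apply, Prod.swap_prod_mk] at this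
          simp [σ, this]
        rw [e]
        exact LinearEquiv.finrank_eq (LinearEquiv.submoduleMap σ _ |>.trans
          (LinearEquiv.ofEq _ _ (Submodule.map_comap_eq_of_surjective σ.surjective _))))
      refine ⟨fun i => (ν i).swap, ?_, ?_⟩
      · intro i j; rw [← hν i j]; simp [hh, add_comm]
      · intro x hx
        apply hp x
        rw [Submodule.mem_comap]
        convert hx using 1
        have : ∑ i, x i • (ν i).swap = (∑ i, x i • ν i).swap := by
          ext k <;> simp [Prod.fst_sum, Prod.snd_sum, Finset.sum_apply, -zsmul_eq_mul]
        rw [this]; rfl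

end Nik

namespace Nik
open Module

section
variable {V V' : Type*} [AddCommGroup V] [Module ℚ V] [FiniteDimensional ℚ V]
    [AddCommGroup V'] [Module ℚ V'] [FiniteDimensional ℚ V']

def psi (Φ : V →ₗ[ℚ] V →ₗ[ℚ] ℚ) (Φ' : V' →ₗ[ℚ] V' →ₗ[ℚ] ℚ) : LinearMap.BilinForm ℚ (V × V') :=
  Φ.compl₁₂ (LinearMap.fst ℚ V V') (LinearMap.fst ℚ V V') -
    Φ'.compl₁₂ (LinearMap.snd ℚ V V') (LinearMap.snd ℚ V V')

lemma psi_apply (Φ : V →ₗ[ℚ] V →ₗ[ℚ] ℚ) (Φ' : V' →ₗ[ℚ] V' →ₗ[ℚ] ℚ) (z w : V × V') :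
    psi Φ Φ' z w = Φ z.1 w.1 - Φ' z.2 w.2 := rfl

lemma nondeg_of (Φ : V →ₗ[ℚ] V →ₗ[ℚ] ℚ) (hs : ∀ x y, Φ x y = Φ y x)
    (hnd : ∀ x : V, (∀ y, Φ x y = 0) → x = 0) : LinearMap.BilinForm.Nondegenerate (B := Φ) := by
  constructor
  · exact hnd
  · intro x hx; exact hnd x fun y => by rw [hs]; exact hx y

lemma isSymm_of (Φ : V →ₗ[ℚ] V →ₗ[ℚ] ℚ) (hs : ∀ x y, Φ x y = Φ y x) :
    LinearMap.BilinForm.IsSymm (B := Φ) := ⟨fun x y => by simpa using hs x y⟩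

lemma dual_fg (Φ : V →ₗ[ℚ] V →ₗ[ℚ] ℚ) (hs : ∀ x y, Φ x y = Φ y x)
    (hnd : ∀ x : V, (∀ y, Φ x y = 0) → x = 0) (L : Submodule ℤ V) (hfg : L.FG)
    (hspan : Submodule.span ℚ (L : Set V) = ⊤) : (dualLattice Φ L).FG := by
  classical
  obtain ⟨n, b, rfl⟩ := lattice_basis L hfg hspan
  have h := LinearMap.BilinForm.dualSubmodule_span_of_basis (R := ℤ) Φ (nondeg_of Φ hs hnd) b
  have e : dualLattice Φ (Submodule.span ℤ (Set.range b)) =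
      LinearMap.BilinForm.dualSubmodule Φ (Submodule.span ℤ (Set.range b)) := by
    ext x
    constructor
    · intro hx y hy
      obtain ⟨n, hn⟩ := hx y hy
      exact Submodule.mem_one.mpr ⟨n, by simpa using hn.symm⟩
    · intro hx y hy
      obtain ⟨m, hm⟩ := Submodule.mem_one.mp (hx y hy)
      exact ⟨m, by simpa using hm.symm⟩
  rw [e, h]
  exact Submodule.fg_span (Set.finite_range _)

lemma glue (Φ : V →ₗ[ℚ] V →ₗ[ℚ] ℚ) (Φ' : V' →ₗ[ℚ] V' →ₗ[ℚ] ℚ)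
    (hsymm : ∀ x y, Φ x y = Φ y x) (hsymm' : ∀ x y, Φ' x y = Φ' y x)
    (hnd : ∀ x : V, (∀ y, Φ x y = 0) → x = 0)
    (hnd' : ∀ x : V', (∀ y, Φ' x y = 0) → x = 0)
    (L : Submodule ℤ V) (hfg : L.FG)
    (hspan : Submodule.span ℚ (L : Set V) = ⊤)
    (hint : ∀ x ∈ L, ∀ y ∈ L, ∃ n : ℤ, Φ x y = (n : ℚ))
    (L' : Submodule ℤ V') (hfg' : L'.FG)
    (hspan' : Submodule.span ℚ (L' : Set V') = ⊤)
    (hint' : ∀ x ∈ L', ∀ y ∈ L', ∃ n : ℤ, Φ' x y = (n : ℚ))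
    (hdisc : ∃ g : discGroup Φ L ≃+ discGroup Φ' L',
      ∀ (x : ↥(dualLattice Φ L)) (y : ↥(dualLattice Φ' L')),
        g (Submodule.Quotient.mk x) = Submodule.Quotient.mk y →
        ∃ n : ℤ, Φ' (y : V') (y : V') - Φ (x : V) (x : V) = 2 * (n : ℚ)) :
    ∃ Γ : Submodule ℤ (V × V'), Γ.FG ∧
      (∀ x, x ∈ Γ ↔ ∀ y ∈ Γ, ∃ n : ℤ, psi Φ Φ' x y = n) ∧
      (∀ x ∈ Γ, ∃ n : ℤ, psi Φ Φ' x x = 2 * n) ∧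
      (∀ x, (x, 0) ∈ Γ ↔ x ∈ L) ∧ (∀ y, (0, y) ∈ Γ ↔ y ∈ L') := by
  obtain ⟨g, hg⟩ := hdisc
  let Γ : Submodule ℤ (V × V') :=
    { carrier := {z | ∃ (hx : z.1 ∈ dualLattice Φ L) (hy : z.2 ∈ dualLattice Φ' L'),
        g (Submodule.Quotient.mk ⟨z.1, hx⟩) = Submodule.Quotient.mk ⟨z.2, hy⟩}
      add_mem' := by
        rintro z w ⟨hx, hy, h⟩ ⟨hx', hy', h'⟩
        refine ⟨add_mem hx hx', add_mem hy hy', ?_⟩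
        have e := congrArg₂ (· + ·) h h'
        rw [← map_add, ← Submodule.Quotient.mk_add, ← Submodule.Quotient.mk_add] at e
        exact e
      zero_mem' := ⟨zero_mem _, zero_mem _, by
        have := map_zero g
        exact this⟩
      smul_mem' := by
        rintro c z ⟨hx, hy, h⟩
        refine ⟨Submodule.smul_mem _ c hx, Submodule.smul_mem _ c hy, ?_⟩
        have e := congrArg (fun t => c • t) h
        rw [← map_zsmul, ← Submodule.Quotient.mk_smul, ← Submodule.Quotient.mk_smul] at e
        exact e }
  have hΓfg : Γ.FG := by
    have h1 : ((dualLattice Φ L).prod (dualLattice Φ' L')).FG :=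
      (dual_fg Φ hsymm hnd L hfg hspan).prod (dual_fg Φ' hsymm' hnd' L' hfg' hspan')
    refine Submodule.FG.of_le h1 ?_
    rintro z ⟨hx, hy, -⟩
    exact ⟨hx, hy⟩
  have hLd : ∀ x ∈ L, x ∈ dualLattice Φ L := fun x hx y hy => hint x hx y hy
  have hLd' : ∀ x ∈ L', x ∈ dualLattice Φ' L' := fun x hx y hy => hint' x hx y hy
  have hL : ∀ x, (x, 0) ∈ Γ ↔ x ∈ L := by
    intro x
    constructor
    · rintro ⟨hx, hy, h⟩
      have h0 : (Submodule.Quotient.mk ⟨(0 : V'), hy⟩ : discGroup Φ' L') = 0 :=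
        (Submodule.Quotient.mk_eq_zero _).mpr (by simp [Submodule.mem_comap])
      have h1 : g (Submodule.Quotient.mk ⟨x, hx⟩) = 0 := h.trans h0
      rw [EmbeddingLike.map_eq_zero_iff] at h1
      exact (Submodule.Quotient.mk_eq_zero (Submodule.comap (dualLattice Φ L).subtype L)).mp h1
    · intro hx
      refine ⟨hLd x hx, zero_mem _, ?_⟩
      have h0 : (Submodule.Quotient.mk ⟨x, hLd x hx⟩ : discGroup Φ L) = 0 :=
        (Submodule.Quotient.mk_eq_zero _).mpr hx
      refine (congrArg g h0).trans ((map_zero g).trans ?_)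
      exact ((Submodule.Quotient.mk_eq_zero _).mpr (by simp [Submodule.mem_comap])).symm
  have hL' : ∀ x, (0, x) ∈ Γ ↔ x ∈ L' := by
    intro x
    have h0 : ∀ hx : (0 : V) ∈ dualLattice Φ L, (Submodule.Quotient.mk ⟨(0 : V), hx⟩ : discGroup Φ L) = 0 :=
      fun hx => (Submodule.Quotient.mk_eq_zero _).mpr (by simp [Submodule.mem_comap])
    constructor
    · rintro ⟨hx, hy, h⟩
      have h1 : (Submodule.Quotient.mk ⟨x, hy⟩ : discGroup Φ' L') = 0 :=
        h.symm.trans ((congrArg g (h0 hx)).trans (map_zero g))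
      exact (Submodule.Quotient.mk_eq_zero (Submodule.comap (dualLattice Φ' L').subtype L')).mp h1
    · intro hx
      refine ⟨zero_mem _, hLd' x hx, ?_⟩
      refine (congrArg g (h0 _)).trans ((map_zero g).trans ?_)
      exact ((Submodule.Quotient.mk_eq_zero (Submodule.comap (dualLattice Φ' L').subtype L') (x := ⟨x, hLd' x hx⟩)).mpr hx).symm
  have hev : ∀ x ∈ Γ, ∃ n : ℤ, psi Φ Φ' x x = 2 * n := by
    rintro z ⟨hx, hy, h⟩
    obtain ⟨n, hn⟩ := hg _ _ h
    refine ⟨-n, ?_⟩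
    rw [psi_apply]; push_cast; simp only at hn; linarith
  refine ⟨Γ, hΓfg, ?_, hev, hL, hL'⟩
  intro z
  constructor
  · intro hz w hw
    obtain ⟨a, ha⟩ := hev z hz
    obtain ⟨b, hb⟩ := hev w hw
    obtain ⟨c, hc⟩ := hev _ (add_mem hz hw)
    refine ⟨c - a - b, ?_⟩
    have hs : psi Φ Φ' w z = psi Φ Φ' z w := by
      rw [psi_apply, psi_apply, hsymm, hsymm']
    simp only [map_add, LinearMap.add_apply] at hc
    rw [hs, ha, hb] at hc
    push_cast; linarith
  · intro h
    have hz1 : z.1 ∈ dualLattice Φ L := by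
      intro y hy
      obtain ⟨n, hn⟩ := h _ ((hL y).mpr hy)
      exact ⟨n, by rw [← hn, psi_apply]; simp⟩
    have hz2 : z.2 ∈ dualLattice Φ' L' := by
      intro y hy
      obtain ⟨n, hn⟩ := h _ ((hL' y).mpr hy)
      exact ⟨-n, by rw [psi_apply] at hn; simp at hn; push_cast; linarith⟩
    obtain ⟨⟨y, hy⟩, hgy⟩ := Submodule.Quotient.mk_surjective _ (g (Submodule.Quotient.mk ⟨z.1, hz1⟩))
    have hd : z.2 - y ∈ L' := by
      refine bidual (B := Φ') (nondeg_of Φ' hsymm' hnd') (isSymm_of Φ' hsymm') L' hfg' hspan' _ ?_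
      intro w hw
      have hw' : w ∈ dualLattice Φ' L' := hw
      obtain ⟨⟨u, hu⟩, hgu⟩ := Submodule.Quotient.mk_surjective _ (g.symm (Submodule.Quotient.mk ⟨w, hw'⟩))
      have huw : (u, w) ∈ Γ := ⟨hu, hw', by rw [hgu]; simp⟩
      have hzy : (z.1, y) ∈ Γ := ⟨hz1, hy, hgy.symm⟩
      obtain ⟨n, hn⟩ := h _ huw
      obtain ⟨a, ha⟩ := hev _ huw
      obtain ⟨b, hb⟩ := hev _ hzy
      obtain ⟨c, hc⟩ := hev _ (add_mem huw hzy)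
      simp only [psi_apply, Prod.mk_add_mk, map_add, LinearMap.add_apply] at hn ha hb hc
      rw [hsymm u z.1, hsymm' w y] at hc
      refine ⟨(c - a - b) - n, ?_⟩
      rw [map_sub, LinearMap.sub_apply]
      push_cast
      linarith
    refine ⟨hz1, hz2, hgy.symm.trans ?_⟩
    rw [Submodule.Quotient.eq, Submodule.mem_comap]
    have := neg_mem hd
    simpa using this

end
end Nik

namespace Nik
open Module

lemma sig_basis {V : Type*} [AddCommGroup V] [Module ℚ V] (Φ : V →ₗ[ℚ] V →ₗ[ℚ] ℚ) (tp tm : ℕ)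
    (h : hasSignature Φ tp tm) : ∃ (b : Basis (Fin (tp + tm)) ℚ V) (a : Fin (tp + tm) → ℤ),
      (∀ i, Squarefree (a i)) ∧ (∀ i j, Φ (b i) (b j) = if i = j then (a i : ℚ) else 0) ∧
      (∀ i, (0 < a i ↔ (i : ℕ) < tp)) := by
  obtain ⟨b, ho, hsg⟩ := h
  have hne : ∀ i, Φ (b i) (b i) ≠ 0 := by
    intro i
    rcases lt_or_ge (i : ℕ) tp with hi | hi
    · exact ((hsg i).1 hi).ne'
    · exact ((hsg i).2 hi).ne
  have key : ∀ i, ∃ (a : ℤ) (t : ℚ), t ≠ 0 ∧ Squarefree a ∧ t * t * Φ (b i) (b i) = a := by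
    intro i
    set q := Φ (b i) (b i) with hq
    have hd : (q.den : ℚ) ≠ 0 := by exact_mod_cast q.den_ne_zero
    obtain ⟨a, s, hs, ha, has⟩ := sqf_part (q.num * q.den)
      (mul_ne_zero (Rat.num_ne_zero.mpr (hne i)) (by exact_mod_cast q.den_ne_zero))
    have hs' : (s : ℚ) ≠ 0 := by exact_mod_cast hs
    refine ⟨a, q.den / s, div_ne_zero hd hs', ha, ?_⟩
    have h1 : (q.num : ℚ) * q.den = a * s ^ 2 := by exact_mod_cast has
    have h2 : q * q.den = q.num := Rat.mul_den_eq_num q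
    field_simp
    linear_combination h1 + (q.den : ℚ) * h2
  choose a t ht ha hat using key
  refine ⟨b.isUnitSMul (w := t) (fun i => (ht i).isUnit), a, ha, ?_, ?_⟩
  · intro i j
    simp only [Basis.isUnitSMul_apply, map_smul, LinearMap.smul_apply, smul_eq_mul]
    split_ifs with hij
    · subst hij; rw [← hat]; ring
    · rw [ho i j hij]; ring
  · intro i
    have hp : 0 < t i * t i := mul_self_pos.mpr (ht i)
    constructor
    · intro h
      by_contra hc
      have h1 := (hsg i).2 (by omega)
      have h2 : (0 : ℚ) < a i := by exact_mod_cast h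
      rw [← hat] at h2
      nlinarith
    · intro h
      have h1 := (hsg i).1 h
      have : (0 : ℚ) < a i := by rw [← hat]; positivity
      exact_mod_cast this

lemma lagr_exists {V V' : Type*} [AddCommGroup V] [Module ℚ V] [FiniteDimensional ℚ V]
    [AddCommGroup V'] [Module ℚ V'] [FiniteDimensional ℚ V']
    (Φ : V →ₗ[ℚ] V →ₗ[ℚ] ℚ) (Φ' : V' →ₗ[ℚ] V' →ₗ[ℚ] ℚ)
    (tp tm : ℕ) (hsig : hasSignature Φ tp tm) (hsig' : hasSignature Φ' tp tm)
    (Γ : Submodule ℤ (V × V')) (hfg : Γ.FG)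
    (hsd : ∀ x, x ∈ Γ ↔ ∀ y ∈ Γ, ∃ n : ℤ, psi Φ Φ' x y = n) :
    ∃ N : Submodule ℚ (V × V'), (∀ x ∈ N, ∀ y ∈ N, psi Φ Φ' x y = 0) ∧
      finrank ℚ (V × V') ≤ 2 * finrank ℚ N := by
  classical
  obtain ⟨b, a, ha, hb, hp⟩ := sig_basis Φ tp tm hsig
  obtain ⟨b', a', ha', hb', hp'⟩ := sig_basis Φ' tp tm hsig'
  let c := b.prod b'
  let w : Fin (tp + tm) ⊕ Fin (tp + tm) → ℤ := Sum.elim a (fun i => - a' i)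
  have hpsi : psi Φ Φ' = (bf (fun i => (w i : ℚ))).compl₁₂ c.equivFun.toLinearMap c.equivFun.toLinearMap := by
    refine LinearMap.BilinForm.ext_basis c ?_
    rintro i j
    simp only [LinearMap.compl₁₂_apply, LinearEquiv.coe_coe, Basis.equivFun_apply, Basis.repr_self,
      Finsupp.single_eq_pi_single]
    rw [bf_single, psi_apply]
    rcases i with i | i <;> rcases j with j | j
    · simp only [c, Basis.prod_apply_inl_fst, Basis.prod_apply_inl_snd, hb, w]
      simp [Pi.single_apply]
      split_ifs <;> simp_all
    · simp [c, w]
    · simp [c, w]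
    · simp only [c, Basis.prod_apply_inr_fst, Basis.prod_apply_inr_snd, hb', w]
      simp [Pi.single_apply]
      split_ifs <;> simp_all
  have hpsi' : ∀ x y, psi Φ Φ' x y = bf (fun i => (w i : ℚ)) (c.equivFun x) (c.equivFun y) := by
    intro x y; rw [hpsi]; rfl
  have hM := unimod_metabolic w (by
      rintro (i | i)
      exacts [ha i, sqf_neg (ha' i)]) (Γ.map (c.equivFun.toLinearMap.restrictScalars ℤ)) (hfg.map _) (by
      intro x
      obtain ⟨x, rfl⟩ := c.equivFun.surjective x
      have : c.equivFun x ∈ Γ.map (c.equivFun.toLinearMap.restrictScalars ℤ) ↔ x ∈ Γ := by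
        constructor
        · rintro ⟨y, hy, h⟩
          rwa [← c.equivFun.injective h]
        · intro h; exact ⟨x, h, rfl⟩
      rw [this, hsd]
      constructor
      · rintro h _ ⟨y, hy, rfl⟩
        obtain ⟨n, hn⟩ := h y hy
        exact ⟨n, by rw [← hn, hpsi']; rfl⟩
      · intro h y hy
        obtain ⟨n, hn⟩ := h _ ⟨y, hy, rfl⟩
        exact ⟨n, by rw [← hn, hpsi']; rfl⟩) (by
      have e1 : ∀ i, a i < 0 ↔ ¬ ((i : ℕ) < tp) := by
        intro i; rw [← hp]; have := (ha i).ne_zero; omega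
      have e2 : ∀ i, a' i < 0 ↔ ¬ ((i : ℕ) < tp) := by
        intro i; rw [← hp']; have := (ha' i).ne_zero; omega
      simp only [Finset.card_filter, Fintype.sum_sum_type, w, Sum.elim_inl, Sum.elim_inr,
        Int.neg_pos, Int.neg_neg_iff_pos, e1, e2, hp, hp']
      exact add_comm _ _)
  obtain ⟨N, h1, h2⟩ := hM
  refine ⟨N.map c.equivFun.symm.toLinearMap, ?_, ?_⟩
  · rintro _ ⟨x, hx, rfl⟩ _ ⟨y, hy, rfl⟩
    rw [hpsi', LinearEquiv.coe_coe, LinearEquiv.apply_symm_apply, LinearEquiv.apply_symm_apply]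
    exact h1 x hx y hy
  · rw [LinearEquiv.finrank_map_eq, finrank_eq_card_basis c]
    exact h2

lemma clear_den {E : Type*} [AddCommGroup E] [Module ℚ E] (Γ : Submodule ℤ E)
    (hspan : Submodule.span ℚ (Γ : Set E) = ⊤) (v : E) : ∃ m : ℤ, m ≠ 0 ∧ m • v ∈ Γ := by
  have hv : v ∈ Submodule.span ℚ (Γ : Set E) := by rw [hspan]; trivial
  induction hv using Submodule.span_induction with
  | mem x h => exact ⟨1, one_ne_zero, by simpa using h⟩
  | zero => exact ⟨1, one_ne_zero, by simp⟩
  | add x y _ _ hx hy =>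
    obtain ⟨m, hm, h⟩ := hx
    obtain ⟨k, hk, h'⟩ := hy
    refine ⟨m * k, mul_ne_zero hm hk, ?_⟩
    rw [smul_add]
    refine add_mem ?_ ?_
    · rw [mul_comm, mul_smul]; exact Γ.smul_mem _ h
    · rw [mul_smul]; exact Γ.smul_mem _ h'
  | smul q x _ hx =>
    obtain ⟨m, hm, h⟩ := hx
    refine ⟨m * q.den, mul_ne_zero hm (by exact_mod_cast q.den_ne_zero), ?_⟩
    have : (m * q.den : ℤ) • q • x = q.num • m • x := by
      simp only [← Int.cast_smul_eq_zsmul ℚ, smul_smul]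
      congr 1
      push_cast
      rw [mul_assoc, mul_comm (q.den : ℚ), Rat.mul_den_eq_num, mul_comm]
    rw [this]; exact Γ.smul_mem _ h

lemma hyp_coord {E : Type*} [AddCommGroup E] [Module ℚ E] [FiniteDimensional ℚ E]
    (B : LinearMap.BilinForm ℚ E) (hB : B.Nondegenerate) (hs : ∀ x y, B x y = B y x)
    (Γ : Submodule ℤ E) (hfg : Γ.FG) (hspan : Submodule.span ℚ (Γ : Set E) = ⊤)
    (hsd : ∀ x, x ∈ Γ ↔ ∀ y ∈ Γ, ∃ n : ℤ, B x y = n)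
    (hev : ∀ x ∈ Γ, ∃ n : ℤ, B x x = 2 * n)
    (N : Submodule ℚ E) (hN : ∀ x ∈ N, ∀ y ∈ N, B x y = 0) (hN2 : finrank ℚ E ≤ 2 * finrank ℚ N) :
    ∃ (r : ℕ) (θ : HE r ℤ →ₗ[ℤ] E), (∀ x, θ x ∈ Γ) ∧ (∀ γ ∈ Γ, ∃ x, θ x = γ) ∧
      (∀ x y, B (θ x) (θ y) = (hh x y : ℤ)) ∧ finrank ℚ E = r + r := by
  classical
  obtain ⟨h3, -⟩ := lagr B hB N hN hN2
  have hfin : Module.Finite ℤ Γ := Module.Finite.iff_fg.mpr hfg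
  have htf : IsTorsionFree ℤ E := IsTorsionFree.trans_faithfulSMul ℤ ℚ E
  have hfree : Module.Free ℤ Γ := inferInstance
  have hnum : ∀ x y : Γ, (((B x y).num : ℤ) : ℚ) = B x y := by
    intro x y
    obtain ⟨n, hn⟩ := (hsd x).mp x.2 y y.2
    rw [hn]; simp
  let Bz : Γ →ₗ[ℤ] Γ →ₗ[ℤ] ℤ := LinearMap.mk₂ ℤ (fun x y => (B x y).num)
    (by intro x y z
        have : (((B (x + y : Γ) z).num : ℤ) : ℚ) = (B x z).num + (B y z).num := by
          rw [hnum, hnum, hnum]; simp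
        exact_mod_cast this)
    (by intro c x z
        have : (((B (c • x : Γ) z).num : ℤ) : ℚ) = c * (B x z).num := by
          rw [hnum, hnum, Submodule.coe_smul, map_zsmul, LinearMap.smul_apply, zsmul_eq_mul]
        rw [smul_eq_mul]
        exact_mod_cast this)
    (by intro z x y
        have : (((B z (x + y : Γ)).num : ℤ) : ℚ) = (B z x).num + (B z y).num := by
          rw [hnum, hnum, hnum]; simp
        exact_mod_cast this)
    (by intro c z x
        have : (((B z (c • x : Γ)).num : ℤ) : ℚ) = c * (B z x).num := by
          rw [hnum, hnum, Submodule.coe_smul, map_zsmul, zsmul_eq_mul]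
        rw [smul_eq_mul]
        exact_mod_cast this)
  have hBz : ∀ x y : Γ, ((Bz x y : ℤ) : ℚ) = B x y := hnum
  have hinj : ∀ {m n : ℤ}, (m : ℚ) = n → m = n := fun h => by exact_mod_cast h
  obtain ⟨r, a, b, haa, hbb, hab, hx, -⟩ := hyp_basis Bz
    (fun x y => hinj (by rw [hBz, hBz, hs]))
    (by
      intro φ
      obtain ⟨n, c, hc⟩ := lattice_basis Γ hfg hspan
      have hcG : ∀ i, c i ∈ Γ := fun i => by rw [hc]; exact Submodule.subset_span ⟨i, rfl⟩
      let φq : E →ₗ[ℚ] ℚ := c.constr ℚ (fun i => (φ ⟨c i, hcG i⟩ : ℚ))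
      have hφ : ∀ y : Γ, φq y = φ y := by
        rintro ⟨y, hy⟩
        have hy' := hy
        rw [hc] at hy'
        have : ∀ y ∈ Submodule.span ℤ (Set.range c), ∀ hy : y ∈ Γ, φq y = φ ⟨y, hy⟩ := by
          intro y hy
          induction hy using Submodule.span_induction with
          | mem x h => rintro _; obtain ⟨i, rfl⟩ := h; simp [φq]
          | zero => intro h; rw [map_zero]; symm; exact_mod_cast map_zero φ
          | add x y hx hy h1 h2 =>
            intro h
            rw [← hc] at hx hy
            rw [map_add, h1 hx, h2 hy, ← Int.cast_add, ← map_add]; rfl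
          | smul q x hx h1 =>
            intro h
            rw [← hc] at hx
            rw [map_zsmul, h1 hx, zsmul_eq_mul, ← Int.cast_mul, ← smul_eq_mul, ← map_smul]; rfl
        exact this y hy' hy
      let x := (LinearMap.BilinForm.toDual B hB).symm φq
      have hxq : ∀ y, B x y = φq y := by
        intro y
        have := LinearMap.BilinForm.toDual_def (B := B) hB (m := x) (n := y)
        rw [← this]; simp [x]
      have hxG : x ∈ Γ := by
        rw [hsd]
        intro y hy
        exact ⟨φ ⟨y, hy⟩, by rw [hxq, ← hφ ⟨y, hy⟩]⟩
      exact ⟨⟨x, hxG⟩, fun y => hinj (by rw [hBz, hxq, hφ])⟩)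
    (by
      intro x
      obtain ⟨n, hn⟩ := hev x x.2
      exact ⟨n, hinj (by rw [hBz, hn]; push_cast; ring)⟩)
    ((N.restrictScalars ℤ).comap Γ.subtype) (by
      intro x
      constructor
      · intro hx y hy
        exact hinj (by rw [hBz, hN x hx y hy]; simp)
      · intro h
        change (x : E) ∈ N
        rw [← h3]
        intro y hy
        obtain ⟨m, hm, hmy⟩ := clear_den Γ hspan y
        have h1 : B x (m • y) = 0 := by
          have h2 : (m • y) ∈ N := by rw [← Int.cast_smul_eq_zsmul ℚ]; exact N.smul_mem _ hy
          have := h ⟨m • y, hmy⟩ h2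
          rw [← hBz x ⟨m • y, hmy⟩, this]; simp
        rw [map_zsmul, zsmul_eq_mul] at h1
        have hm' : (m : ℚ) ≠ 0 := by exact_mod_cast hm
        have := (mul_eq_zero.mp h1).resolve_left hm'
        change B y x = 0
        rw [hs]; exact this)
  have qaa : ∀ i j, B (a i) (a j) = 0 := fun i j => by rw [← hBz, haa]; simp
  have qbb : ∀ i j, B (b i) (b j) = 0 := fun i j => by rw [← hBz, hbb]; simp
  have qab : ∀ i j, B (a i) (b j) = if i = j then 1 else 0 := fun i j => by rw [← hBz, hab]; simp
  have qba : ∀ i j, B (b i) (a j) = if i = j then 1 else 0 := fun i j => by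
    rw [hs, qab]; simp [eq_comm]
  let θq : ((Fin r → ℚ) × (Fin r → ℚ)) →ₗ[ℚ] E :=
    LinearMap.coprod (Fintype.linearCombination ℚ (fun i => (a i : E)))
      (Fintype.linearCombination ℚ (fun i => (b i : E)))
  have hθq : ∀ x, θq x = ∑ i, x.1 i • (a i : E) + ∑ i, x.2 i • (b i : E) := by
    intro x; simp [θq, Fintype.linearCombination_apply]
  have hform : ∀ x y, B (θq x) (θq y) = ∑ i, (x.1 i * y.2 i + x.2 i * y.1 i) := by
    intro x y
    rw [hθq, hθq]
    simp only [map_add, map_sum, map_smul, LinearMap.add_apply, LinearMap.sum_apply,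
      LinearMap.smul_apply, qaa, qbb, qab, qba, smul_eq_mul]
    simp [Finset.sum_add_distrib]
    rw [add_comm]
    congr 1 <;> exact Finset.sum_congr rfl fun i _ => by ring
  have hker : Function.Injective θq := by
    rw [← LinearMap.ker_eq_bot, LinearMap.ker_eq_bot']
    intro x hx
    have h1 : ∀ y : (Fin r → ℚ) × (Fin r → ℚ), ∑ i, (x.1 i * y.2 i + x.2 i * y.1 i) = 0 := by
      intro y
      rw [← hform x y, hx]; simp
    ext i
    · simpa [Pi.single_apply] using h1 (0, Pi.single i 1)
    · simpa [Pi.single_apply] using h1 (Pi.single i 1, 0)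
  have hsurjG : ∀ γ ∈ Γ, ∃ x1 x2 : Fin r → ℤ, γ = ∑ i, x1 i • (a i : E) + ∑ i, x2 i • (b i : E) := by
    intro γ hγ
    refine ⟨fun i => Bz ⟨γ, hγ⟩ (b i), fun i => Bz ⟨γ, hγ⟩ (a i), ?_⟩
    have := congrArg (Γ.subtype) (hx ⟨γ, hγ⟩)
    simpa only [map_add, map_sum, map_smul, Submodule.subtype_apply] using this
  have hsurj : Function.Surjective θq := by
    intro v
    obtain ⟨m, hm, hmv⟩ := clear_den Γ hspan v
    obtain ⟨x1, x2, h⟩ := hsurjG _ hmv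
    have hm' : (m : ℚ) ≠ 0 := by exact_mod_cast hm
    refine ⟨(m : ℚ)⁻¹ • (fun i => (x1 i : ℚ), fun i => (x2 i : ℚ)), ?_⟩
    rw [map_smul, hθq]
    simp only [Int.cast_smul_eq_zsmul]
    rw [← h, ← Int.cast_smul_eq_zsmul ℚ, smul_smul, inv_mul_cancel₀ hm', one_smul]
  let θ : HE r ℤ →ₗ[ℤ] E :=
    LinearMap.coprod (Fintype.linearCombination ℤ (fun i => (a i : E)))
      (Fintype.linearCombination ℤ (fun i => (b i : E)))
  have hθ : ∀ x, θ x = ∑ i, x.1 i • (a i : E) + ∑ i, x.2 i • (b i : E) := by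
    intro x; simp [θ, Fintype.linearCombination_apply]
  refine ⟨r, θ, ?_, ?_, ?_, ?_⟩
  · intro x
    rw [hθ]
    exact add_mem (sum_mem fun i _ => Γ.smul_mem _ (a i).2) (sum_mem fun i _ => Γ.smul_mem _ (b i).2)
  · intro γ hγ
    obtain ⟨x1, x2, h⟩ := hsurjG γ hγ
    exact ⟨(x1, x2), by rw [hθ, h]⟩
  · intro x y
    have e : ∀ x : HE r ℤ, θ x = θq (fun i => (x.1 i : ℚ), fun i => (x.2 i : ℚ)) := by
      intro x; rw [hθ, hθq]; simp only [Int.cast_smul_eq_zsmul]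
    rw [e, e, hform]
    simp [hh]
  · have := (LinearEquiv.ofBijective θq ⟨hker, hsurj⟩).finrank_eq
    rw [← this]; simp

end Nik

namespace Nik
open Module

/-- membership in the localization of a lattice at `p` -/
def InLoc {V : Type*} [AddCommGroup V] (p : ℕ) (L : Submodule ℤ V) (x : V) : Prop :=
  ∃ m : ℤ, ¬ (p : ℤ) ∣ m ∧ m • x ∈ L

lemma int_pow_dvd_zero {p : ℕ} (hp : p.Prime) (z : ℤ) (h : ∀ k : ℕ, (p : ℤ) ^ k ∣ z) : z = 0 := by
  have h1 := h z.natAbs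
  rw [← Nat.cast_pow, Int.natCast_dvd] at h1
  by_contra hz
  have h2 := Nat.le_of_dvd (Int.natAbs_pos.mpr hz) h1
  exact absurd (Nat.lt_pow_self hp.one_lt (n := z.natAbs)) (by omega)

lemma common_den {r : ℕ} (x : Fin r → ℚ) : ∃ m : ℤ, m ≠ 0 ∧ ∃ z : Fin r → ℤ, ∀ i, m * x i = z i := by
  refine ⟨∏ i, ((x i).den : ℤ), Finset.prod_ne_zero_iff.mpr fun i _ => by exact_mod_cast (x i).den_ne_zero,
    fun i => (∏ j ∈ Finset.univ.erase i, ((x j).den : ℤ)) * (x i).num, fun i => ?_⟩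
  rw [← Finset.prod_erase_mul _ _ (Finset.mem_univ i)]
  push_cast
  rw [mul_assoc, mul_comm ((x i).den : ℚ), Rat.mul_den_eq_num]

lemma locA {E W : Type*} [AddCommGroup E] [Module ℚ E] [AddCommGroup W] [Module ℚ W]
    [FiniteDimensional ℚ W] (π : E →ₗ[ℚ] W) (r : ℕ) (hr : finrank ℚ W = r) (Γ : Submodule ℤ E)
    (v : Fin r → E) (hv : ∀ i, v i ∈ Γ) (p : ℕ) (hp : p.Prime)
    (H : ∀ x : Fin r → ℤ, ∀ k ∈ Γ, ∀ γ ∈ Γ, π k = 0 → ∑ i, x i • v i = k + (p : ℤ) • γ → ∀ i, (p : ℤ) ∣ x i) :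
    Function.Bijective (π ∘ₗ Fintype.linearCombination ℚ v) ∧
    ∀ γ ∈ Γ, ∃ m : ℤ, ¬ (p : ℤ) ∣ m ∧ ∃ x : Fin r → ℤ, π (m • γ) = π (∑ i, x i • v i) := by
  have hp0 : (p : ℤ) ≠ 0 := by exact_mod_cast hp.ne_zero
  have hpW : ∀ w : W, (p : ℤ) • w = 0 → w = 0 := by
    intro w hw
    rw [← Int.cast_smul_eq_zsmul ℚ] at hw
    exact (smul_eq_zero.mp hw).resolve_left (by exact_mod_cast hp0)
  have hvG : ∀ x : Fin r → ℤ, ∑ i, x i • v i ∈ Γ := fun x => sum_mem fun i _ => Γ.smul_mem _ (hv i)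
  have hps : ∀ x : Fin r → ℤ, ∑ i, ((p : ℤ) * x i) • v i = (p : ℤ) • ∑ i, x i • v i := by
    intro x; rw [Finset.smul_sum]; exact Finset.sum_congr rfl fun i _ => mul_smul _ _ _
  have hA : ∀ k : ℕ, ∀ x : Fin r → ℤ, π (∑ i, x i • v i) = 0 → ∀ i, (p : ℤ) ^ k ∣ x i := by
    intro k
    induction k with
    | zero => intro x _ i; simp
    | succ k ih =>
      intro x hx i
      have h1 := H x _ (hvG x) 0 (zero_mem _) hx (by simp)
      choose y hy using h1
      have hxy : x = fun i => (p : ℤ) * y i := funext hy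
      rw [hxy, hps, map_zsmul] at hx
      have := ih y (hpW _ hx) i
      rw [hy, pow_succ']
      exact mul_dvd_mul_left _ this
  have hinj : Function.Injective (π ∘ₗ Fintype.linearCombination ℚ v) := by
    rw [← LinearMap.ker_eq_bot, LinearMap.ker_eq_bot']
    intro x hx
    obtain ⟨m, hm, z, hz⟩ := common_den x
    have hz0 : ∀ i, z i = 0 := by
      intro i
      refine int_pow_dvd_zero hp _ fun k => hA k z ?_ i
      have : ∑ i, z i • v i = Fintype.linearCombination ℚ v ((m : ℚ) • x) := by
        rw [Fintype.linearCombination_apply]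
        refine Finset.sum_congr rfl fun i _ => ?_
        rw [← Int.cast_smul_eq_zsmul ℚ, ← hz]; rfl
      rw [this, map_smul, map_smul]
      rw [LinearMap.comp_apply] at hx
      rw [hx, smul_zero]
    funext i
    have := hz i
    rw [hz0] at this
    have hm' : (m : ℚ) ≠ 0 := by exact_mod_cast hm
    simpa [hm'] using this
  have hbij : Function.Bijective (π ∘ₗ Fintype.linearCombination ℚ v) :=
    ⟨hinj, (LinearMap.injective_iff_surjective_of_finrank_eq_finrank (by simp [hr])).mp hinj⟩
  refine ⟨hbij, ?_⟩
  have hsat : ∀ k : ℕ, ∀ γ ∈ Γ, (∃ x : Fin r → ℤ, π (((p : ℤ) ^ k) • γ) = π (∑ i, x i • v i)) →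
      ∃ x : Fin r → ℤ, π γ = π (∑ i, x i • v i) := by
    intro k
    induction k with
    | zero => intro γ _ h; simpa using h
    | succ k ih =>
      rintro γ hγ ⟨x, hx⟩
      refine ih γ hγ ?_
      rw [pow_succ', mul_smul] at hx
      have hG := Γ.smul_mem ((p : ℤ) ^ k) hγ
      have h1 := H x _ (sub_mem (hvG x) (Γ.smul_mem (p : ℤ) hG)) _ hG (by rw [map_sub, ← hx, sub_self]) (by abel)
      choose y hy using h1
      have hxy : x = fun i => (p : ℤ) * y i := funext hy
      refine ⟨y, ?_⟩
      rw [hxy, hps, map_zsmul, map_zsmul π (p : ℤ)] at hx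
      rw [← sub_eq_zero]
      exact hpW _ (by rw [smul_sub, hx, sub_self])
  intro γ hγ
  obtain ⟨q, hq⟩ := hbij.2 (π γ)
  obtain ⟨m, hm, z, hz⟩ := common_den q
  have e1 : π (m • γ) = π (∑ i, z i • v i) := by
    have : ∑ i, z i • v i = Fintype.linearCombination ℚ v ((m : ℚ) • q) := by
      rw [Fintype.linearCombination_apply]
      refine Finset.sum_congr rfl fun i _ => ?_
      rw [← Int.cast_smul_eq_zsmul ℚ, ← hz]; rfl
    rw [LinearMap.comp_apply] at hq
    rw [this, map_zsmul, ← hq, map_smul, map_smul, Int.cast_smul_eq_zsmul]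
  obtain ⟨k, m', hm', hmm⟩ : ∃ (k : ℕ) (m' : ℤ), ¬ (p : ℤ) ∣ m' ∧ m = (p : ℤ) ^ k * m' := by
    have hf : FiniteMultiplicity (p : ℤ) m := Int.finiteMultiplicity_iff.mpr ⟨by simpa using hp.ne_one, hm⟩
    obtain ⟨c, hc, hnd⟩ := hf.exists_eq_pow_mul_and_not_dvd
    exact ⟨_, c, hnd, hc⟩
  refine ⟨m', hm', hsat k _ (Γ.smul_mem _ hγ) ⟨z, ?_⟩⟩
  rw [smul_smul, ← hmm, e1]

lemma local_iso {V V' : Type*} [AddCommGroup V] [Module ℚ V] [FiniteDimensional ℚ V]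
    [AddCommGroup V'] [Module ℚ V'] [FiniteDimensional ℚ V']
    (Φ : V →ₗ[ℚ] V →ₗ[ℚ] ℚ) (Φ' : V' →ₗ[ℚ] V' →ₗ[ℚ] ℚ)
    (L : Submodule ℤ V) (hfg : L.FG)
    (hspan : Submodule.span ℚ (L : Set V) = ⊤)
    (L' : Submodule ℤ V')
    (Γ : Submodule ℤ (V × V'))
    (hsd : ∀ x, x ∈ Γ ↔ ∀ y ∈ Γ, ∃ n : ℤ, psi Φ Φ' x y = n)
    (hL : ∀ x, (x, 0) ∈ Γ ↔ x ∈ L) (hL' : ∀ y, (0, y) ∈ Γ ↔ y ∈ L')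
    (r : ℕ) (hr : finrank ℚ V = r) (hr' : finrank ℚ V' = r)
    (θ : HE r ℤ →ₗ[ℤ] V × V') (hθ : ∀ x, θ x ∈ Γ) (hθs : ∀ γ ∈ Γ, ∃ x, θ x = γ)
    (hθh : ∀ x y, psi Φ Φ' (θ x) (θ y) = (hh x y : ℤ))
    (p : ℕ) (hp : p.Prime) :
    ∃ τ : V' ≃ₗ[ℚ] V, (∀ x y, Φ (τ x) (τ y) = Φ' x y) ∧ ∀ y, InLoc p L' y ↔ InLoc p L (τ y) := by
  have : Fact p.Prime := ⟨hp⟩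
  have hp0 : (p : ℤ) ≠ 0 := by exact_mod_cast hp.ne_zero
  have hpp : Prime (p : ℤ) := Nat.prime_iff_prime_int.mp hp
  have hinj : ∀ x y, θ x = θ y → x = y := by
    intro x y h
    have h1 : ∀ z, hh x z = hh y z := by
      intro z
      have := hθh x z
      rw [h, hθh] at this
      exact_mod_cast this.symm
    ext i
    · simpa [hh, Pi.single_apply] using h1 (0, Pi.single i 1)
    · simpa [hh, Pi.single_apply] using h1 (Pi.single i 1, 0)
  obtain ⟨n, b, hb⟩ := lattice_basis L hfg hspan
  have hbL : ∀ j, b j ∈ L := fun j => by rw [hb]; exact Submodule.subset_span ⟨j, rfl⟩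
  choose yb hyb using fun j => hθs _ ((hL _).mpr (hbL j))
  let S : Submodule (ZMod p) (HE r (ZMod p)) := Submodule.span _ (Set.range fun j => red p (yb j))
  have hS : finrank (ZMod p) S ≤ r := by
    refine (finrank_range_le_card _).trans ?_
    rw [Fintype.card_fin, ← hr, finrank_eq_card_basis b, Fintype.card_fin]
  have hred : ∀ l ∈ Submodule.span ℤ (Set.range b), ∀ y, θ y = (l, 0) → red p y ∈ S := by
    intro l hl
    induction hl using Submodule.span_induction with
    | mem x h =>
      obtain ⟨j, rfl⟩ := h
      intro y hy
      rw [hinj y (yb j) (by rw [hy, hyb])]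
      exact Submodule.subset_span ⟨j, rfl⟩
    | zero =>
      intro y hy
      rw [hinj y 0 (by rw [hy, map_zero]; rfl), map_zero]
      exact zero_mem _
    | add l1 l2 h1 h2 i1 i2 =>
      intro y hy
      rw [← hb] at h1 h2
      obtain ⟨y1, e1⟩ := hθs _ ((hL _).mpr h1)
      obtain ⟨y2, e2⟩ := hθs _ ((hL _).mpr h2)
      rw [hinj y (y1 + y2) (by rw [hy, map_add, e1, e2]; simp), map_add]
      exact add_mem (i1 _ e1) (i2 _ e2)
    | smul c l1 h1 i1 =>
      intro y hy
      rw [← hb] at h1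
      obtain ⟨y1, e1⟩ := hθs _ ((hL _).mpr h1)
      rw [hinj y (c • y1) (by rw [hy, map_smul, e1, Prod.smul_mk, smul_zero]), red_zsmul]
      exact S.smul_mem _ (i1 _ e1)
  obtain ⟨ν, hν, hνp⟩ := claim_all p r S hS
  let v : Fin r → V × V' := fun i => θ (ν i)
  have hv : ∀ i, v i ∈ Γ := fun i => hθ _
  have hvG : ∀ x : Fin r → ℤ, ∑ i, x i • v i ∈ Γ := fun x => sum_mem fun i _ => Γ.smul_mem _ (hv i)
  have hvz : ∀ x : Fin r → ℤ, ∑ i, x i • v i = θ (∑ i, x i • ν i) := by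
    intro x; rw [map_sum]; exact Finset.sum_congr rfl fun i _ => (map_smul θ _ _).symm
  have H1 : ∀ x : Fin r → ℤ, ∀ k ∈ Γ, ∀ γ ∈ Γ, LinearMap.snd ℚ V V' k = 0 →
      ∑ i, x i • v i = k + (p : ℤ) • γ → ∀ i, (p : ℤ) ∣ x i := by
    intro x k hk γ hγ hk0 h
    refine hνp x ?_
    obtain ⟨g, hg⟩ := hθs γ hγ
    obtain ⟨y, hy⟩ := hθs k hk
    have hk' : k = (k.1, 0) := Prod.ext rfl hk0
    rw [hinj (∑ i, x i • ν i) (y + (p : ℤ) • g) (by rw [← hvz, h, map_add, map_smul, hy, hg]),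
      map_add, red_zsmul]
    simp only [Int.cast_natCast, CharP.cast_eq_zero, zero_smul, add_zero]
    refine hred k.1 ?_ y (by rw [hy, ← hk'])
    rw [← hb, ← hL, ← hk']; exact hk
  obtain ⟨hbij, hM⟩ := locA (LinearMap.snd ℚ V V') r hr' Γ v hv p hp H1
  have hsy : ∀ x y, psi Φ Φ' x y = psi Φ Φ' x y := fun _ _ => rfl
  have hiso : ∀ x y : Fin r → ℚ, psi Φ Φ' (Fintype.linearCombination ℚ v x)
      (Fintype.linearCombination ℚ v y) = 0 := by
    intro x y
    simp only [Fintype.linearCombination_apply, map_sum, map_smul, LinearMap.sum_apply,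
      LinearMap.smul_apply]
    refine Finset.sum_eq_zero fun i _ => ?_
    simp [v, hθh, hν]
  have hzq : ∀ x : Fin r → ℤ, ∑ i, x i • v i = Fintype.linearCombination ℚ v (fun i => (x i : ℚ)) := by
    intro x; simp only [Fintype.linearCombination_apply, Int.cast_smul_eq_zsmul]
  have H2 : ∀ x : Fin r → ℤ, ∀ k ∈ Γ, ∀ γ ∈ Γ, LinearMap.fst ℚ V V' k = 0 →
      ∑ i, x i • v i = k + (p : ℤ) • γ → ∀ i, (p : ℤ) ∣ x i := by
    intro x k hk γ hγ hk0 h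
    have hdiv : ((p : ℚ)⁻¹ • ∑ i, x i • v i) ∈ Γ := by
      rw [hsd]
      intro δ hδ
      obtain ⟨m, hm, y, hy⟩ := hM δ hδ
      obtain ⟨s, hs⟩ := (hsd _).mp (hvG x) δ hδ
      set l := m • δ - ∑ i, y i • v i with hl
      have hlG : l ∈ Γ := sub_mem (Γ.smul_mem _ hδ) (hvG y)
      have hl2 : l.2 = 0 := by
        have : LinearMap.snd ℚ V V' l = 0 := by rw [hl, map_sub, hy, sub_self]
        exact this
      have hk1 : k.1 = 0 := hk0
      obtain ⟨t, ht⟩ := (hsd _).mp hγ l hlG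
      have hpk : psi Φ Φ' k l = 0 := by rw [psi_apply, hk1, hl2]; simp
      have e : psi Φ Φ' (∑ i, x i • v i) (m • δ) = p * t := by
        have : m • δ = ∑ i, y i • v i + l := by rw [hl]; abel
        rw [this, map_add]
        conv_lhs => enter [1]; rw [hzq, hzq, hiso]
        rw [h, map_add, LinearMap.add_apply, map_zsmul, LinearMap.smul_apply, ht, hpk]
        simp
      rw [map_zsmul, hs, zsmul_eq_mul] at e
      have e' : m * s = p * t := by exact_mod_cast e
      have hd : (p : ℤ) ∣ s := (hpp.dvd_or_dvd ⟨t, e'⟩).resolve_left hm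
      obtain ⟨s', rfl⟩ := hd
      refine ⟨s', ?_⟩
      rw [map_smul, LinearMap.smul_apply, hs]
      have : (p : ℚ) ≠ 0 := by exact_mod_cast hp.ne_zero
      simp [this]
    refine H1 x 0 (zero_mem _) _ hdiv (by simp) ?_
    have : (p : ℚ) ≠ 0 := by exact_mod_cast hp.ne_zero
    rw [zero_add, ← Int.cast_smul_eq_zsmul ℚ (p : ℤ), smul_smul]
    simp [this]
  obtain ⟨hbij', hM'⟩ := locA (LinearMap.fst ℚ V V') r hr Γ v hv p hp H2
  let e2 := LinearEquiv.ofBijective _ hbij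
  let e1 := LinearEquiv.ofBijective _ hbij'
  have he2 : ∀ x, e2 x = (Fintype.linearCombination ℚ v x).2 := fun x => rfl
  have he1 : ∀ x, e1 x = (Fintype.linearCombination ℚ v x).1 := fun x => rfl
  refine ⟨e2.symm.trans e1, ?_, ?_⟩
  · intro x y
    obtain ⟨x, rfl⟩ := e2.surjective x
    obtain ⟨y, rfl⟩ := e2.surjective y
    simp only [LinearEquiv.trans_apply, LinearEquiv.symm_apply_apply]
    have := hiso x y
    rw [psi_apply] at this
    rw [he1, he1, he2, he2]; linarith
  · intro y
    constructor
    · rintro ⟨m, hm, hy⟩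
      obtain ⟨m', hm', x, hx⟩ := hM _ ((hL' _).mpr hy)
      refine ⟨m' * m, fun hd => (hpp.dvd_or_dvd hd).elim hm' hm, ?_⟩
      have hxe : m' • m • y = e2 (fun i => (x i : ℚ)) := by
        rw [he2, ← hzq]; exact hx
      rw [mul_smul, ← map_zsmul, ← map_zsmul, hxe, LinearEquiv.trans_apply, LinearEquiv.symm_apply_apply]
      rw [← hL]
      have := sub_mem (hvG x) (Γ.smul_mem m' ((hL' _).mpr hy))
      convert this using 1
      rw [hzq]
      refine Prod.ext ?_ ?_
      · rw [he1]; simp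
      · rw [Prod.snd_sub, ← he2, ← hxe]; simp
    · rintro ⟨m, hm, hy⟩
      obtain ⟨m', hm', x, hx⟩ := hM' _ ((hL _).mpr hy)
      refine ⟨m' * m, fun hd => (hpp.dvd_or_dvd hd).elim hm' hm, ?_⟩
      have hxe : m' • m • (e2.symm.trans e1) y = e1 (fun i => (x i : ℚ)) := by
        rw [he1, ← hzq]; exact hx
      have hye : m' • m • y = e2 (fun i => (x i : ℚ)) := by
        apply (e2.symm.trans e1).injective
        rw [map_zsmul, map_zsmul, hxe, LinearEquiv.trans_apply, LinearEquiv.symm_apply_apply]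
      rw [mul_smul, hye, ← hL']
      have := sub_mem (hvG x) (Γ.smul_mem m' ((hL _).mpr hy))
      convert this using 1
      rw [hzq]
      refine Prod.ext ?_ ?_
      · rw [Prod.fst_sub, ← he1, ← hxe]; simp
      · rw [he2]; simp

end Nik

namespace Nik
open Module

section
variable {V : Type*} [AddCommGroup V] [Module ℚ V]

/-- the orthogonal group -/
def OG (Φ : V →ₗ[ℚ] V →ₗ[ℚ] ℚ) : Subgroup (V ≃ₗ[ℚ] V) where
  carrier := {g | ∀ x y, Φ (g x) (g y) = Φ x y}
  one_mem' := fun _ _ => rfl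
  mul_mem' := by
    intro g h hg hh x y
    rw [LinearEquiv.mul_apply, LinearEquiv.mul_apply, hg, hh]
  inv_mem' := by
    intro g hg x y
    rw [← hg]
    simp [← LinearEquiv.mul_apply]

lemma mem_OG {Φ : V →ₗ[ℚ] V →ₗ[ℚ] ℚ} {g : V ≃ₗ[ℚ] V} :
    g ∈ OG Φ ↔ ∀ x y, Φ (g x) (g y) = Φ x y := Iff.rfl

/-- reflection -/
def svl (Φ : V →ₗ[ℚ] V →ₗ[ℚ] ℚ) (v : V) : V →ₗ[ℚ] V :=
  LinearMap.id - (2 / Φ v v) • (Φ.flip v).smulRight v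

lemma svl_apply (Φ : V →ₗ[ℚ] V →ₗ[ℚ] ℚ) (v x : V) :
    svl Φ v x = x - (2 / Φ v v * Φ x v) • v := by
  simp [svl, smul_smul]

def sv (Φ : V →ₗ[ℚ] V →ₗ[ℚ] ℚ) (v : V) : V ≃ₗ[ℚ] V :=
  LinearEquiv.ofInvolutive (svl Φ v) (by
    intro x
    simp only [svl_apply, map_sub, map_smul, LinearMap.sub_apply, LinearMap.smul_apply, smul_eq_mul]
    rcases eq_or_ne (Φ v v) 0 with h | h
    · simp [h]
    · match_scalars <;> field_simp <;> ring)

lemma sv_apply (Φ : V →ₗ[ℚ] V →ₗ[ℚ] ℚ) (v x : V) :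
    sv Φ v x = x - (2 / Φ v v * Φ x v) • v := svl_apply Φ v x

lemma sv_mem (Φ : V →ₗ[ℚ] V →ₗ[ℚ] ℚ) (hs : ∀ x y, Φ x y = Φ y x) (v : V) : sv Φ v ∈ OG Φ := by
  intro x y
  simp only [sv_apply, map_sub, map_smul, LinearMap.sub_apply, LinearMap.smul_apply, smul_eq_mul]
  rcases eq_or_ne (Φ v v) 0 with h | h
  · simp [h]
  · rw [hs v y]; field_simp; ring

lemma sv_sq (Φ : V →ₗ[ℚ] V →ₗ[ℚ] ℚ) (v : V) : sv Φ v * sv Φ v = 1 := by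
  ext x
  exact (sv Φ v).apply_symm_apply x

lemma sv_conj (Φ : V →ₗ[ℚ] V →ₗ[ℚ] ℚ) (v : V) (g : V ≃ₗ[ℚ] V) (hg : g ∈ OG Φ) :
    g * sv Φ v * g⁻¹ = sv Φ (g v) := by
  ext x
  obtain ⟨x, rfl⟩ := g.surjective x
  have : g⁻¹ (g x) = x := g.symm_apply_apply x
  rw [LinearEquiv.mul_apply, LinearEquiv.mul_apply, this, sv_apply, sv_apply, map_sub, map_smul, hg, hg]

lemma sv_smul (Φ : V →ₗ[ℚ] V →ₗ[ℚ] ℚ) (v : V) (c : ℚ) (hc : c ≠ 0) : sv Φ (c • v) = sv Φ v := by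
  ext x
  simp only [sv_apply, map_smul, LinearMap.smul_apply, smul_eq_mul]
  rcases eq_or_ne (Φ v v) 0 with h | h
  · simp [h]
  · match_scalars <;> field_simp

/-- weak Cartan Dieudonne -/
lemma refl_gen [FiniteDimensional ℚ V] (Φ : V →ₗ[ℚ] V →ₗ[ℚ] ℚ) (hs : ∀ x y, Φ x y = Φ y x)
    (n : ℕ) (b : Basis (Fin n) ℚ V) (ho : ∀ i j, i ≠ j → Φ (b i) (b j) = 0)
    (hne : ∀ i, Φ (b i) (b i) ≠ 0) (P : (V ≃ₗ[ℚ] V) → Prop) (h1 : P 1)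
    (hm : ∀ g v, Φ v v ≠ 0 → P g → P (sv Φ v * g)) (g : V ≃ₗ[ℚ] V) (hg : g ∈ OG Φ) : P g := by
  have hm' : ∀ g v, Φ v v ≠ 0 → P (sv Φ v * g) → P g := by
    intro g v hv h
    have := hm _ v hv h
    rwa [← mul_assoc, sv_sq, one_mul] at this
  have key : ∀ k : ℕ, k ≤ n → ∀ g ∈ OG Φ, (∀ i : Fin n, (i : ℕ) < n - k → g (b i) = b i) → P g := by
    intro k
    induction k with
    | zero =>
      intro _ g _ hfix
      have : g = 1 := by
        refine LinearEquiv.toLinearMap_injective (b.ext fun i => ?_)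
        exact hfix i (by omega)
      rwa [this]
    | succ k ih =>
      intro hk g hg hfix
      let i0 : Fin n := ⟨n - (k + 1), by omega⟩
      set v := b i0 with hv
      have hvv : Φ v v ≠ 0 := hne i0
      have hgv : Φ (g v) (g v) = Φ v v := hg v v
      have hperp : ∀ i : Fin n, (i : ℕ) < n - (k + 1) → Φ (b i) v = 0 ∧ Φ (b i) (g v) = 0 := by
        intro i hi
        have h0 : Φ (b i) v = 0 := ho i i0 (by intro h; rw [h] at hi; simp [i0] at hi)
        refine ⟨h0, ?_⟩
        rw [← hfix i hi, hg]; exact h0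
      have hcase : ∀ i : Fin n, (i : ℕ) < n - k → (i : ℕ) < n - (k + 1) ∨ i = i0 := by
        intro i hi
        rcases lt_or_ge (i : ℕ) (n - (k + 1)) with h | h
        · exact Or.inl h
        · right; ext; simp [i0]; omega
      by_cases hd : Φ (v - g v) (v - g v) = 0
      · have hd' : Φ (v + g v) (v + g v) ≠ 0 := by
          intro h
          simp only [map_sub, map_add, LinearMap.sub_apply, LinearMap.add_apply] at hd h
          apply hvv
          linarith
        refine hm' g _ hd' (hm' _ v hvv (ih (by omega) _ (mul_mem (sv_mem Φ hs v) (mul_mem (sv_mem Φ hs _) hg)) ?_))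
        intro i hi
        rw [LinearEquiv.mul_apply, LinearEquiv.mul_apply]
        rcases hcase i hi with h | rfl
        · have hp1 : Φ (b i) (v + g v) = 0 := by
            rw [map_add, (hperp i h).1, (hperp i h).2, add_zero]
          rw [hfix i h, sv_apply Φ (v + g v), hp1]
          simp only [mul_zero, zero_smul, sub_zero]
          rw [sv_apply, (hperp i h).1]; simp
        · have e : sv Φ (v + g v) (g v) = - v := by
            rw [sv_apply]
            have : 2 / Φ (v + g v) (v + g v) * Φ (g v) (v + g v) = 1 := by
              rw [div_mul_eq_mul_div, div_eq_one_iff_eq hd']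
              simp only [map_add, LinearMap.add_apply]
              rw [hs (g v) v, hgv]; ring
            rw [this]; module
          rw [← hv, e, map_neg, sv_apply]
          rw [div_mul_cancel₀ _ hvv]; module
      · refine hm' g _ hd (ih (by omega) _ (mul_mem (sv_mem Φ hs _) hg) ?_)
        intro i hi
        rw [LinearEquiv.mul_apply]
        rcases hcase i hi with h | rfl
        · have hp1 : Φ (b i) (v - g v) = 0 := by
            rw [map_sub, (hperp i h).1, (hperp i h).2, sub_zero]
          rw [hfix i h, sv_apply, hp1]; simp
        · rw [← hv, sv_apply]
          have : 2 / Φ (v - g v) (v - g v) * Φ (g v) (v - g v) = -1 := by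
            rw [div_mul_eq_mul_div, div_eq_iff hd]
            simp only [map_sub, LinearMap.sub_apply]
            rw [hs (g v) v, hgv]; ring
          rw [this]; module
  exact key n le_rfl g hg (fun i hi => by omega)

/-- Eichler transformations -/
def IsE (Φ : V →ₗ[ℚ] V →ₗ[ℚ] ℚ) (e u : V) (g : V ≃ₗ[ℚ] V) : Prop :=
  ∀ x, g x = x + Φ x e • u - Φ x u • e - (Φ u u / 2 * Φ x e) • e

def eil (Φ : V →ₗ[ℚ] V →ₗ[ℚ] ℚ) (e u : V) : V →ₗ[ℚ] V :=
  LinearMap.id + (Φ.flip e).smulRight u - (Φ.flip u).smulRight e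
    - (Φ u u / 2) • (Φ.flip e).smulRight e

lemma eil_apply (Φ : V →ₗ[ℚ] V →ₗ[ℚ] ℚ) (e u x : V) :
    eil Φ e u x = x + Φ x e • u - Φ x u • e - (Φ u u / 2 * Φ x e) • e := by
  simp [eil, smul_smul]

lemma eil_add (Φ : V →ₗ[ℚ] V →ₗ[ℚ] ℚ) (hs : ∀ x y, Φ x y = Φ y x) (e u w x : V) (he : Φ e e = 0)
    (hu : Φ u e = 0) (hw : Φ w e = 0) : eil Φ e u (eil Φ e w x) = eil Φ e (u + w) x := by
  simp only [eil_apply, map_add, map_sub, map_smul, LinearMap.sub_apply, LinearMap.add_apply,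
    LinearMap.smul_apply, smul_eq_mul, he, hw, hu, hs e u, hs w u, hs e w]
  match_scalars <;> ring

lemma eil_zero (Φ : V →ₗ[ℚ] V →ₗ[ℚ] ℚ) (e x : V) : eil Φ e 0 x = x := by
  simp [eil_apply]

lemma exists_IsE (Φ : V →ₗ[ℚ] V →ₗ[ℚ] ℚ) (hs : ∀ x y, Φ x y = Φ y x) (e u : V) (he : Φ e e = 0)
    (hu : Φ u e = 0) : ∃ g, IsE Φ e u g := by
  have hu' : Φ (-u) e = 0 := by simp [hu]
  refine ⟨LinearEquiv.ofLinearMap (eil Φ e u) (eil Φ e (-u)) ?_ ?_, fun x => eil_apply Φ e u x⟩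
  · ext x
    simp only [LinearMap.comp_apply]
    rw [eil_add Φ hs e u (-u) x he hu hu', add_neg_cancel, eil_zero]; rfl
  · ext x
    simp only [LinearMap.comp_apply]
    rw [eil_add Φ hs e (-u) u x he hu' hu, neg_add_cancel, eil_zero]; rfl

lemma IsE_eil {Φ : V →ₗ[ℚ] V →ₗ[ℚ] ℚ} {e u : V} {g : V ≃ₗ[ℚ] V} (hg : IsE Φ e u g) (x : V) :
    g x = eil Φ e u x := by rw [eil_apply]; exact hg x

lemma IsE_mem {Φ : V →ₗ[ℚ] V →ₗ[ℚ] ℚ} (hs : ∀ x y, Φ x y = Φ y x) {e u : V} {g : V ≃ₗ[ℚ] V}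
    (he : Φ e e = 0) (hu : Φ u e = 0) (hg : IsE Φ e u g) : g ∈ OG Φ := by
  intro x y
  rw [hg x, hg y]
  simp only [map_add, map_sub, map_smul, LinearMap.sub_apply, LinearMap.add_apply,
    LinearMap.smul_apply, smul_eq_mul, he, hu, hs e u, hs e y, hs u y]
  ring

lemma IsE_inv {Φ : V →ₗ[ℚ] V →ₗ[ℚ] ℚ} (hs : ∀ x y, Φ x y = Φ y x) {e u : V} {g : V ≃ₗ[ℚ] V}
    (he : Φ e e = 0) (hu : Φ u e = 0) (hg : IsE Φ e u g) : IsE Φ e (-u) g⁻¹ := by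
  intro x
  rw [← eil_apply]
  apply g.injective
  rw [← LinearEquiv.mul_apply, mul_inv_cancel, IsE_eil hg,
    eil_add Φ hs e u (-u) x he hu (by simp [hu]), add_neg_cancel, eil_zero]
  rfl

lemma IsE_conj {Φ : V →ₗ[ℚ] V →ₗ[ℚ] ℚ} {e u : V} {g σ : V ≃ₗ[ℚ] V} (hσ : σ ∈ OG Φ)
    (hg : IsE Φ e u g) : IsE Φ (σ e) (σ u) (σ * g * σ⁻¹) := by
  intro x
  obtain ⟨x, rfl⟩ := σ.surjective x
  have : σ⁻¹ (σ x) = x := σ.symm_apply_apply x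
  rw [LinearEquiv.mul_apply, LinearEquiv.mul_apply, this, hg x, hσ, hσ, hσ]
  simp only [map_add, map_sub, map_smul]

lemma IsE_smul {Φ : V →ₗ[ℚ] V →ₗ[ℚ] ℚ} {e u : V} {g : V ≃ₗ[ℚ] V} {c : ℚ}
    (hg : IsE Φ (c • e) u g) : IsE Φ e (c • u) g := by
  intro x
  rw [hg x]
  simp only [map_smul, LinearMap.smul_apply, smul_eq_mul]
  match_scalars <;> ring

/-- elementary subgroup -/
def EG (Φ : V →ₗ[ℚ] V →ₗ[ℚ] ℚ) (e f : V) : Subgroup (V ≃ₗ[ℚ] V) :=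
  Subgroup.closure {g | ∃ u, Φ u e = 0 ∧ Φ u f = 0 ∧ (IsE Φ e u g ∨ IsE Φ f u g)}

lemma move_H (Φ : V →ₗ[ℚ] V →ₗ[ℚ] ℚ) (hs : ∀ x y, Φ x y = Φ y x) (e f : V) (c : ℚ) (hc : c ≠ 0)
    (he : Φ e e = 0) (hf : Φ f f = 0) (hef : Φ e f = c) (v : V) (hv : Φ v v ≠ 0) :
    ∃ ε ∈ EG Φ e f, ε ∈ OG Φ ∧ ∃ α β : ℚ, ε v = α • e + β • f := by
  have hfe : Φ f e = c := by rw [hs, hef]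
  have key : ∀ v : V, Φ v e ≠ 0 → ∃ ε ∈ EG Φ e f, ε ∈ OG Φ ∧ ∃ α β : ℚ, ε v = α • e + β • f := by
    intro v h
    let u : V := (-(Φ v e)⁻¹) • (v - (Φ v f / c) • e - (Φ v e / c) • f)
    have hue : Φ u e = 0 := by
      simp only [u, map_smul, map_sub, LinearMap.smul_apply, LinearMap.sub_apply, he, hfe, smul_eq_mul]
      field_simp; ring
    have huf : Φ u f = 0 := by
      simp only [u, map_smul, map_sub, LinearMap.smul_apply, LinearMap.sub_apply, hf, hef, smul_eq_mul]
      field_simp; ring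
    obtain ⟨g, hg⟩ := exists_IsE Φ hs e u he hue
    refine ⟨g, Subgroup.subset_closure ⟨u, hue, huf, Or.inl hg⟩, IsE_mem hs he hue hg,
      Φ v f / c - Φ v u - Φ u u / 2 * Φ v e, Φ v e / c, ?_⟩
    have h2 : Φ v e • u = -(v - (Φ v f / c) • e - (Φ v e / c) • f) := by
      simp only [u, smul_smul]
      rw [mul_neg, mul_inv_cancel₀ h]; simp
    rw [hg v, h2]; module
  by_cases h1 : Φ v e = 0
  · by_cases h2 : Φ v f = 0
    · obtain ⟨g, hg⟩ := exists_IsE Φ hs f v hf h2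
      have hgv : Φ (g v) e ≠ 0 := by
        rw [hg v]
        simp only [map_smul, map_sub, map_add, LinearMap.add_apply, LinearMap.smul_apply,
          LinearMap.sub_apply, hfe, h1, h2, smul_eq_mul]
        simp [hv, hc]
      obtain ⟨ε, h3, h4, α, β, h5⟩ := key _ hgv
      exact ⟨ε * g, mul_mem h3 (Subgroup.subset_closure ⟨v, h1, h2, Or.inr hg⟩),
        mul_mem h4 (IsE_mem hs hf h2 hg), α, β, h5⟩
    · let u : V := (-(Φ v f)⁻¹) • (v - (Φ v f / c) • e - (Φ v e / c) • f)
      have hue : Φ u e = 0 := by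
        simp only [u, map_smul, map_sub, LinearMap.smul_apply, LinearMap.sub_apply, he, hfe, smul_eq_mul]
        field_simp; ring
      have huf : Φ u f = 0 := by
        simp only [u, map_smul, map_sub, LinearMap.smul_apply, LinearMap.sub_apply, hf, hef, smul_eq_mul]
        field_simp; ring
      obtain ⟨g, hg⟩ := exists_IsE Φ hs f u hf huf
      refine ⟨g, Subgroup.subset_closure ⟨u, hue, huf, Or.inr hg⟩, IsE_mem hs hf huf hg,
        Φ v f / c, Φ v e / c - Φ v u - Φ u u / 2 * Φ v f, ?_⟩
      have h3 : Φ v f • u = -(v - (Φ v f / c) • e - (Φ v e / c) • f) := by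
        simp only [u, smul_smul]
        rw [mul_neg, mul_inv_cancel₀ h2]; simp
      rw [hg v, h3]; module
  · exact key v h1

/-- reflection in `e - t f` -/
def sc (Φ : V →ₗ[ℚ] V →ₗ[ℚ] ℚ) (e f : V) (t : ℚ) : V ≃ₗ[ℚ] V := sv Φ (e - t • f)

lemma sc_apply (Φ : V →ₗ[ℚ] V →ₗ[ℚ] ℚ) (hs : ∀ x y, Φ x y = Φ y x) (e f : V) (c : ℚ) (hc : c ≠ 0)
    (he : Φ e e = 0) (hf : Φ f f = 0) (hef : Φ e f = c) (t : ℚ) (ht : t ≠ 0) (x : V) :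
    sc Φ e f t x = x + ((Φ x e - t * Φ x f) / (t * c)) • (e - t • f) := by
  have hfe : Φ f e = c := by rw [hs, hef]
  have h2 : Φ (e - t • f) (e - t • f) = - (2 * t * c) := by
    simp only [map_smul, map_sub, LinearMap.smul_apply, LinearMap.sub_apply, hf, hef, he, hfe, smul_eq_mul]
    ring
  rw [sc, sv_apply, h2]
  simp only [map_smul, map_sub, smul_eq_mul]
  match_scalars <;> field_simp

lemma sc_vals (Φ : V →ₗ[ℚ] V →ₗ[ℚ] ℚ) (hs : ∀ x y, Φ x y = Φ y x) (e f : V) (c : ℚ) (hc : c ≠ 0)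
    (he : Φ e e = 0) (hf : Φ f f = 0) (hef : Φ e f = c) (t : ℚ) (ht : t ≠ 0) :
    sc Φ e f t e = t • f ∧ sc Φ e f t f = t⁻¹ • e ∧
      ∀ u, Φ u e = 0 → Φ u f = 0 → sc Φ e f t u = u := by
  have hfe : Φ f e = c := by rw [hs, hef]
  refine ⟨?_, ?_, ?_⟩
  · rw [sc_apply Φ hs e f c hc he hf hef t ht, he, hef]
    match_scalars <;> field_simp <;> ring
  · rw [sc_apply Φ hs e f c hc he hf hef t ht, hf, hfe]
    match_scalars <;> field_simp <;> ring
  · intro u h1 h2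
    rw [sc_apply Φ hs e f c hc he hf hef t ht, h1, h2]
    simp

lemma sc_mul (Φ : V →ₗ[ℚ] V →ₗ[ℚ] ℚ) (hs : ∀ x y, Φ x y = Φ y x) (e f : V) (c : ℚ) (hc : c ≠ 0)
    (he : Φ e e = 0) (hf : Φ f f = 0) (hef : Φ e f = c) (a b : ℚ) (ha : a ≠ 0) (hb : b ≠ 0) :
    sc Φ e f a * sc Φ e f b = sc Φ e f 1 * sc Φ e f (b / a) := by
  have hfe : Φ f e = c := by rw [hs, hef]
  ext x
  have hba := div_ne_zero hb ha
  simp only [LinearEquiv.mul_apply, sc_apply Φ hs e f c hc he hf hef _ ha, sc_apply Φ hs e f c hc he hf hef _ hb,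
    sc_apply Φ hs e f c hc he hf hef _ hba, sc_apply Φ hs e f c hc he hf hef _ one_ne_zero,
    map_smul, map_sub, map_add, LinearMap.add_apply, LinearMap.smul_apply, LinearMap.sub_apply,
    hf, hef, he, hfe, smul_eq_mul]
  match_scalars <;> field_simp <;> ring

lemma normal_form [FiniteDimensional ℚ V] (Φ : V →ₗ[ℚ] V →ₗ[ℚ] ℚ) (hs : ∀ x y, Φ x y = Φ y x)
    (n : ℕ) (b : Basis (Fin n) ℚ V) (ho : ∀ i j, i ≠ j → Φ (b i) (b j) = 0)
    (hne : ∀ i, Φ (b i) (b i) ≠ 0) (e f : V) (c : ℚ) (hc : c ≠ 0)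
    (he : Φ e e = 0) (hf : Φ f f = 0) (hef : Φ e f = c) (g : V ≃ₗ[ℚ] V) (hg : g ∈ OG Φ) :
    ∃ ε ∈ EG Φ e f, ∃ t : ℚ, t ≠ 0 ∧ (g = ε * sc Φ e f t ∨ g = ε * (sc Φ e f 1 * sc Φ e f t)) := by
  refine refl_gen Φ hs n b ho hne (fun g => ∃ ε ∈ EG Φ e f, ∃ t : ℚ, t ≠ 0 ∧
    (g = ε * sc Φ e f t ∨ g = ε * (sc Φ e f 1 * sc Φ e f t))) ?_ ?_ g hg
  · exact ⟨1, one_mem _, 1, one_ne_zero, Or.inr (by rw [sc, sv_sq]; rfl)⟩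
  · rintro g v hv ⟨ε, hε, t, ht, h⟩
    obtain ⟨ε1, hε1, hO, α, β, hab⟩ := move_H Φ hs e f c hc he hf hef v hv
    have hfe : Φ f e = c := by rw [hs, hef]
    have hh : Φ (ε1 v) (ε1 v) = 2 * α * β * c := by
      rw [hab]
      simp only [map_smul, map_add, LinearMap.smul_apply, LinearMap.add_apply, hf, hef, he, hfe, smul_eq_mul]
      ring
    rw [hO] at hh
    have hα : α ≠ 0 := by rintro rfl; apply hv; rw [hh]; ring
    have hβ : β ≠ 0 := by rintro rfl; apply hv; rw [hh]; ring
    let a : ℚ := - β / α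
    have ha : a ≠ 0 := div_ne_zero (neg_ne_zero.mpr hβ) hα
    have hsv : sv Φ (ε1 v) = sc Φ e f a := by
      have : ε1 v = α • (e - a • f) := by
        rw [hab]; simp only [a]; match_scalars <;> field_simp
      rw [this, sv_smul _ _ _ hα]; rfl
    have hsv2 : sv Φ v = ε1⁻¹ * sc Φ e f a * ε1 := by
      rw [← hsv, ← sv_conj Φ v ε1 hO]; group
    obtain ⟨v1, v2, v3⟩ := sc_vals Φ hs e f c hc he hf hef a ha
    have hscO : sc Φ e f a ∈ OG Φ := sv_mem Φ hs _
    have hnorm : ∀ ε ∈ EG Φ e f, sc Φ e f a * ε * (sc Φ e f a)⁻¹ ∈ EG Φ e f := by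
      intro ε hε
      induction hε using Subgroup.closure_induction with
      | mem g hg =>
        obtain ⟨u, hu1, hu2, hE | hE⟩ := hg
        · have := IsE_conj hscO hE
          rw [v1, v3 u hu1 hu2] at this
          exact Subgroup.subset_closure ⟨a • u, by simp [hu1], by simp [hu2], Or.inr (IsE_smul this)⟩
        · have := IsE_conj hscO hE
          rw [v2, v3 u hu1 hu2] at this
          exact Subgroup.subset_closure ⟨a⁻¹ • u, by simp [hu1], by simp [hu2], Or.inl (IsE_smul this)⟩
      | one => simp
      | mul x y _ _ hx hy =>
        have := mul_mem hx hy
        convert this using 1; group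
      | inv x _ hx =>
        have := inv_mem hx
        convert this using 1; group
    set ε2 := ε1⁻¹ * (sc Φ e f a * (ε1 * ε) * (sc Φ e f a)⁻¹) with hε2
    have hε2m : ε2 ∈ EG Φ e f := mul_mem (inv_mem hε1) (hnorm _ (mul_mem hε1 hε))
    refine ⟨ε2, hε2m, ?_⟩
    have e0 : ∀ d, g = ε * d → sv Φ v * g = ε2 * (sc Φ e f a * d) := by
      rintro d rfl
      rw [hsv2, hε2]; group
    rcases h with h | h
    · refine ⟨t / a, div_ne_zero ht ha, Or.inr ?_⟩
      rw [e0 _ h, sc_mul Φ hs e f c hc he hf hef a t ha ht]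
    · refine ⟨a * t, mul_ne_zero ha ht, Or.inl ?_⟩
      have h1 : sc Φ e f 1 * sc Φ e f t = sc Φ e f a * sc Φ e f (a * t) := by
        rw [sc_mul Φ hs e f c hc he hf hef a (a * t) ha (mul_ne_zero ha ht), mul_div_cancel_left₀ _ ha]
      have h2 : sc Φ e f a * sc Φ e f a = 1 := sv_sq Φ _
      rw [e0 _ h, h1, ← mul_assoc (sc Φ e f a), h2, one_mul]

end
end Nik

namespace Nik
open Module

section
variable {V : Type*} [AddCommGroup V] [Module ℚ V]

/-- image of a lattice under `g` -/
def act (g : V ≃ₗ[ℚ] V) (L : Submodule ℤ V) : Submodule ℤ V :=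
  L.comap ((g⁻¹).toLinearMap.restrictScalars ℤ)

lemma mem_act {g : V ≃ₗ[ℚ] V} {L : Submodule ℤ V} {x : V} : x ∈ act g L ↔ g⁻¹ x ∈ L := Iff.rfl

lemma act_mul (g h : V ≃ₗ[ℚ] V) (L : Submodule ℤ V) : act (g * h) L = act g (act h L) := by
  ext x
  rw [mem_act, mem_act, mem_act, mul_inv_rev]; rfl

lemma act_one (L : Submodule ℤ V) : act 1 L = L := by
  ext x
  rw [mem_act, inv_one]; rfl

lemma inv_app (g : V ≃ₗ[ℚ] V) (x : V) : g⁻¹ (g x) = x := g.symm_apply_apply x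
lemma app_inv (g : V ≃ₗ[ℚ] V) (x : V) : g (g⁻¹ x) = x := g.apply_symm_apply x

lemma inLoc_act {p : ℕ} {g : V ≃ₗ[ℚ] V} {L : Submodule ℤ V} {x : V} :
    InLoc p (act g L) x ↔ InLoc p L (g⁻¹ x) := by
  simp only [InLoc, mem_act, map_zsmul]

/-- equality of localizations -/
def EqAt (p : ℕ) (M M' : Submodule ℤ V) : Prop := ∀ x, InLoc p M x ↔ InLoc p M' x

lemma EqAt.refl (p : ℕ) (M : Submodule ℤ V) : EqAt p M M := fun _ => Iff.rfl
lemma EqAt.symm {p : ℕ} {M M' : Submodule ℤ V} (h : EqAt p M M') : EqAt p M' M := fun x => (h x).symm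
lemma EqAt.trans {p : ℕ} {M M' M'' : Submodule ℤ V} (h : EqAt p M M') (h' : EqAt p M' M'') :
    EqAt p M M'' := fun x => (h x).trans (h' x)
lemma EqAt.act {p : ℕ} {M M' : Submodule ℤ V} (h : EqAt p M M') (g : V ≃ₗ[ℚ] V) :
    EqAt p (act g M) (act g M') := fun x => by rw [inLoc_act, inLoc_act]; exact h _

lemma inLoc_of_mem {p : ℕ} (hp : p.Prime) {L : Submodule ℤ V} {x : V} (h : x ∈ L) : InLoc p L x :=
  ⟨1, fun hd => hp.one_lt.ne' (by exact_mod_cast Int.eq_one_of_dvd_one (by positivity) hd), by simpa⟩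

lemma inLoc_of_zsmul {p : ℕ} (hp : p.Prime) {L : Submodule ℤ V} {x : V} {m : ℤ} (hm : ¬ (p : ℤ) ∣ m)
    (h : InLoc p L (m • x)) : InLoc p L x := by
  obtain ⟨k, hk, h⟩ := h
  refine ⟨k * m, fun hd => ?_, by rwa [mul_smul]⟩
  exact ((Nat.prime_iff_prime_int.mp hp).dvd_or_dvd hd).elim hk hm

lemma eqAt_of {p : ℕ} (hp : p.Prime) {M : Submodule ℤ V} {g : V ≃ₗ[ℚ] V}
    (h1 : ∀ x ∈ M, InLoc p M (g x)) (h2 : ∀ x ∈ M, InLoc p M (g⁻¹ x)) : EqAt p (act g M) M := by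
  intro x
  rw [inLoc_act]
  constructor
  · rintro ⟨m, hm, h⟩
    have := h1 _ h
    rw [map_zsmul, app_inv] at this
    exact inLoc_of_zsmul hp hm this
  · rintro ⟨m, hm, h⟩
    have := h2 _ h
    rw [map_zsmul] at this
    exact inLoc_of_zsmul hp hm this

lemma Epres1 {Φ : V →ₗ[ℚ] V →ₗ[ℚ] ℚ} {M : Submodule ℤ V}
    (hint : ∀ x ∈ M, ∀ y ∈ M, ∃ n : ℤ, Φ x y = (n : ℚ))
    (heven : ∀ x ∈ M, ∃ n : ℤ, Φ x x = 2 * (n : ℚ)) {q : ℕ} (hq : q.Prime) {e u : V} (heM : e ∈ M)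
    (hu : InLoc q M u) {g : V ≃ₗ[ℚ] V} (hg : IsE Φ e u g) : ∀ x ∈ M, InLoc q M (g x) := by
  intro x hx
  obtain ⟨m, hm, hmu⟩ := hu
  obtain ⟨a, ha⟩ := hint x hx e heM
  obtain ⟨b, hb⟩ := hint x hx _ hmu
  obtain ⟨d, hd⟩ := heven _ hmu
  refine ⟨m * m, fun h => ((Nat.prime_iff_prime_int.mp hq).dvd_or_dvd h).elim hm hm, ?_⟩
  have : (m * m) • g x = (m * m) • x + (a * m) • (m • u) - (m * b) • e - (d * a) • e := by
    rw [hg x, ha]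
    simp only [← Int.cast_smul_eq_zsmul ℚ, map_smul, LinearMap.smul_apply, smul_eq_mul] at hb hd ⊢
    push_cast
    have h1 : (m : ℚ) * b = m * m * Φ x u := by rw [← hb]; ring
    have h2 : (d : ℚ) = m * m * Φ u u / 2 := by linarith
    rw [h1, h2]
    match_scalars <;> ring
  rw [this]
  exact sub_mem (sub_mem (add_mem (M.smul_mem _ hx) (M.smul_mem _ hmu)) (M.smul_mem _ heM)) (M.smul_mem _ heM)

lemma Epres {Φ : V →ₗ[ℚ] V →ₗ[ℚ] ℚ} (hs : ∀ x y, Φ x y = Φ y x) {M : Submodule ℤ V}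
    (hint : ∀ x ∈ M, ∀ y ∈ M, ∃ n : ℤ, Φ x y = (n : ℚ))
    (heven : ∀ x ∈ M, ∃ n : ℤ, Φ x x = 2 * (n : ℚ)) {q : ℕ} (hq : q.Prime) {e u : V} (heM : e ∈ M)
    (he : Φ e e = 0) (hue : Φ u e = 0)
    (hu : InLoc q M u) {g : V ≃ₗ[ℚ] V} (hg : IsE Φ e u g) : EqAt q (act g M) M := by
  refine eqAt_of hq (Epres1 hint heven hq heM hu hg) (Epres1 hint heven hq heM ?_ (IsE_inv hs he hue hg))
  obtain ⟨m, hm, h⟩ := hu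
  exact ⟨m, hm, by rw [smul_neg]; exact neg_mem h⟩

lemma den_of {L P : Submodule ℤ V} (hfg : L.FG) (hP : ∀ v : V, ∃ m : ℤ, m ≠ 0 ∧ m • v ∈ P) :
    ∃ D : ℤ, D ≠ 0 ∧ ∀ x ∈ L, D • x ∈ P := by
  classical
  obtain ⟨S, rfl⟩ := hfg
  choose m hm hmP using hP
  refine ⟨∏ s ∈ S, m s, Finset.prod_ne_zero_iff.mpr fun i _ => hm i, fun x hx => ?_⟩
  induction hx using Submodule.span_induction with
  | mem x h =>
    rw [← Finset.prod_erase_mul _ _ h, mul_smul]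
    exact P.smul_mem _ (hmP x)
  | zero => simp
  | add x y _ _ hx hy => rw [smul_add]; exact add_mem hx hy
  | smul a x _ hx => rw [smul_comm]; exact P.smul_mem _ hx

lemma split_pow {p : ℕ} (hp : p.Prime) {m : ℤ} (hm : m ≠ 0) :
    ∃ (k : ℕ) (m' : ℤ), m = (p : ℤ) ^ k * m' ∧ ¬ (p : ℤ) ∣ m' := by
  have : FiniteMultiplicity (p : ℤ) m := Int.finiteMultiplicity_iff.mpr ⟨by simpa using hp.ne_one, hm⟩
  obtain ⟨c, h1, h2⟩ := this.exists_eq_pow_mul_and_not_dvd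
  exact ⟨_, c, h1, h2⟩

lemma not_dvd_pow {p q : ℕ} (hp : p.Prime) (hq : q.Prime) (hqp : q ≠ p) (k : ℕ) :
    ¬ (q : ℤ) ∣ (p : ℤ) ^ k := by
  intro h
  have h1 : q ∣ p ^ k := by exact_mod_cast h
  exact hqp ((Nat.prime_dvd_prime_iff_eq hq hp).mp (hq.dvd_of_dvd_pow h1))

lemma approx {L : Submodule ℤ V} {p : ℕ} (hp : p.Prime) (w : V) (hw : ∃ m : ℤ, m ≠ 0 ∧ m • w ∈ L)
    (D : ℤ) (hD : D ≠ 0) :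
    ∃ c d : ℚ, (∀ q : ℕ, q.Prime → q ≠ p → InLoc q L (c • w)) ∧ 1 - c = D * (D * d) ∧
      InLoc p L (d • w) := by
  obtain ⟨m, hm, hmw⟩ := hw
  obtain ⟨a, m', rfl, hm'⟩ := split_pow hp hm
  obtain ⟨b, D', hDD, hD'⟩ := split_pow hp (mul_ne_zero hD hD)
  have hpi := Nat.prime_iff_prime_int.mp hp
  have hcop : IsCoprime m' ((p : ℤ) ^ (a + b)) :=
    (IsCoprime.pow_left ((hpi.coprime_iff_not_dvd).mpr hm')).symm
  obtain ⟨c0, k, hck⟩ := hcop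
  have hD0 : (D' : ℚ) ≠ 0 := by
    intro h; apply hD'; have : D' = 0 := by exact_mod_cast h
    simp [this]
  refine ⟨((c0 * m' : ℤ) : ℚ), (((p : ℤ) ^ a * k : ℤ) : ℚ) / D', ?_, ?_, ?_⟩
  · intro q hq hqp
    refine ⟨(p : ℤ) ^ a, not_dvd_pow hp hq hqp a, ?_⟩
    rw [Int.cast_smul_eq_zsmul ℚ, ← mul_smul, show (p : ℤ) ^ a * (c0 * m') = c0 * ((p : ℤ) ^ a * m') by ring,
      mul_smul]
    exact L.smul_mem _ hmw
  · have h1 : (c0 : ℚ) * m' + k * p ^ (a + b) = 1 := by exact_mod_cast hck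
    have h2 : (D : ℚ) * D = p ^ b * D' := by exact_mod_cast hDD
    rw [← mul_assoc, h2]
    push_cast
    field_simp
    rw [← h1]; ring
  · refine ⟨D' * m', fun h => (hpi.dvd_or_dvd h).elim hD' hm', ?_⟩
    have : (D' * m') • ((((p : ℤ) ^ a * k : ℤ) : ℚ) / D') • w = k • (((p : ℤ) ^ a * m') • w) := by
      simp only [← Int.cast_smul_eq_zsmul ℚ]
      push_cast
      match_scalars; field_simp
    rw [this]
    exact L.smul_mem _ hmw

/-- elements that are integral away from `p` -/
def Gp (Φ : V →ₗ[ℚ] V →ₗ[ℚ] ℚ) (L : Submodule ℤ V) (p : ℕ) (h : V ≃ₗ[ℚ] V) : Prop :=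
  h ∈ OG Φ ∧ ∀ q : ℕ, q.Prime → q ≠ p → EqAt q (act h L) L

lemma Gp_mul {Φ : V →ₗ[ℚ] V →ₗ[ℚ] ℚ} {L : Submodule ℤ V} {p : ℕ} {g h : V ≃ₗ[ℚ] V}
    (hg : Gp Φ L p g) (hh : Gp Φ L p h) : Gp Φ L p (g * h) := by
  refine ⟨mul_mem hg.1 hh.1, fun q hq hqp => ?_⟩
  rw [act_mul]
  exact ((hh.2 q hq hqp).act g).trans (hg.2 q hq hqp)

def Mon (Φ : V →ₗ[ℚ] V →ₗ[ℚ] ℚ) (L : Submodule ℤ V) (p : ℕ) (g : V ≃ₗ[ℚ] V) : Prop :=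
  ∀ h0, Gp Φ L p h0 → ∃ h, Gp Φ L p h ∧ EqAt p (act (g * h0) L) (act h L)

lemma Mon_mul {Φ : V →ₗ[ℚ] V →ₗ[ℚ] ℚ} {L : Submodule ℤ V} {p : ℕ} {g g' : V ≃ₗ[ℚ] V}
    (hg : Mon Φ L p g) (hh : Mon Φ L p g') : Mon Φ L p (g * g') := by
  intro h0 hh0
  obtain ⟨h1, hh1, e1⟩ := hh h0 hh0
  obtain ⟨h2, hh2, e2⟩ := hg h1 hh1
  refine ⟨h2, hh2, ?_⟩
  rw [mul_assoc, act_mul]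
  refine (e1.act g).trans ?_
  rw [← act_mul]; exact e2

lemma Mon_E {Φ : V →ₗ[ℚ] V →ₗ[ℚ] ℚ} (hs : ∀ x y, Φ x y = Φ y x) {L : Submodule ℤ V} (hfg : L.FG)
    (hspan : Submodule.span ℚ (L : Set V) = ⊤)
    (hint : ∀ x ∈ L, ∀ y ∈ L, ∃ n : ℤ, Φ x y = (n : ℚ))
    (heven : ∀ x ∈ L, ∃ n : ℤ, Φ x x = 2 * (n : ℚ)) {p : ℕ} (hp : p.Prime) {e w : V} (heL : e ∈ L)
    (he : Φ e e = 0) (hwe : Φ w e = 0) {g : V ≃ₗ[ℚ] V} (hg : IsE Φ e w g) : Mon Φ L p g := by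
  intro h0 hh0
  have hcl := clear_den L hspan
  obtain ⟨D, hD, hDL⟩ := den_of (P := act h0 L) hfg (fun v => by
    obtain ⟨m, hm, h⟩ := hcl (h0⁻¹ v)
    exact ⟨m, hm, by rw [mem_act, map_zsmul]; exact h⟩)
  obtain ⟨c, d, hc, hcd, hd⟩ := approx (L := L) hp w (hcl w) D hD
  have hcwe : Φ (c • w) e = 0 := by simp [hwe]
  obtain ⟨g', hg'⟩ := exists_IsE Φ hs e (c • w) he hcwe
  have hDe : Φ ((D : ℚ) • e) ((D : ℚ) • e) = 0 := by simp [he]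
  have hDw : Φ (((D : ℚ) * d) • w) ((D : ℚ) • e) = 0 := by simp [hwe]
  obtain ⟨g'', hg''⟩ := exists_IsE Φ hs ((D : ℚ) • e) (((D : ℚ) * d) • w) hDe hDw
  have hgg : g = g' * g'' := by
    ext x
    have h1 := IsE_smul hg''
    rw [smul_smul, ← hcd] at h1
    rw [LinearEquiv.mul_apply, IsE_eil h1, IsE_eil hg', eil_add Φ hs _ _ _ _ he hcwe (by simp [hwe]),
      ← add_smul, add_sub_cancel, one_smul, IsE_eil hg]
  have hint0 : ∀ x ∈ act h0 L, ∀ y ∈ act h0 L, ∃ n : ℤ, Φ x y = (n : ℚ) := by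
    intro x hx y hy
    have := hint _ hx _ hy
    change ∃ n : ℤ, Φ (h0⁻¹ x) (h0⁻¹ y) = n at this
    rwa [← hh0.1, app_inv, app_inv] at this
  have heven0 : ∀ x ∈ act h0 L, ∃ n : ℤ, Φ x x = 2 * (n : ℚ) := by
    intro x hx
    have := heven _ hx
    change ∃ n : ℤ, Φ (h0⁻¹ x) (h0⁻¹ x) = 2 * n at this
    rwa [← hh0.1, app_inv] at this
  refine ⟨g' * h0, Gp_mul ⟨IsE_mem hs he hcwe hg', fun q hq hqp => ?_⟩ hh0, ?_⟩
  · exact Epres hs hint heven hq heL he hcwe (hc q hq hqp) hg'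
  · rw [hgg, mul_assoc, act_mul, act_mul g' h0, act_mul]
    refine EqAt.act ?_ g'
    refine Epres hs hint0 heven0 hp ?_ hDe hDw ?_ hg''
    · rw [Int.cast_smul_eq_zsmul]; exact hDL e heL
    · obtain ⟨m, hm, h⟩ := hd
      refine ⟨m, hm, ?_⟩
      rw [mul_smul, Int.cast_smul_eq_zsmul, smul_comm]
      exact hDL _ h

lemma Mon_EG {Φ : V →ₗ[ℚ] V →ₗ[ℚ] ℚ} (hs : ∀ x y, Φ x y = Φ y x) {L : Submodule ℤ V} (hfg : L.FG)
    (hspan : Submodule.span ℚ (L : Set V) = ⊤)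
    (hint : ∀ x ∈ L, ∀ y ∈ L, ∃ n : ℤ, Φ x y = (n : ℚ))
    (heven : ∀ x ∈ L, ∃ n : ℤ, Φ x x = 2 * (n : ℚ)) {p : ℕ} (hp : p.Prime) {e f : V} (heL : e ∈ L)
    (hfL : f ∈ L) (he : Φ e e = 0) (hf : Φ f f = 0) (g : V ≃ₗ[ℚ] V) (hg : g ∈ EG Φ e f) :
    Mon Φ L p g ∧ Mon Φ L p g⁻¹ := by
  induction hg using Subgroup.closure_induction with
  | mem g hg =>
    obtain ⟨u, h1, h2, hE | hE⟩ := hg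
    · exact ⟨Mon_E hs hfg hspan hint heven hp heL he h1 hE,
        Mon_E hs hfg hspan hint heven hp heL he (by simp [h1]) (IsE_inv hs he h1 hE)⟩
    · exact ⟨Mon_E hs hfg hspan hint heven hp hfL hf h2 hE,
        Mon_E hs hfg hspan hint heven hp hfL hf (by simp [h2]) (IsE_inv hs hf h2 hE)⟩
  | one => rw [inv_one]; exact ⟨fun h hh => ⟨h, hh, by rw [one_mul]; exact EqAt.refl _ _⟩,
      fun h hh => ⟨h, hh, by rw [one_mul]; exact EqAt.refl _ _⟩⟩
  | mul x y _ _ hx hy => rw [mul_inv_rev]; exact ⟨Mon_mul hx.1 hy.1, Mon_mul hy.2 hx.2⟩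
  | inv x _ hx => rw [inv_inv]; exact ⟨hx.2, hx.1⟩

lemma sc_inv (Φ : V →ₗ[ℚ] V →ₗ[ℚ] ℚ) (e f : V) (t : ℚ) : (sc Φ e f t)⁻¹ = sc Φ e f t :=
  inv_eq_of_mul_eq_one_left (sv_sq Φ _)

lemma sc_loc {Φ : V →ₗ[ℚ] V →ₗ[ℚ] ℚ} (hs : ∀ x y, Φ x y = Φ y x) {L : Submodule ℤ V}
    {e f : V} {c : ℚ} (hc : c ≠ 0) (heL : e ∈ L) (hfL : f ∈ L)
    (he : Φ e e = 0) (hf : Φ f f = 0) (hef : Φ e f = c)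
    (hU : ∀ x ∈ L, ∃ a b : ℤ, ∃ k ∈ L, Φ e k = 0 ∧ Φ f k = 0 ∧ x = a • e + b • f + k)
    {q : ℕ} (hq : q.Prime) {a b : ℤ} (ha : ¬ (q : ℤ) ∣ a) (hb : ¬ (q : ℤ) ∣ b) :
    EqAt q (act (sc Φ e f ((a : ℚ) / b)) L) L := by
  have ha0 : (a : ℚ) ≠ 0 := by
    intro h; apply ha; have : a = 0 := by exact_mod_cast h
    simp [this]
  have hb0 : (b : ℚ) ≠ 0 := by
    intro h; apply hb; have : b = 0 := by exact_mod_cast h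
    simp [this]
  have key : ∀ x ∈ L, InLoc q L (sc Φ e f ((a : ℚ) / b) x) := by
    intro x hx
    obtain ⟨α, β, k, hk, h1, h2, rfl⟩ := hU x hx
    obtain ⟨v1, v2, v3⟩ := sc_vals Φ hs e f c hc he hf hef ((a : ℚ) / b) (div_ne_zero ha0 hb0)
    refine ⟨a * b, fun h => ((Nat.prime_iff_prime_int.mp hq).dvd_or_dvd h).elim ha hb, ?_⟩
    rw [map_add, map_add, map_zsmul, map_zsmul, v1, v2, v3 k (by rw [hs, h1]) (by rw [hs, h2])]
    have : (a * b) • (α • ((a : ℚ) / b) • f + β • ((a : ℚ) / b)⁻¹ • e + k)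
        = (α * (a * a)) • f + (β * (b * b)) • e + (a * b) • k := by
      simp only [← Int.cast_smul_eq_zsmul ℚ]
      push_cast
      match_scalars <;> field_simp
    rw [this]
    exact add_mem (add_mem (L.smul_mem _ hfL) (L.smul_mem _ heL)) (L.smul_mem _ hk)
  refine eqAt_of hq key ?_
  rw [sc_inv]; exact key

lemma approx_OG [FiniteDimensional ℚ V] {Φ : V →ₗ[ℚ] V →ₗ[ℚ] ℚ} (hs : ∀ x y, Φ x y = Φ y x)
    {n : ℕ} (B : Basis (Fin n) ℚ V) (ho : ∀ i j, i ≠ j → Φ (B i) (B j) = 0)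
    (hne : ∀ i, Φ (B i) (B i) ≠ 0) {L : Submodule ℤ V} (hfg : L.FG)
    (hspan : Submodule.span ℚ (L : Set V) = ⊤)
    (hint : ∀ x ∈ L, ∀ y ∈ L, ∃ n : ℤ, Φ x y = (n : ℚ))
    (heven : ∀ x ∈ L, ∃ n : ℤ, Φ x x = 2 * (n : ℚ))
    {e f : V} {c : ℚ} (hc : c ≠ 0) (heL : e ∈ L) (hfL : f ∈ L)
    (he : Φ e e = 0) (hf : Φ f f = 0) (hef : Φ e f = c)
    (hU : ∀ x ∈ L, ∃ a b : ℤ, ∃ k ∈ L, Φ e k = 0 ∧ Φ f k = 0 ∧ x = a • e + b • f + k)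
    {p : ℕ} (hp : p.Prime) (g : V ≃ₗ[ℚ] V) (hg : g ∈ OG Φ) :
    ∃ h, Gp Φ L p h ∧ EqAt p (act g L) (act h L) := by
  have hO : ∀ t, sc Φ e f t ∈ OG Φ := fun t => sv_mem Φ hs _
  have n1 : ∀ q : ℕ, q.Prime → ¬ (q : ℤ) ∣ 1 := by
    intro q hq h
    exact hq.one_lt.ne' (by exact_mod_cast Int.eq_one_of_dvd_one (by positivity) h)
  have one_loc : ∀ q : ℕ, q.Prime → EqAt q (act (sc Φ e f 1) L) L := by
    intro q hq
    have := sc_loc hs hc heL hfL he hf hef hU hq (n1 q hq) (n1 q hq)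
    simpa using this
  have hsc : ∀ t : ℚ, t ≠ 0 → ∃ h, Gp Φ L p h ∧ EqAt p (act (sc Φ e f t) L) (act h L) := by
    intro t ht
    obtain ⟨i, a, hia, ha⟩ := split_pow hp (Rat.num_ne_zero.mpr ht)
    obtain ⟨j, b, hjb, hb⟩ := split_pow (m := (t.den : ℤ)) hp (by exact_mod_cast t.den_ne_zero)
    have hp0 : (p : ℚ) ≠ 0 := by exact_mod_cast hp.ne_zero
    have ha0 : (a : ℚ) ≠ 0 := by
      intro h; apply ha; have : a = 0 := by exact_mod_cast h
      simp [this]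
    have hb0 : (b : ℚ) ≠ 0 := by
      intro h; apply hb; have : b = 0 := by exact_mod_cast h
      simp [this]
    have htt : t = (p ^ i * a) / (p ^ j * b) := by
      have h1 : (t.num : ℚ) = p ^ i * a := by exact_mod_cast hia
      have h2 : (t.den : ℚ) = p ^ j * b := by exact_mod_cast hjb
      rw [← h1, ← h2, Rat.num_div_den]
    set P : ℚ := (((p : ℤ) ^ i : ℤ) : ℚ) / (((p : ℤ) ^ j : ℤ) : ℚ) with hP
    have hP' : P = (p : ℚ) ^ i / (p : ℚ) ^ j := by rw [hP]; push_cast; rfl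
    have hP0 : P ≠ 0 := by rw [hP']; positivity
    refine ⟨sc Φ e f P, ⟨hO P, fun q hq hqp => ?_⟩, ?_⟩
    · exact sc_loc hs hc heL hfL he hf hef hU hq (not_dvd_pow hp hq hqp i) (not_dvd_pow hp hq hqp j)
    · have h1 : sc Φ e f t = sc Φ e f P * (sc Φ e f 1 * sc Φ e f ((a : ℚ) / b)) := by
        have : (a : ℚ) / b = t / P := by rw [hP', htt]; field_simp
        rw [this, ← sc_mul Φ hs e f c hc he hf hef P t hP0 ht, ← mul_assoc]
        have h2 : sc Φ e f P * sc Φ e f P = 1 := sv_sq Φ _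
        rw [h2, one_mul]
      rw [h1, act_mul]
      refine EqAt.act ?_ _
      rw [act_mul]
      exact ((sc_loc hs hc heL hfL he hf hef hU hp ha hb).act _).trans (one_loc p hp)
  obtain ⟨ε, hε, t, ht, h⟩ := normal_form Φ hs n B ho hne e f c hc he hf hef g hg
  have hd : ∃ d, g = ε * d ∧ ∃ h, Gp Φ L p h ∧ EqAt p (act d L) (act h L) := by
    rcases h with h | h
    · exact ⟨_, h, hsc t ht⟩
    · refine ⟨_, h, ?_⟩
      obtain ⟨h, h1, h2⟩ := hsc t ht
      refine ⟨sc Φ e f 1 * h, Gp_mul ⟨hO 1, fun q hq _ => one_loc q hq⟩ h1, ?_⟩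
      rw [act_mul, act_mul]; exact h2.act _
  obtain ⟨d, rfl, h0, hh0, e0⟩ := hd
  obtain ⟨h1, hh1, e1⟩ := (Mon_EG hs hfg hspan hint heven hp heL hfL he hf ε hε).1 h0 hh0
  refine ⟨h1, hh1, ?_⟩
  rw [act_mul]
  refine (e0.act ε).trans ?_
  rw [← act_mul]; exact e1

lemma all_loc {L : Submodule ℤ V} {x : V} (h : ∀ p : ℕ, p.Prime → InLoc p L x) : x ∈ L := by
  let I : Ideal ℤ := L.comap (LinearMap.toSpanSingleton ℤ V x)
  have hI : ∀ m : ℤ, m ∈ I ↔ m • x ∈ L := fun m => Iff.rfl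
  obtain ⟨d, hd⟩ := (IsPrincipalIdealRing.principal I).principal
  have hd' : ∀ m : ℤ, m ∈ I ↔ d ∣ m := by
    intro m; rw [hd]; exact Ideal.mem_span_singleton
  have h1 : d.natAbs = 1 := by
    by_contra hne
    obtain ⟨p, hp, hpd⟩ := Nat.exists_prime_and_dvd hne
    obtain ⟨m, hm, hmx⟩ := h p hp
    exact hm ((Int.natCast_dvd.mpr hpd).trans ((hd' m).mp ((hI m).mpr hmx)))
  have := (hI 1).mp ((hd' 1).mpr (Int.isUnit_iff_natAbs_eq.mpr h1).dvd)
  simpa using this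

lemma eq_of_eqAt {L M : Submodule ℤ V} (h : ∀ p : ℕ, p.Prime → EqAt p L M) : L = M := by
  ext x
  exact ⟨fun hx => all_loc fun p hp => (h p hp x).mp (inLoc_of_mem hp hx),
    fun hx => all_loc fun p hp => (h p hp x).mpr (inLoc_of_mem hp hx)⟩

lemma strong {Φ : V →ₗ[ℚ] V →ₗ[ℚ] ℚ} {L : Submodule ℤ V}
    (H : ∀ p : ℕ, p.Prime → ∀ g ∈ OG Φ, ∃ h, Gp Φ L p h ∧ EqAt p (act g L) (act h L))
    (T : Finset ℕ) : ∀ L1 : Submodule ℤ V,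
    (∀ p : ℕ, p.Prime → ∃ g ∈ OG Φ, EqAt p L1 (act g L)) →
    (∀ q : ℕ, q.Prime → q ∉ T → EqAt q L1 L) → ∃ g ∈ OG Φ, L1 = act g L := by
  induction T using Finset.induction_on with
  | empty =>
    intro L1 _ h
    exact ⟨1, one_mem _, by rw [act_one]; exact eq_of_eqAt fun p hp => h p hp (by simp)⟩
  | insert p T _ ih =>
    intro L1 h1 h2
    by_cases hp : p.Prime
    · obtain ⟨g, hg, e1⟩ := h1 p hp
      obtain ⟨h, hh, e2⟩ := H p hp g hg
      have hback : ∀ q, EqAt q L1 (act h L) → EqAt q (act h⁻¹ L1) L := by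
        intro q hq
        have := hq.act h⁻¹
        rwa [← act_mul, inv_mul_cancel, act_one] at this
      obtain ⟨k, hk, e3⟩ := ih (act h⁻¹ L1) (fun q hq => by
        obtain ⟨k, hk, e⟩ := h1 q hq
        exact ⟨h⁻¹ * k, mul_mem (inv_mem hh.1) hk, by rw [act_mul]; exact e.act _⟩) (fun q hq hqT => by
        by_cases hqp : q = p
        · subst hqp; exact hback q (e1.trans e2)
        · exact hback q ((h2 q hq (by simp [hqp, hqT])).trans (hh.2 q hq hqp).symm))
      refine ⟨h * k, mul_mem hh.1 hk, ?_⟩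
      rw [act_mul, ← e3, ← act_mul, mul_inv_cancel, act_one]
    · refine ih L1 h1 fun q hq hqT => h2 q hq ?_
      rw [Finset.mem_insert]
      rintro (rfl | h)
      · exact hp hq
      · exact hqT h

lemma bad_finite {L L1 : Submodule ℤ V} (hfg : L.FG) (hfg1 : L1.FG)
    (h : ∀ v : V, ∃ m : ℤ, m ≠ 0 ∧ m • v ∈ L) (h1 : ∀ v : V, ∃ m : ℤ, m ≠ 0 ∧ m • v ∈ L1) :
    ∃ T : Finset ℕ, ∀ q : ℕ, q.Prime → q ∉ T → EqAt q L1 L := by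
  obtain ⟨D, hD, hDL⟩ := den_of hfg h1
  obtain ⟨D1, hD1, hDL1⟩ := den_of hfg1 h
  refine ⟨(D * D1).natAbs.primeFactors, fun q hq hqT => ?_⟩
  have hn : ¬ (q : ℤ) ∣ D * D1 := by
    intro hd
    exact hqT (Nat.mem_primeFactors.mpr ⟨hq, Int.natCast_dvd.mp hd, by simp [hD, hD1]⟩)
  have hnD : ¬ (q : ℤ) ∣ D := fun h => hn (h.mul_right _)
  have hnD1 : ¬ (q : ℤ) ∣ D1 := fun h => hn (h.mul_left _)
  intro x
  constructor
  · rintro ⟨m, hm, hx⟩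
    exact inLoc_of_zsmul hq hm (inLoc_of_zsmul hq hnD1 (inLoc_of_mem hq (hDL1 _ hx)))
  · rintro ⟨m, hm, hx⟩
    exact inLoc_of_zsmul hq hm (inLoc_of_zsmul hq hnD (inLoc_of_mem hq (hDL _ hx)))

end
end Nik

/-- Nikulin's one-class genus criterion.  Let `L ⊆ V` and `L' ⊆ V'` be non-degenerate
even lattices with `rank L ≥ 3` having the same signature `(tp, tm)`, and suppose there
is a group isomorphism `A(L) ≅ A(L')` identifying the discriminant quadratic forms.
If `L ≅ U(n) ⊕ L''` for some positive integer `n` (an orthogonal direct summand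
spanned by isotropic `e, f ∈ L` with `⟨e,f⟩ = n`), then `L ≅ L'` as lattices. -/
theorem stmt_5 {V V' : Type*} [AddCommGroup V] [Module ℚ V] [FiniteDimensional ℚ V]
    [AddCommGroup V'] [Module ℚ V'] [FiniteDimensional ℚ V']
    (Φ : V →ₗ[ℚ] V →ₗ[ℚ] ℚ) (Φ' : V' →ₗ[ℚ] V' →ₗ[ℚ] ℚ)
    (hsymm : ∀ x y, Φ x y = Φ y x) (hsymm' : ∀ x y, Φ' x y = Φ' y x)
    (hnd : ∀ x : V, (∀ y, Φ x y = 0) → x = 0)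
    (hnd' : ∀ x : V', (∀ y, Φ' x y = 0) → x = 0)
    (L : Submodule ℤ V) (hfg : L.FG)
    (hspan : Submodule.span ℚ (L : Set V) = ⊤)
    (hint : ∀ x ∈ L, ∀ y ∈ L, ∃ n : ℤ, Φ x y = (n : ℚ))
    (heven : ∀ x ∈ L, ∃ n : ℤ, Φ x x = 2 * (n : ℚ))
    (L' : Submodule ℤ V') (hfg' : L'.FG)
    (hspan' : Submodule.span ℚ (L' : Set V') = ⊤)
    (hint' : ∀ x ∈ L', ∀ y ∈ L', ∃ n : ℤ, Φ' x y = (n : ℚ))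
    (heven' : ∀ x ∈ L', ∃ n : ℤ, Φ' x x = 2 * (n : ℚ))
    (hrank : 3 ≤ Module.finrank ℚ V)
    (tp tm : ℕ) (hsig : hasSignature Φ tp tm) (hsig' : hasSignature Φ' tp tm)
    (hdisc : ∃ g : discGroup Φ L ≃+ discGroup Φ' L',
      ∀ (x : ↥(dualLattice Φ L)) (y : ↥(dualLattice Φ' L')),
        g (Submodule.Quotient.mk x) = Submodule.Quotient.mk y →
        ∃ n : ℤ, Φ' (y : V') (y : V') - Φ (x : V) (x : V) = 2 * (n : ℚ))
    (n : ℕ) (hn : 0 < n)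
    (hU : ∃ e f : V, e ∈ L ∧ f ∈ L ∧ Φ e e = 0 ∧ Φ f f = 0 ∧ Φ e f = (n : ℚ) ∧
      ∀ x ∈ L, ∃ a b : ℤ, ∃ k ∈ L, Φ e k = 0 ∧ Φ f k = 0 ∧ x = a • e + b • f + k) :
    ∃ F : ↥L ≃+ ↥L', ∀ x y : ↥L, Φ' (F x : V') (F y : V') = Φ (x : V) (y : V) := by
  classical
  obtain ⟨e, f, heL, hfL, he, hf, hef, hU⟩ := hU
  have hn0 : (n : ℚ) ≠ 0 := by exact_mod_cast hn.ne'
  obtain ⟨Γ, hΓfg, hsd, hev, hL, hL'⟩ := Nik.glue Φ Φ' hsymm hsymm' hnd hnd' L hfg hspan hint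
    L' hfg' hspan' hint' hdisc
  have hcl := Nik.clear_den L hspan
  have hcl' := Nik.clear_den L' hspan'
  have hΓspan : Submodule.span ℚ (Γ : Set (V × V')) = ⊤ := by
    rw [eq_top_iff]
    rintro ⟨x, y⟩ -
    obtain ⟨m, hm, hmx⟩ := hcl x
    obtain ⟨m', hm', hmy⟩ := hcl' y
    have h1 : (m • x, (0 : V')) ∈ Submodule.span ℚ (Γ : Set (V × V')) :=
      Submodule.subset_span ((hL _).mpr hmx)
    have h2 : ((0 : V), m' • y) ∈ Submodule.span ℚ (Γ : Set (V × V')) :=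
      Submodule.subset_span ((hL' _).mpr hmy)
    have hm0 : (m : ℚ) ≠ 0 := by exact_mod_cast hm
    have hm0' : (m' : ℚ) ≠ 0 := by exact_mod_cast hm'
    have e : (x, y) = (m : ℚ)⁻¹ • (m • x, (0 : V')) + (m' : ℚ)⁻¹ • ((0 : V), m' • y) := by
      ext
      · simp only [Prod.fst_add, Prod.smul_fst, smul_zero, add_zero]
        rw [← Int.cast_smul_eq_zsmul ℚ, smul_smul, inv_mul_cancel₀ hm0, one_smul]
      · simp only [Prod.snd_add, Prod.smul_snd, smul_zero, zero_add]
        rw [← Int.cast_smul_eq_zsmul ℚ, smul_smul, inv_mul_cancel₀ hm0', one_smul]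
    rw [e]
    exact add_mem (Submodule.smul_mem _ _ h1) (Submodule.smul_mem _ _ h2)
  have hps : ∀ x y, Nik.psi Φ Φ' x y = Nik.psi Φ Φ' y x := by
    intro x y
    rw [Nik.psi_apply, Nik.psi_apply, hsymm, hsymm']
  have hpnd : ∀ x : V × V', (∀ y, Nik.psi Φ Φ' x y = 0) → x = 0 := by
    intro x hx
    refine Prod.ext (hnd _ fun y => ?_) (hnd' _ fun y => ?_)
    · have := hx (y, 0)
      simpa [Nik.psi_apply] using this
    · have := hx (0, y)
      simpa [Nik.psi_apply] using this
  obtain ⟨N, hN, hN2⟩ := Nik.lagr_exists Φ Φ' tp tm hsig hsig' Γ hΓfg hsd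
  obtain ⟨r, θ, hθ, hθs, hθh, hfr⟩ := Nik.hyp_coord (Nik.psi Φ Φ') (Nik.nondeg_of _ hps hpnd) hps Γ hΓfg
    hΓspan hsd hev N hN hN2
  obtain ⟨B, ho, hsq⟩ := hsig
  obtain ⟨B', -, -⟩ := hsig'
  have hr1 : Module.finrank ℚ V = tp + tm := by rw [Module.finrank_eq_card_basis B, Fintype.card_fin]
  have hr2 : Module.finrank ℚ V' = tp + tm := by rw [Module.finrank_eq_card_basis B', Fintype.card_fin]
  rw [Module.finrank_prod] at hfr
  have hr : Module.finrank ℚ V = r := by omega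
  have hr' : Module.finrank ℚ V' = r := by omega
  have hne : ∀ i, Φ (B i) (B i) ≠ 0 := by
    intro i
    rcases lt_or_ge (i : ℕ) tp with h | h
    · exact ((hsq i).1 h).ne'
    · exact ((hsq i).2 h).ne
  have hloc := fun p hp => Nik.local_iso Φ Φ' L hfg hspan L' Γ hsd hL hL' r hr hr' θ hθ hθs hθh p hp
  obtain ⟨τ, hτ, -⟩ := hloc 2 Nat.prime_two
  have hτs : ∀ x y, Φ' (τ.symm x) (τ.symm y) = Φ x y := by
    intro x y
    rw [← hτ, τ.apply_symm_apply, τ.apply_symm_apply]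
  let L1 : Submodule ℤ V := L'.map (τ.toLinearMap.restrictScalars ℤ)
  have hL1 : ∀ x, x ∈ L1 ↔ τ.symm x ∈ L' := by
    intro x
    constructor
    · rintro ⟨y, hy, rfl⟩
      change τ.symm (τ y) ∈ L'
      rw [τ.symm_apply_apply]; exact hy
    · intro h
      exact ⟨_, h, τ.apply_symm_apply x⟩
  have hL1loc : ∀ (p : ℕ) x, Nik.InLoc p L1 x ↔ Nik.InLoc p L' (τ.symm x) := by
    intro p x
    simp only [Nik.InLoc, hL1, map_zsmul]
  have hL1den : ∀ v : V, ∃ m : ℤ, m ≠ 0 ∧ m • v ∈ L1 := by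
    intro v
    obtain ⟨m, hm, h⟩ := hcl' (τ.symm v)
    exact ⟨m, hm, by rw [hL1, map_zsmul]; exact h⟩
  obtain ⟨T, hT⟩ := Nik.bad_finite hfg (hfg'.map _) hcl hL1den
  have H : ∀ p : ℕ, p.Prime → ∀ g ∈ Nik.OG Φ, ∃ h, Nik.Gp Φ L p h ∧
      Nik.EqAt p (Nik.act g L) (Nik.act h L) := fun p hp g hg =>
    Nik.approx_OG hsymm B ho hne hfg hspan hint heven hn0 heL hfL he hf hef hU hp g hg
  obtain ⟨g, hg, hgL⟩ := Nik.strong H T L1 (fun p hp => by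
    obtain ⟨σ, hσ, hσL⟩ := hloc p hp
    refine ⟨σ.symm.trans τ, ?_, ?_⟩
    · intro x y
      change Φ (τ (σ.symm x)) (τ (σ.symm y)) = Φ x y
      rw [hτ, ← hσ, σ.apply_symm_apply, σ.apply_symm_apply]
    · intro x
      rw [Nik.inLoc_act, hL1loc, hσL]
      rfl) hT
  have hmem : ∀ x : V, x ∈ L ↔ τ.symm (g x) ∈ L' := by
    intro x
    rw [← hL1, hgL, Nik.mem_act, Nik.inv_app]
  refine ⟨{ toFun := fun x => ⟨τ.symm (g x), (hmem x).mp x.2⟩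
            invFun := fun y => ⟨g.symm (τ y), (hmem _).mpr (by simp)⟩
            left_inv := fun x => by simp
            right_inv := fun y => by simp
            map_add' := fun x y => by ext; simp }, fun x y => ?_⟩
  change Φ' (τ.symm (g x)) (τ.symm (g y)) = Φ x y
  rw [hτs, hg]
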